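/- Let d ≥ 1, let 1 < p, q < ∞, and let s, k₁, k₂ ∈ ℝ with k := k₁ + k₂. Assume k₁ > d·max(0, 1/q − 1/p) and p ≤ 2q. Then there exists a constant C > 0, independent of τ, such that for every τ ≥ 0 and all Schwartz functions A, B on ℝ^d, setting a := e^{−τΛ₁}A and b := e^{−τΛ₁}B, one has ‖e^{τΛ₁}(T_a b)‖_{Ḃ^{s−k+d/q−d/p}_{q,∞}} ≤ C·‖A‖_{Ḃ^{d/p−k₁}_{p,∞}}·‖B‖_{Ḃ^{s−k₂}_{p,∞}}. -/

import Mathlib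

open MeasureTheory SchwartzMap Real
open scoped FourierTransform ENNReal NNReal

noncomputable section

abbrev Rd (d : ℕ) := EuclideanSpace ℝ (Fin d)

/-- Homogeneous Littlewood–Paley block Δ_j f = 𝓕⁻¹(φ(2^{-j}·)·𝓕 f). -/
def LPblock (d : ℕ) (φ : Rd d → ℝ) (j : ℤ) (f : Rd d → ℂ) : Rd d → ℂ :=
  𝓕⁻ fun ξ => (φ (((2:ℝ) ^ (-j)) • ξ) : ℂ) * 𝓕 f ξ

/-- ℓ^r norm (over ℤ) of a sequence of extended nonnegative reals. -/
def seqNorm (r : ℝ≥0∞) (u : ℤ → ℝ≥0∞) : ℝ≥0∞ :=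
  if r = ∞ then ⨆ j, u j else (∑' j, u j ^ r.toReal) ^ (1 / r.toReal)

/-- Homogeneous Besov norm ‖f‖_{Ḃ^s_{p,r}}. -/
def besovNorm (d : ℕ) (φ : Rd d → ℝ) (s : ℝ) (p r : ℝ≥0∞) (f : Rd d → ℂ) : ℝ≥0∞ :=
  seqNorm r fun j =>
    ENNReal.ofReal ((2:ℝ) ^ ((j : ℝ) * s)) * eLpNorm (LPblock d φ j f) p volume

/-- Low-frequency cut-off Ṡ_{j-1} f = ∑_{k ≤ j-2} Δ_k f. -/
def lowFreq (d : ℕ) (φ : Rd d → ℝ) (j : ℤ) (f : Rd d → ℂ) : Rd d → ℂ :=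
  fun x => ∑' k : ℤ, if k ≤ j - 2 then LPblock d φ k f x else 0

/-- Bony paraproduct T_a b = ∑_j Ṡ_{j-1}a · Δ_j b. -/
def para (d : ℕ) (φ : Rd d → ℝ) (a b : Rd d → ℂ) : Rd d → ℂ :=
  fun x => ∑' j : ℤ, lowFreq d φ j a x * LPblock d φ j b x

/-- Bony remainder R(a,b) = ∑_j (Δ_{j-1}a + Δ_j a + Δ_{j+1}a)·Δ_j b. -/
def remainder (d : ℕ) (φ : Rd d → ℝ) (a b : Rd d → ℂ) : Rd d → ℂ :=
  fun x => ∑' j : ℤ,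
    (LPblock d φ (j-1) a x + LPblock d φ j a x + LPblock d φ (j+1) a x) * LPblock d φ j b x

/-- Gevrey multiplier e^{τΛ₁} with symbol e^{τ|ξ|₁}, |ξ|₁ = ∑ᵢ|ξᵢ|. -/
def expL1 (d : ℕ) (τ : ℝ) (f : Rd d → ℂ) : Rd d → ℂ :=
  𝓕⁻ fun ξ => (Real.exp (τ * ∑ i, |ξ i|) : ℂ) * 𝓕 f ξ

/-- Young's inequality `L¹ * Lᵖ ⊆ Lᵖ` for nonnegative functions. -/
lemma lintegral_conv_rpow_le {G : Type*} [AddCommGroup G] [MeasurableSpace G] [MeasurableAdd₂ G]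
    [MeasurableNeg G] (μ : Measure G) [SFinite μ] [μ.IsAddLeftInvariant] {p : ℝ} (hp : 1 < p)
    {K g : G → ℝ≥0∞} (hK : Measurable K) (hg : Measurable g) :
    ∫⁻ x, (∫⁻ u, K u * g (x - u) ∂μ) ^ p ∂μ ≤ (∫⁻ u, K u ∂μ) ^ p * ∫⁻ x, g x ^ p ∂μ := by
  have hp0 : 0 < p := by linarith
  have hpq := Real.HolderConjugate.conjExponent hp
  set q := p.conjExponent
  have hq0 : 0 < q := hpq.symm.pos
  have hsum : 1 / q + 1 / p = 1 := by
    have := hpq.symm.inv_add_inv_eq_one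
    simpa [one_div] using this
  have hmeas (x : G) : Measurable fun u => g (x - u) := hg.comp (measurable_const.sub measurable_id)
  have key (x : G) : (∫⁻ u, K u * g (x - u) ∂μ) ^ p
      ≤ (∫⁻ u, K u ∂μ) ^ (p - 1) * ∫⁻ u, K u * g (x - u) ^ p ∂μ := by
    have h1 := ENNReal.lintegral_mul_le_Lp_mul_Lq μ hpq.symm
      (f := fun u => K u ^ (1 / q)) (g := fun u => K u ^ (1 / p) * g (x - u))
      (hK.pow_const _).aemeasurable (((hK.pow_const _).mul (hmeas x))).aemeasurable
    have e1 (u : G) : ((fun u => K u ^ (1 / q)) * fun u => K u ^ (1 / p) * g (x - u)) u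
        = K u * g (x - u) := by
      simp only [Pi.mul_apply]
      rw [← mul_assoc, ← ENNReal.rpow_add_of_nonneg _ _ (by positivity) (by positivity), hsum,
        ENNReal.rpow_one]
    have e2 (u : G) : (K u ^ (1 / q)) ^ q = K u := by
      rw [← ENNReal.rpow_mul, one_div, inv_mul_cancel₀ hq0.ne', ENNReal.rpow_one]
    have e3 (u : G) : (K u ^ (1 / p) * g (x - u)) ^ p = K u * g (x - u) ^ p := by
      rw [ENNReal.mul_rpow_of_nonneg _ _ hp0.le, ← ENNReal.rpow_mul, one_div,
        inv_mul_cancel₀ hp0.ne', ENNReal.rpow_one]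
    simp only [e1, e2, e3] at h1
    calc _ ≤ ((∫⁻ u, K u ∂μ) ^ (1 / q) * (∫⁻ u, K u * g (x - u) ^ p ∂μ) ^ (1 / p)) ^ p := by
          gcongr
      _ = _ := by
          rw [ENNReal.mul_rpow_of_nonneg _ _ hp0.le, ← ENNReal.rpow_mul, ← ENNReal.rpow_mul,
            one_div_mul_cancel hp0.ne', ENNReal.rpow_one]
          congr 2
          have : 1 / q = 1 - 1 / p := by linarith
          rw [this]; field_simp
  have hm : Measurable (Function.uncurry fun x u => K u * g (x - u) ^ p) :=
    (hK.comp measurable_snd).mul ((hg.comp (measurable_fst.sub measurable_snd)).pow_const _)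
  calc _ ≤ ∫⁻ x, (∫⁻ u, K u ∂μ) ^ (p - 1) * ∫⁻ u, K u * g (x - u) ^ p ∂μ ∂μ :=
        lintegral_mono key
    _ = (∫⁻ u, K u ∂μ) ^ (p - 1) * ∫⁻ x, ∫⁻ u, K u * g (x - u) ^ p ∂μ ∂μ :=
        lintegral_const_mul _ hm.lintegral_prod_right'
    _ = (∫⁻ u, K u ∂μ) ^ (p - 1) * ((∫⁻ u, K u ∂μ) * ∫⁻ x, g x ^ p ∂μ) := by
        congr 1
        rw [lintegral_lintegral_swap hm.aemeasurable]
        rw [← lintegral_mul_const _ hK]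
        refine lintegral_congr fun u => ?_
        have hm' : Measurable fun x => g (x - u) ^ p :=
          (hg.comp (measurable_id.sub measurable_const)).pow_const _
        rw [lintegral_const_mul _ hm']
        congr 1
        exact lintegral_sub_right_eq_self (fun x => g x ^ p) u
    _ = _ := by
        rw [← mul_assoc]
        congr 1
        conv_lhs => rw [← ENNReal.rpow_one (∫⁻ u, K u ∂μ)]
        rw [← ENNReal.rpow_mul, one_mul, ← ENNReal.rpow_add_of_nonneg _ _ (by linarith) zero_le_one]
        simp

lemma exists_norm_rpow_le_re_rpow_sub_re_cpow {p : ℝ} (hp1 : 1 < p) (hp2 : p ≤ 2) :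
    ∃ A B : ℝ, 0 ≤ A ∧ 0 ≤ B ∧ ∀ z : ℂ, 0 < z.re →
      ‖z‖ ^ p ≤ A * z.re ^ p - B * (z ^ (p : ℂ)).re := by
  have hc : Real.cos (p * (π / 2)) < 0 := by
    apply Real.cos_neg_of_pi_div_two_lt_of_lt <;> nlinarith [Real.pi_pos]
  set c := - Real.cos (p * (π / 2)) with hcdef
  have hc0 : 0 < c := by linarith
  have hcont : ContinuousAt (fun θ : ℝ => Real.cos (p * θ)) (π / 2) := by fun_prop
  have hev : ∀ᶠ θ in nhds (π / 2), Real.cos (p * θ) < - (c / 2) :=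
    hcont.eventually (gt_mem_nhds (by simp only [hcdef]; linarith))
  obtain ⟨δ, hδ, hball⟩ := Metric.eventually_nhds_iff.1 hev
  set θ₀ := max 0 (π / 2 - δ / 2) with hθ₀
  have hθ₀1 : θ₀ < π / 2 := max_lt (by positivity) (by linarith)
  have hθ₀0 : 0 ≤ θ₀ := le_max_left _ _
  have hcos0 : 0 < Real.cos θ₀ := Real.cos_pos_of_mem_Ioo ⟨by linarith [Real.pi_pos], hθ₀1⟩
  refine ⟨(1 + 2 / c) / Real.cos θ₀ ^ p, 2 / c, by positivity, by positivity, fun z hz => ?_⟩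
  have hz0 : z ≠ 0 := by rintro rfl; simp at hz
  have hn : 0 < ‖z‖ := norm_pos_iff.2 hz0
  have hre : z.re = ‖z‖ * Real.cos (Complex.arg z) := by
    rw [Complex.cos_arg hz0]; field_simp
  have harg : |Complex.arg z| < π / 2 := Complex.abs_arg_lt_pi_div_two_iff.2 (Or.inl hz)
  have hcp : (z ^ (p : ℂ)).re = ‖z‖ ^ p * Real.cos (p * Complex.arg z) := by
    rw [Complex.cpow_def_of_ne_zero hz0]
    rw [Complex.exp_re]
    simp only [Complex.mul_re, Complex.mul_im, Complex.log_re, Complex.log_im, Complex.ofReal_re,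
      Complex.ofReal_im, mul_zero, sub_zero, zero_add]
    rw [Real.rpow_def_of_pos hn]
    congr 2
    ring
  have hcosarg : 0 < Real.cos (Complex.arg z) :=
    Real.cos_pos_of_mem_Ioo ⟨by linarith [(abs_lt.1 harg).1], (abs_lt.1 harg).2⟩
  rw [hcp, hre, Real.mul_rpow hn.le hcosarg.le]
  have hnp : 0 < ‖z‖ ^ p := Real.rpow_pos_of_pos hn _
  suffices h : 1 ≤ (1 + 2 / c) / Real.cos θ₀ ^ p * Real.cos (Complex.arg z) ^ p
      - 2 / c * Real.cos (p * Complex.arg z) by nlinarith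
  rcases le_total |Complex.arg z| θ₀ with h | h
  · have h1 : Real.cos θ₀ ≤ Real.cos (Complex.arg z) := by
      rw [← Real.cos_abs (Complex.arg z)]
      exact Real.cos_le_cos_of_nonneg_of_le_pi (abs_nonneg _) (by linarith [Real.pi_pos]) h
    have h2 : Real.cos θ₀ ^ p ≤ Real.cos (Complex.arg z) ^ p :=
      Real.rpow_le_rpow hcos0.le h1 (by linarith)
    have h3 : 1 + 2 / c ≤ (1 + 2 / c) / Real.cos θ₀ ^ p * Real.cos (Complex.arg z) ^ p := by
      rw [div_mul_eq_mul_div, le_div_iff₀ (by positivity)]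
      gcongr
    have h4 : 2 / c * Real.cos (p * Complex.arg z) ≤ 2 / c * 1 := by
      gcongr; exact Real.cos_le_one _
    linarith
  · have h1 : Real.cos (p * Complex.arg z) < - (c / 2) := by
      have : Real.cos (p * Complex.arg z) = Real.cos (p * |Complex.arg z|) := by
        rw [← Real.cos_abs, abs_mul, abs_of_pos (by linarith : 0 < p)]
      rw [this]
      apply hball
      rw [Real.dist_eq, abs_sub_lt_iff]
      have : π / 2 - δ / 2 ≤ θ₀ := le_max_right _ _
      constructor <;> linarith
    have h2 : 2 / c * Real.cos (p * Complex.arg z) ≤ 2 / c * (-(c / 2)) := by gcongr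
    have h3 : 2 / c * (-(c / 2)) = -1 := by field_simp
    have h4 : 0 ≤ (1 + 2 / c) / Real.cos θ₀ ^ p * Real.cos (Complex.arg z) ^ p := by positivity
    linarith

lemma integral_horizontal_eq_zero {G : ℂ → ℂ} {y p C : ℝ} (hy : 0 < y) (hp : 1 < p)
    (hG : DifferentiableOn ℂ G {z | 0 < z.im})
    (hC : ∀ z : ℂ, y ≤ z.im → ‖G z‖ ≤ C * (1 + ‖z‖) ^ (-p)) :
    Integrable (fun x : ℝ => G (x + y * Complex.I)) ∧ ∫ x : ℝ, G (x + y * Complex.I) = 0 := by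
  have hC0 : 0 ≤ C := by
    have := (norm_nonneg _).trans (hC (y * Complex.I) (by simp))
    exact nonneg_of_mul_nonneg_left this (by positivity)
  have hbd (z : ℂ) (hz : y ≤ z.im) (R : ℝ) (hR : 0 < R) (hzR : R ≤ ‖z‖) :
      ‖G z‖ ≤ C * R ^ (-p) := by
    refine (hC z hz).trans ?_
    gcongr ?_ * ?_
    exact Real.rpow_le_rpow_of_nonpos hR (by linarith) (by linarith)
  have hInt : Integrable (fun x : ℝ => G (x + y * Complex.I)) := by
    have h1 : Integrable (fun x : ℝ => C * (1 + ‖x‖) ^ (-p)) :=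
      (integrable_one_add_norm (by simpa using hp)).const_mul C
    refine h1.mono' ?_ (Filter.Eventually.of_forall fun x => ?_)
    · refine Continuous.aestronglyMeasurable ?_
      refine hG.continuousOn.comp_continuous (by fun_prop) fun x => by simp [hy]
    · refine (hC _ (by simp)).trans ?_
      gcongr ?_ * ?_
      refine Real.rpow_le_rpow_of_nonpos (by positivity) ?_ (by linarith)
      have := Complex.abs_re_le_norm ((x : ℂ) + y * Complex.I)
      simp at this
      simpa using this
  refine ⟨hInt, ?_⟩
  have hlim : Filter.Tendsto (fun R : ℝ => ∫ x in (-R)..R, G (x + y * Complex.I)) Filter.atTop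
      (nhds (∫ x : ℝ, G (x + y * Complex.I))) :=
    intervalIntegral_tendsto_integral hInt Filter.tendsto_neg_atTop_atBot Filter.tendsto_id
  refine tendsto_nhds_unique hlim ?_
  rw [tendsto_zero_iff_norm_tendsto_zero]
  have hz : Filter.Tendsto (fun R : ℝ => 4 * C * R ^ (-(p - 1))) Filter.atTop (nhds 0) := by
    simpa using (tendsto_rpow_neg_atTop (by linarith : 0 < p - 1)).const_mul (4 * C)
  refine squeeze_zero' (Filter.Eventually.of_forall fun _ => norm_nonneg _) ?_ hz
  filter_upwards [Filter.eventually_gt_atTop 0] with R hR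
  have hrect := Complex.integral_boundary_rect_eq_zero_of_differentiableOn G
    ⟨-R, y⟩ ⟨R, y + R⟩ (hG.mono (by
      intro w hw
      rw [Complex.mem_reProdIm] at hw
      have := hw.2
      simp only [Set.uIcc_of_le (by linarith : y ≤ y + R), Set.mem_Icc] at this
      exact hy.trans_le this.1))
  simp only at hrect
  have htop : ‖∫ x in (-R)..R, G (x + ((y + R : ℝ) : ℂ) * Complex.I)‖
      ≤ C * R ^ (-p) * |R - (-R)| := by
    refine intervalIntegral.norm_integral_le_of_norm_le_const fun x _ => ?_
    refine hbd _ (by simp; linarith) R hR ?_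
    have := Complex.abs_im_le_norm ((x : ℂ) + ((y + R : ℝ) : ℂ) * Complex.I)
    simp only [Complex.add_im, Complex.ofReal_im, Complex.mul_im, Complex.I_re, Complex.I_im,
      Complex.ofReal_re, mul_zero, mul_one, zero_add, add_zero] at this
    rw [abs_of_pos (by linarith)] at this
    linarith
  have hside (r : ℝ) (hr : |r| = R) : ‖∫ t in y..(y + R), G ((r : ℂ) + t * Complex.I)‖
      ≤ C * R ^ (-p) * |y + R - y| := by
    refine intervalIntegral.norm_integral_le_of_norm_le_const fun t ht => ?_
    rw [Set.uIoc_of_le (by linarith)] at ht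
    refine hbd _ (by simpa using ht.1.le) R hR ?_
    have := Complex.abs_re_le_norm ((r : ℂ) + (t : ℂ) * Complex.I)
    simp only [Complex.add_re, Complex.ofReal_re, Complex.mul_re, Complex.I_re, Complex.I_im,
      Complex.ofReal_im, mul_zero, mul_one, sub_zero, add_zero] at this
    linarith
  have hs1 := hside R (abs_of_pos hR)
  have hs2 := hside (-R) (by rw [abs_neg, abs_of_pos hR])
  have e1 : |R - -R| = 2 * R := by rw [abs_of_pos (by linarith)]; ring
  have e2 : |y + R - y| = R := by rw [abs_of_pos (by linarith)]; ring
  rw [e1] at htop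
  rw [e2] at hs1 hs2
  have e3 : R ^ (-p) * R = R ^ (-(p - 1)) := by
    conv_lhs => rw [← Real.rpow_one R, ← Real.rpow_mul hR.le, ← Real.rpow_add hR]
    congr 1; ring
  have hbot : ∫ x in (-R)..R, G (x + y * Complex.I)
      = (∫ x in (-R)..R, G (x + ((y + R : ℝ) : ℂ) * Complex.I))
        - Complex.I • (∫ t in y..(y + R), G ((R : ℂ) + t * Complex.I))
        + Complex.I • (∫ t in y..(y + R), G (((-R : ℝ) : ℂ) + t * Complex.I)) := by
    linear_combination hrect
  rw [hbot]
  refine (norm_add_le _ _).trans ((add_le_add_left (norm_sub_le _ _) _).trans ?_)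
  rw [norm_smul, norm_smul, Complex.norm_I, one_mul, one_mul]
  calc _ ≤ C * R ^ (-p) * (2 * R) + C * R ^ (-p) * R + C * R ^ (-p) * R := by gcongr
    _ = _ := by rw [← e3]; ring

/-- Cauchy integral of a function on the line, at points of the upper half plane. -/
def cauchyInt (g : ℝ → ℂ) (z : ℂ) : ℂ :=
  ∫ u : ℝ, Complex.I / (2 * π * (z - u)) * g u

lemma im_le_norm_sub_ofReal (z : ℂ) (u : ℝ) : z.im ≤ ‖z - u‖ := by
  have := Complex.abs_im_le_norm (z - u)
  simp only [Complex.sub_im, Complex.ofReal_im, sub_zero] at this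
  exact (le_abs_self _).trans this

lemma norm_cauchyKernel_eq (z : ℂ) (u : ℝ) :
    ‖Complex.I / (2 * π * (z - u))‖ = (2 * π * ‖z - u‖)⁻¹ := by
  rw [norm_div, norm_mul, norm_mul, Complex.norm_I, Complex.norm_real, Real.norm_eq_abs,
    abs_of_pos Real.pi_pos, one_div]
  simp

lemma norm_cauchyKernel_le_inv_norm (z : ℂ) (hz : 0 < z.im) (u : ℝ) :
    ‖Complex.I / (2 * π * (z - u))‖ ≤ ‖z - u‖⁻¹ := by
  rw [norm_cauchyKernel_eq]
  have h := hz.trans_le (im_le_norm_sub_ofReal z u)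
  gcongr
  nlinarith [Real.pi_gt_three]

lemma norm_cauchyKernel_le {y : ℝ} (hy : 0 < y) (z : ℂ) (hz : y ≤ z.im) (u : ℝ) :
    ‖Complex.I / (2 * π * (z - u))‖ ≤ y⁻¹ := by
  refine (norm_cauchyKernel_le_inv_norm z (hy.trans_le hz) u).trans ?_
  have := im_le_norm_sub_ofReal z u
  gcongr
  linarith

lemma sub_ofReal_ne_zero {z : ℂ} (hz : 0 < z.im) (u : ℝ) : z - u ≠ 0 := by
  have := im_le_norm_sub_ofReal z u
  exact norm_pos_iff.1 (by linarith)

lemma continuous_cauchyKernel {z : ℂ} (hz : 0 < z.im) :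
    Continuous fun u : ℝ => Complex.I / (2 * π * (z - u)) := by
  refine Continuous.div continuous_const (by fun_prop) fun u => ?_
  exact mul_ne_zero (by simp [Real.pi_ne_zero]) (sub_ofReal_ne_zero hz u)

lemma integrable_cauchyKernel_mul {g : ℝ → ℂ} (hg : Integrable g) {z : ℂ} (hz : 0 < z.im) :
    Integrable fun u : ℝ => Complex.I / (2 * π * (z - u)) * g u :=
  hg.bdd_mul (continuous_cauchyKernel hz).aestronglyMeasurable
    (Filter.Eventually.of_forall fun u => norm_cauchyKernel_le hz z le_rfl u)

lemma exists_norm_cauchyInt_le {g : ℝ → ℂ} (hg : Integrable g)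
    (hg' : Integrable fun u : ℝ => u * g u) {y : ℝ} (hy : 0 < y) :
    ∃ C : ℝ, 0 ≤ C ∧ ∀ z : ℂ, y ≤ z.im → ‖cauchyInt g z‖ ≤ C * (1 + ‖z‖)⁻¹ := by
  refine ⟨∫ u : ℝ, ((y⁻¹ + 1) * ‖g u‖ + y⁻¹ * ‖u * g u‖), by positivity, fun z hz => ?_⟩
  have hz0 := hy.trans_le hz
  rw [← div_eq_mul_inv, le_div_iff₀ (by positivity), mul_comm, ← abs_of_pos (by positivity :
    0 < 1 + ‖z‖), ← Real.norm_eq_abs, ← norm_smul, cauchyInt, ← integral_smul]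
  refine norm_integral_le_of_norm_le ((hg.norm.const_mul _).add (hg'.norm.const_mul _))
    (Filter.Eventually.of_forall fun u => ?_)
  have hpos : 0 < ‖z - u‖ := norm_pos_iff.2 (sub_ofReal_ne_zero hz0 u)
  have hyz : y ≤ ‖z - u‖ := hz.trans (im_le_norm_sub_ofReal z u)
  rw [norm_smul, norm_mul, norm_mul, Complex.norm_real, Real.norm_eq_abs, Real.norm_eq_abs,
    abs_of_pos (by positivity : 0 < 1 + ‖z‖)]
  have h1 : ‖z‖ ≤ ‖z - u‖ + |u| := by
    have := norm_add_le (z - u) (u : ℂ)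
    rwa [sub_add_cancel, Complex.norm_real] at this
  have h2 : ‖z - u‖⁻¹ ≤ y⁻¹ := by gcongr
  have h3 : (1 + ‖z‖) * ‖Complex.I / (2 * π * (z - u))‖ ≤ y⁻¹ + 1 + y⁻¹ * |u| := by
    calc _ ≤ (1 + (‖z - u‖ + |u|)) * ‖z - u‖⁻¹ := by
          gcongr
          exact norm_cauchyKernel_le_inv_norm z hz0 u
      _ = ‖z - u‖⁻¹ + 1 + ‖z - u‖⁻¹ * |u| := by field_simp; ring
      _ ≤ _ := by gcongr
  calc _ = ((1 + ‖z‖) * ‖Complex.I / (2 * π * (z - u))‖) * ‖g u‖ := by ring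
    _ ≤ (y⁻¹ + 1 + y⁻¹ * |u|) * ‖g u‖ := by gcongr
    _ = _ := by ring

lemma differentiableOn_cauchyInt {g : ℝ → ℂ} (hg : Integrable g) :
    DifferentiableOn ℂ (cauchyInt g) {z | 0 < z.im} := by
  intro z₀ hz₀
  have hz₀' : 0 < z₀.im := hz₀
  refine DifferentiableAt.differentiableWithinAt ?_
  have hball (z : ℂ) (hz : z ∈ Metric.ball z₀ (z₀.im / 2)) : z₀.im / 2 ≤ z.im := by
    have h1 := Complex.abs_im_le_norm (z - z₀)
    have h2 : ‖z - z₀‖ < z₀.im / 2 := by simpa [dist_eq_norm] using hz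
    rw [Complex.sub_im] at h1
    linarith [(abs_le.1 h1).1]
  have h := hasDerivAt_integral_of_dominated_loc_of_deriv_le (μ := volume) (𝕜 := ℂ)
    (F := fun (z : ℂ) (u : ℝ) => Complex.I / (2 * π * (z - u)) * g u)
    (F' := fun (z : ℂ) (u : ℝ) => -Complex.I / (2 * π * (z - u) ^ 2) * g u)
    (bound := fun u => (z₀.im / 2)⁻¹ ^ 2 * ‖g u‖)
    (x₀ := z₀) (s := Metric.ball z₀ (z₀.im / 2)) (Metric.ball_mem_nhds _ (by positivity))
    ?_ (integrable_cauchyKernel_mul hg hz₀) ?_ ?_ (hg.norm.const_mul _) ?_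
  · exact h.2.differentiableAt
  · filter_upwards [Metric.ball_mem_nhds z₀ (by positivity : 0 < z₀.im / 2)] with z hz
    exact (integrable_cauchyKernel_mul hg (by linarith [hball z hz])).1
  · refine AEStronglyMeasurable.mul ?_ hg.1
    refine Continuous.aestronglyMeasurable ?_
    refine Continuous.div continuous_const (by fun_prop) fun u => ?_
    exact mul_ne_zero (by simp [Real.pi_ne_zero]) (pow_ne_zero _ (sub_ofReal_ne_zero hz₀ u))
  · refine Filter.Eventually.of_forall fun u z hz => ?_
    have hz1 := hball z hz
    rw [norm_mul]
    gcongr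
    have hk := norm_cauchyKernel_le_inv_norm z (by linarith) u
    have h0 : z - u ≠ 0 := sub_ofReal_ne_zero (by linarith) u
    have hyz := hz1.trans (im_le_norm_sub_ofReal z u)
    have e : -Complex.I / (2 * π * (z - u) ^ 2)
        = -(Complex.I / (2 * π * (z - u))) * (z - u)⁻¹ := by
      field_simp
    rw [e, norm_mul, norm_neg, norm_inv, sq]
    have : ‖z - u‖⁻¹ ≤ (z₀.im / 2)⁻¹ := by gcongr
    gcongr
    exact hk.trans this
  · refine Filter.Eventually.of_forall fun u z hz => ?_
    have h0 : z - u ≠ 0 := sub_ofReal_ne_zero (by linarith [hball z hz]) u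
    have hpi : (π : ℂ) ≠ 0 := by simp [Real.pi_ne_zero]
    have h1 : HasDerivAt (fun z : ℂ => 2 * π * (z - u)) (2 * π) z := by
      simpa using ((hasDerivAt_id z).sub_const (u : ℂ)).const_mul (2 * (π : ℂ))
    have h2 := ((hasDerivAt_const z Complex.I).div h1
      (mul_ne_zero (by simp [Real.pi_ne_zero]) h0)).mul_const (g u)
    refine h2.congr_deriv ?_
    field_simp
    ring

/-- The Poisson kernel of the upper half plane, with total mass `1/2`. -/
def halfPoisson (y t : ℝ) : ℝ := y / (2 * π * (t ^ 2 + y ^ 2))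

lemma re_cauchyKernel (x y u : ℝ) (c : ℝ) :
    (Complex.I / (2 * π * ((x + y * Complex.I) - u)) * c).re = halfPoisson y (x - u) * c := by
  have e : Complex.I / (2 * π * ((x + y * Complex.I) - u)) * c
      = ((c / (2 * π) : ℝ) : ℂ) * (Complex.I * (((x - u : ℝ) : ℂ) + y * Complex.I)⁻¹) := by
    push_cast
    rw [div_eq_mul_inv, mul_inv]
    ring_nf
  rw [e, Complex.re_ofReal_mul, Complex.mul_re, Complex.I_re, Complex.I_im, Complex.inv_im,
    halfPoisson]
  simp only [Complex.add_im, Complex.ofReal_im, Complex.mul_im, Complex.I_re, Complex.I_im,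
    Complex.ofReal_re, mul_zero, mul_one, zero_add, add_zero, zero_mul, one_mul, zero_sub,
    Complex.normSq_apply, Complex.add_re, Complex.mul_re, sub_self]
  by_cases h : (x - u) ^ 2 + y ^ 2 = 0
  · have h' : (x - u) * (x - u) + y * y = 0 := by linarith
    rw [h, h']; simp
  · have h' : (x - u) * (x - u) + y * y ≠ 0 := by intro h2; apply h; linarith
    field_simp

lemma lintegral_halfPoisson {y : ℝ} (hy : 0 < y) :
    ∫⁻ t : ℝ, ENNReal.ofReal (halfPoisson y t) ≤ 1 := by
  have e (t : ℝ) : halfPoisson y t = (2 * π * y)⁻¹ * (1 + (t / y) ^ 2)⁻¹ := by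
    rw [halfPoisson]; field_simp; ring
  have hInt : Integrable fun t : ℝ => halfPoisson y t := by
    simp only [e]
    exact (integrable_inv_one_add_sq.comp_div hy.ne').const_mul _
  rw [← ofReal_integral_eq_lintegral_ofReal hInt
    (Filter.Eventually.of_forall fun t => by simp only [e, Pi.zero_apply]; positivity)]
  rw [ENNReal.ofReal_le_one]
  simp only [e]
  rw [integral_const_mul, Measure.integral_comp_div (fun t => (1 + t ^ 2)⁻¹) y,
    integral_univ_inv_one_add_sq, abs_of_pos hy, smul_eq_mul]
  have := Real.pi_pos
  field_simp
  norm_num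

lemma measurable_halfPoisson (y : ℝ) : Measurable (halfPoisson y) := by
  unfold halfPoisson; fun_prop

/-- The M. Riesz inequality for nonnegative functions and `1 < p ≤ 2`. -/
lemma exists_lintegral_cauchyInt_le_of_nonneg {p : ℝ} (hp1 : 1 < p) (hp2 : p ≤ 2) :
    ∃ C : ℝ≥0, ∀ y : ℝ, 0 < y → ∀ g : ℝ → ℝ, Measurable g → (∀ u, 0 ≤ g u) →
      Integrable g → Integrable (fun u => u * g u) →
      ∫⁻ x : ℝ, ‖cauchyInt (fun u => g u) (x + y * Complex.I)‖ₑ ^ p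
        ≤ C * ∫⁻ u, ‖g u‖ₑ ^ p := by
  obtain ⟨A, B, hA, hB, hAB⟩ := exists_norm_rpow_le_re_rpow_sub_re_cpow hp1 hp2
  have hp0 : 0 < p := by linarith
  refine ⟨A.toNNReal, fun y hy g hgm hg0 hgi hgi' => ?_⟩
  have hgc : Integrable (fun u => (g u : ℂ)) := hgi.ofReal
  have hgc' : Integrable (fun u : ℝ => (u : ℂ) * (g u : ℂ)) := by
    simpa using hgi'.ofReal (𝕜 := ℂ)
  set F := cauchyInt (fun u => (g u : ℂ)) with hF
  by_cases hzero : g =ᵐ[volume] 0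
  · have : ∀ z, F z = 0 := by
      intro z
      rw [hF, cauchyInt]
      apply integral_eq_zero_of_ae
      filter_upwards [hzero] with u hu
      simp [hu]
    simp [this, hp0]
  have hFre' (x y : ℝ) (hy : 0 < y) :
      (F (x + y * Complex.I)).re = ∫ u, halfPoisson y (x - u) * g u := by
    have h := integrable_cauchyKernel_mul hgc (z := x + y * Complex.I) (by simp [hy])
    have h2 := Complex.reCLM.integral_comp_comm h
    simp only [Complex.reCLM_apply] at h2
    rw [hF, cauchyInt, ← h2]
    exact integral_congr_ae (Filter.Eventually.of_forall fun u => re_cauchyKernel x y u (g u))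
  have hPint (x y : ℝ) (hy : 0 < y) : Integrable fun u => halfPoisson y (x - u) * g u := by
    have h := (integrable_cauchyKernel_mul hgc (z := x + y * Complex.I) (by simp [hy])).re
    refine h.congr (Filter.Eventually.of_forall fun u => ?_)
    exact re_cauchyKernel x y u (g u)
  have hPpos (y : ℝ) (hy : 0 < y) (t : ℝ) : 0 < halfPoisson y t := by
    unfold halfPoisson; positivity
  have hpos (z : ℂ) (hz : 0 < z.im) : 0 < (F z).re := by
    have h1 := hFre' z.re z.im hz
    rw [Complex.re_add_im] at h1
    rw [h1, integral_pos_iff_support_of_nonneg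
      (fun u => mul_nonneg (hPpos _ hz _).le (hg0 u)) (hPint _ _ hz)]
    have : (Function.support fun u => halfPoisson z.im (z.re - u) * g u) = {u | g u ≠ 0} := by
      ext u; simp [(hPpos _ hz _).ne']
    rw [this, pos_iff_ne_zero]
    intro h
    exact hzero (by rw [Filter.EventuallyEq, ae_iff]; simpa using h)
  obtain ⟨C, hC0, hC⟩ := exists_norm_cauchyInt_le hgc hgc' hy
  have hCp (z : ℂ) (hz : y ≤ z.im) : ‖F z‖ ^ p ≤ C ^ p * (1 + ‖z‖) ^ (-p) := by
    calc ‖F z‖ ^ p ≤ (C * (1 + ‖z‖)⁻¹) ^ p := by gcongr; exact hC z hz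
      _ = _ := by
        rw [Real.mul_rpow hC0 (by positivity), Real.inv_rpow (by positivity),
          Real.rpow_neg (by positivity)]
  have hcont : Continuous fun x : ℝ => F (x + y * Complex.I) :=
    (differentiableOn_cauchyInt hgc).continuousOn.comp_continuous (by fun_prop)
      fun x => by simp [hy]
  have hdiff : DifferentiableOn ℂ (fun z => F z ^ (p : ℂ)) {z | 0 < z.im} :=
    (differentiableOn_cauchyInt hgc).cpow_const fun z hz => Or.inl (hpos z hz)
  obtain ⟨hi, h0⟩ := integral_horizontal_eq_zero (G := fun z => F z ^ (p : ℂ)) (C := C ^ p)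
    hy hp1 hdiff fun z hz => by
      rw [Complex.norm_cpow_real]
      exact hCp z hz
  have hnorm_int : Integrable fun x : ℝ => ‖F (x + y * Complex.I)‖ ^ p := by
    refine hi.norm.congr (Filter.Eventually.of_forall fun x => ?_)
    simp only [Complex.norm_cpow_real]
  have hre_int : Integrable fun x : ℝ => (F (x + y * Complex.I)).re ^ p := by
    refine hnorm_int.mono' ?_ (Filter.Eventually.of_forall fun x => ?_)
    · exact ((Complex.continuous_re.comp hcont).rpow_const
        fun _ => Or.inr hp0.le).aestronglyMeasurable
    · have h := (hpos (x + y * Complex.I) (by simp [hy])).le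
      rw [Real.norm_eq_abs, abs_of_nonneg (by positivity)]
      gcongr
      exact Complex.re_le_norm _
  have hmain : ∫ x : ℝ, ‖F (x + y * Complex.I)‖ ^ p
      ≤ A * ∫ x : ℝ, (F (x + y * Complex.I)).re ^ p := by
    have h1 : ∫ x : ℝ, (F (x + y * Complex.I) ^ (p : ℂ)).re = 0 := by
      have := Complex.reCLM.integral_comp_comm hi
      simp only [Complex.reCLM_apply] at this
      rw [this, h0, Complex.zero_re]
    have hcre : Integrable fun x : ℝ => (F (x + y * Complex.I) ^ (p : ℂ)).re := hi.re
    calc _ ≤ ∫ x : ℝ, (A * (F (x + y * Complex.I)).re ^ p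
          - B * (F (x + y * Complex.I) ^ (p : ℂ)).re) :=
          integral_mono hnorm_int ((hre_int.const_mul _).sub (hcre.const_mul _))
            fun x => hAB _ (hpos _ (by simp [hy]))
      _ = _ := by
          rw [integral_sub (hre_int.const_mul _) (hcre.const_mul _), integral_const_mul,
            integral_const_mul]
          rw [h1]
          ring
  have hre_le : ∫⁻ x : ℝ, ENNReal.ofReal ((F (x + y * Complex.I)).re ^ p)
      ≤ ∫⁻ u, ‖g u‖ₑ ^ p := by
    have hstep (x : ℝ) : ENNReal.ofReal ((F (x + y * Complex.I)).re ^ p)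
        = (∫⁻ u, ENNReal.ofReal (halfPoisson y u) * ‖g (x - u)‖ₑ) ^ p := by
      rw [← ENNReal.ofReal_rpow_of_pos (hpos _ (by simp [hy])), hFre' x y hy,
        ofReal_integral_eq_lintegral_ofReal (hPint x y hy)
          (Filter.Eventually.of_forall fun u => mul_nonneg (hPpos y hy _).le (hg0 u))]
      rw [← lintegral_sub_left_eq_self _ x]
      congr 1
      refine lintegral_congr fun u => ?_
      rw [ENNReal.ofReal_mul (hPpos y hy _).le, Real.enorm_of_nonneg (hg0 _)]
      simp
    simp only [hstep]
    calc _ ≤ (∫⁻ u, ENNReal.ofReal (halfPoisson y u)) ^ p * ∫⁻ u, ‖g u‖ₑ ^ p :=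
          lintegral_conv_rpow_le volume hp1 (measurable_halfPoisson y).ennreal_ofReal hgm.enorm
      _ ≤ 1 ^ p * ∫⁻ u, ‖g u‖ₑ ^ p := by gcongr; exact lintegral_halfPoisson hy
      _ = _ := by simp
  calc ∫⁻ x : ℝ, ‖F (x + y * Complex.I)‖ₑ ^ p
      = ENNReal.ofReal (∫ x : ℝ, ‖F (x + y * Complex.I)‖ ^ p) := by
        rw [ofReal_integral_eq_lintegral_ofReal hnorm_int
          (Filter.Eventually.of_forall fun x => by positivity)]
        refine lintegral_congr fun x => ?_
        rw [← ofReal_norm, ENNReal.ofReal_rpow_of_nonneg (norm_nonneg _) hp0.le]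
    _ ≤ ENNReal.ofReal (A * ∫ x : ℝ, (F (x + y * Complex.I)).re ^ p) :=
        ENNReal.ofReal_le_ofReal hmain
    _ = A.toNNReal * ∫⁻ x : ℝ, ENNReal.ofReal ((F (x + y * Complex.I)).re ^ p) := by
        rw [ENNReal.ofReal_mul hA, ofReal_integral_eq_lintegral_ofReal hre_int
          (Filter.Eventually.of_forall fun x =>
            Real.rpow_nonneg (hpos _ (by simp [hy])).le _)]
        rfl
    _ ≤ _ := by gcongr

lemma lintegral_enorm_add_rpow_le {X E : Type*} [MeasurableSpace X] [NormedAddCommGroup E]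
    [MeasurableSpace E] [OpensMeasurableSpace E]
    {μ : Measure X} {p : ℝ} (hp : 1 ≤ p) {f g : X → E} (hf : Measurable f) :
    ∫⁻ x, ‖f x + g x‖ₑ ^ p ∂μ
      ≤ 2 ^ (p - 1) * (∫⁻ x, ‖f x‖ₑ ^ p ∂μ + ∫⁻ x, ‖g x‖ₑ ^ p ∂μ) := by
  calc _ ≤ ∫⁻ x, 2 ^ (p - 1) * (‖f x‖ₑ ^ p + ‖g x‖ₑ ^ p) ∂μ := by
        refine lintegral_mono fun x => ?_
        calc _ ≤ (‖f x‖ₑ + ‖g x‖ₑ) ^ p := by gcongr; exact enorm_add_le _ _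
          _ ≤ _ := ENNReal.rpow_add_le_mul_rpow_add_rpow _ _ hp
    _ = _ := by
        rw [lintegral_const_mul' _ _ (by simp), lintegral_add_left (hf.enorm.pow_const _)]

lemma cauchyInt_add {f g : ℝ → ℂ} (hf : Integrable f) (hg : Integrable g) {z : ℂ}
    (hz : 0 < z.im) : cauchyInt (fun u => f u + g u) z = cauchyInt f z + cauchyInt g z := by
  simp only [cauchyInt, mul_add]
  exact integral_add (integrable_cauchyKernel_mul hf hz) (integrable_cauchyKernel_mul hg hz)

lemma cauchyInt_const_mul (c : ℂ) (g : ℝ → ℂ) (z : ℂ) :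
    cauchyInt (fun u => c * g u) z = c * cauchyInt g z := by
  simp only [cauchyInt]
  rw [← integral_const_mul]
  congr 1 with u
  ring

lemma continuous_cauchyInt_horizontal {g : ℝ → ℂ} (hg : Integrable g) {y : ℝ} (hy : 0 < y) :
    Continuous fun x : ℝ => cauchyInt g (x + y * Complex.I) :=
  (differentiableOn_cauchyInt hg).continuousOn.comp_continuous (by fun_prop)
    fun x => by simp [hy]

lemma exists_lintegral_cauchyInt_le_of_real {p : ℝ} (hp1 : 1 < p) (hp2 : p ≤ 2) :
    ∃ C : ℝ≥0, ∀ y : ℝ, 0 < y → ∀ g : ℝ → ℝ, Measurable g →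
      Integrable g → Integrable (fun u => u * g u) →
      ∫⁻ x : ℝ, ‖cauchyInt (fun u => g u) (x + y * Complex.I)‖ₑ ^ p
        ≤ C * ∫⁻ u, ‖g u‖ₑ ^ p := by
  obtain ⟨C, hC⟩ := exists_lintegral_cauchyInt_le_of_nonneg hp1 hp2
  refine ⟨2 ^ (p - 1) * (C + C), fun y hy g hgm hgi hgi' => ?_⟩
  have habs : ∀ (s : ℝ → ℝ), Measurable s → (∀ u, |s u| ≤ |g u|) →
      Integrable s ∧ Integrable (fun u => u * s u) := by
    intro s hs hle
    constructor
    · exact hgi.mono hs.aestronglyMeasurable (Filter.Eventually.of_forall fun u => by simpa using hle u)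
    · refine hgi'.mono (measurable_id.mul hs).aestronglyMeasurable
        (Filter.Eventually.of_forall fun u => ?_)
      rw [norm_mul, norm_mul]
      gcongr
      simpa using hle u
  have hpos_le (u : ℝ) : |max (g u) 0| ≤ |g u| := by
    rw [abs_of_nonneg (le_max_right _ _)]
    exact max_le (le_abs_self _) (abs_nonneg _)
  have hneg_le (u : ℝ) : |max (-g u) 0| ≤ |g u| := by
    rw [abs_of_nonneg (le_max_right _ _)]
    exact max_le (neg_le_abs _) (abs_nonneg _)
  have hm1 : Measurable fun u => max (g u) 0 := hgm.max measurable_const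
  have hm2 : Measurable fun u => max (-g u) 0 := hgm.neg.max measurable_const
  obtain ⟨h1, h1'⟩ := habs _ hm1 hpos_le
  obtain ⟨h2, h2'⟩ := habs _ hm2 hneg_le
  have h1c : Integrable fun u => ((max (g u) 0 : ℝ) : ℂ) := h1.ofReal
  have h2c : Integrable fun u => ((max (-g u) 0 : ℝ) : ℂ) := h2.ofReal
  have b1 := hC y hy _ hm1 (fun u => le_max_right _ _) h1 h1'
  have b2 := hC y hy _ hm2 (fun u => le_max_right _ _) h2 h2'
  have hmono (s : ℝ → ℝ) (hle : ∀ u, |s u| ≤ |g u|) :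
      ∫⁻ u, ‖s u‖ₑ ^ p ≤ ∫⁻ u, ‖g u‖ₑ ^ p := by
    refine lintegral_mono fun u => ?_
    gcongr
    exact enorm_le_iff_norm_le.2 (by simpa using hle u)
  have hsplit (x : ℝ) : cauchyInt (fun u => (g u : ℂ)) (x + y * Complex.I)
      = cauchyInt (fun u => ((max (g u) 0 : ℝ) : ℂ)) (x + y * Complex.I)
        + (-1) * cauchyInt (fun u => ((max (-g u) 0 : ℝ) : ℂ)) (x + y * Complex.I) := by
    rw [← cauchyInt_const_mul, ← cauchyInt_add h1c (h2c.const_mul _) (by simp [hy])]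
    congr 1
    ext u
    have : g u = max (g u) 0 + (-1) * max (-g u) 0 := by
      rcases le_total 0 (g u) with h | h
      · rw [max_eq_left h, max_eq_right (by linarith)]; ring
      · rw [max_eq_right h, max_eq_left (by linarith)]; ring
    exact_mod_cast this
  simp only [hsplit]
  refine (lintegral_enorm_add_rpow_le hp1.le
    (continuous_cauchyInt_horizontal h1c hy).measurable).trans ?_
  have e (x : ℝ) : ‖(-1 : ℂ) * cauchyInt (fun u => ((max (-g u) 0 : ℝ) : ℂ)) (x + y * Complex.I)‖ₑ
      = ‖cauchyInt (fun u => ((max (-g u) 0 : ℝ) : ℂ)) (x + y * Complex.I)‖ₑ := by simp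
  simp only [e]
  calc _ ≤ 2 ^ (p - 1) * ((C * ∫⁻ u, ‖g u‖ₑ ^ p) + (C * ∫⁻ u, ‖g u‖ₑ ^ p)) := by
        gcongr
        · exact b1.trans (mul_le_mul_right (hmono _ hpos_le) _)
        · exact b2.trans (mul_le_mul_right (hmono _ hneg_le) _)
    _ = _ := by
        push_cast
        rw [ENNReal.coe_rpow_of_nonneg _ (by linarith)]
        push_cast
        ring

lemma exists_lintegral_cauchyInt_le_of_le_two {p : ℝ} (hp1 : 1 < p) (hp2 : p ≤ 2) :
    ∃ C : ℝ≥0, ∀ y : ℝ, 0 < y → ∀ g : ℝ → ℂ, Measurable g →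
      Integrable g → Integrable (fun u : ℝ => (u : ℂ) * g u) →
      ∫⁻ x : ℝ, ‖cauchyInt g (x + y * Complex.I)‖ₑ ^ p ≤ C * ∫⁻ u, ‖g u‖ₑ ^ p := by
  obtain ⟨C, hC⟩ := exists_lintegral_cauchyInt_le_of_real hp1 hp2
  refine ⟨2 ^ (p - 1) * (C + C), fun y hy g hgm hgi hgi' => ?_⟩
  have h1 : Integrable fun u => (g u).re := hgi.re
  have h2 : Integrable fun u => (g u).im := hgi.im
  have h1' : Integrable fun u => u * (g u).re :=
    hgi'.re.congr (Filter.Eventually.of_forall fun u => by simp)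
  have h2' : Integrable fun u => u * (g u).im :=
    hgi'.im.congr (Filter.Eventually.of_forall fun u => by simp)
  have h1c : Integrable fun u => ((g u).re : ℂ) := h1.ofReal
  have h2c : Integrable fun u => ((g u).im : ℂ) := h2.ofReal
  have b1 := hC y hy (fun u => (g u).re) (Complex.measurable_re.comp hgm) h1 h1'
  have b2 := hC y hy (fun u => (g u).im) (Complex.measurable_im.comp hgm) h2 h2'
  have m1 : ∫⁻ u, ‖(g u).re‖ₑ ^ p ≤ ∫⁻ u, ‖g u‖ₑ ^ p := by
    refine lintegral_mono fun u => ?_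
    gcongr
    exact enorm_le_iff_norm_le.2 (by simpa using Complex.abs_re_le_norm (g u))
  have m2 : ∫⁻ u, ‖(g u).im‖ₑ ^ p ≤ ∫⁻ u, ‖g u‖ₑ ^ p := by
    refine lintegral_mono fun u => ?_
    gcongr
    exact enorm_le_iff_norm_le.2 (by simpa using Complex.abs_im_le_norm (g u))
  have hsplit (x : ℝ) : cauchyInt g (x + y * Complex.I)
      = cauchyInt (fun u => ((g u).re : ℂ)) (x + y * Complex.I)
        + Complex.I * cauchyInt (fun u => ((g u).im : ℂ)) (x + y * Complex.I) := by
    rw [← cauchyInt_const_mul, ← cauchyInt_add h1c (h2c.const_mul _) (by simp [hy])]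
    congr 1
    ext u
    conv_lhs => rw [← Complex.re_add_im (g u)]
    ring
  simp only [hsplit]
  refine (lintegral_enorm_add_rpow_le hp1.le
    (continuous_cauchyInt_horizontal h1c hy).measurable).trans ?_
  have e (x : ℝ) : ‖Complex.I * cauchyInt (fun u => ((g u).im : ℂ)) (x + y * Complex.I)‖ₑ
      = ‖cauchyInt (fun u => ((g u).im : ℂ)) (x + y * Complex.I)‖ₑ := by
    rw [enorm_mul]
    simp [← ofReal_norm]
  simp only [e]
  calc _ ≤ 2 ^ (p - 1) * ((C * ∫⁻ u, ‖g u‖ₑ ^ p) + (C * ∫⁻ u, ‖g u‖ₑ ^ p)) := by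
        gcongr
        · exact b1.trans (by gcongr)
        · exact b2.trans (by gcongr)
    _ = _ := by
        push_cast
        rw [ENNReal.coe_rpow_of_nonneg _ (by linarith)]
        push_cast
        ring

lemma conj_cauchyKernel (x u y : ℝ) :
    (starRingEnd ℂ) (Complex.I / (2 * π * ((x + y * Complex.I) - u)))
      = Complex.I / (2 * π * ((u + y * Complex.I) - x)) := by
  rw [map_div₀, Complex.conj_I, map_mul, map_mul, map_sub, map_add, map_mul]
  simp only [Complex.conj_ofReal, Complex.conj_I, map_ofNat]
  rw [← neg_div_neg_eq]
  congr 1 <;> ring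

lemma exists_lintegral_cauchyInt_le_of_two_lt {p : ℝ} (hp : 2 < p) :
    ∃ C : ℝ≥0, ∀ y : ℝ, 0 < y → ∀ g : ℝ → ℂ, Measurable g →
      Integrable g → Integrable (fun u : ℝ => (u : ℂ) * g u) →
      ∫⁻ x : ℝ, ‖cauchyInt g (x + y * Complex.I)‖ₑ ^ p ≤ C * ∫⁻ u, ‖g u‖ₑ ^ p := by
  have hp0 : 0 < p := by linarith
  have hpq := Real.HolderConjugate.conjExponent (by linarith : 1 < p)
  set q := p.conjExponent with hq
  have hq1 : 1 < q := hpq.symm.lt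
  have hqe : q = p / (p - 1) := rfl
  have hq2 : q ≤ 2 := by rw [hqe, div_le_iff₀ (by linarith)]; linarith
  obtain ⟨C, hC⟩ := exists_lintegral_cauchyInt_le_of_le_two hq1 hq2
  refine ⟨C ^ (p - 1), fun y hy g hgm hgi hgi' => ?_⟩
  set G : ℝ → ℂ := fun x => cauchyInt g (x + y * Complex.I) with hG
  have hGc : Continuous G := continuous_cauchyInt_horizontal hgi hy
  obtain ⟨D, hD0, hD⟩ := exists_norm_cauchyInt_le hgi hgi' hy
  have hGb (x : ℝ) : ‖G x‖ ≤ D := by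
    refine (hD _ (by simp)).trans ?_
    refine mul_le_of_le_one_right hD0 (inv_le_one_of_one_le₀ ?_)
    linarith [norm_nonneg ((x : ℂ) + y * Complex.I)]
  suffices hR : ∀ R : ℝ, ∫⁻ x in Set.Icc (-R) R, ‖G x‖ₑ ^ p
      ≤ (C ^ (p - 1) : ℝ≥0) * ∫⁻ u, ‖g u‖ₑ ^ p by
    have hcov := aecover_Icc (μ := (volume : Measure ℝ)) Filter.tendsto_neg_atTop_atBot
      Filter.tendsto_id
    exact le_of_tendsto' (hcov.lintegral_tendsto_of_countably_generated
      (hGc.enorm.measurable.pow_const p).aemeasurable) hR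
  intro R
  set w : ℝ → ℂ := (Set.Icc (-R) R).indicator
    (fun x => (starRingEnd ℂ) (G x) * ((‖G x‖ ^ (p - 2) : ℝ) : ℂ)) with hw
  have hinner : Continuous fun x => (starRingEnd ℂ) (G x) * ((‖G x‖ ^ (p - 2) : ℝ) : ℂ) := by
    refine (Complex.continuous_conj.comp hGc).mul (Complex.continuous_ofReal.comp ?_)
    exact hGc.norm.rpow_const fun _ => Or.inr (by linarith)
  have hwm : Measurable w := hinner.measurable.indicator measurableSet_Icc
  have hwi : Integrable w := by
    rw [hw, integrable_indicator_iff measurableSet_Icc]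
    exact hinner.continuousOn.integrableOn_Icc
  have hwi' : Integrable fun u : ℝ => (u : ℂ) * w u := by
    have : (fun u : ℝ => (u : ℂ) * w u) = (Set.Icc (-R) R).indicator
        (fun x : ℝ => (x : ℂ) * ((starRingEnd ℂ) (G x) * ((‖G x‖ ^ (p - 2) : ℝ) : ℂ))) := by
      ext u
      simp only [hw, Set.indicator_apply]
      split_ifs <;> simp
    rw [this, integrable_indicator_iff measurableSet_Icc]
    exact (Complex.continuous_ofReal.mul hinner).continuousOn.integrableOn_Icc
  set w' : ℝ → ℂ := fun x => (starRingEnd ℂ) (w x) with hw'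
  have hw'm : Measurable w' := Complex.continuous_conj.measurable.comp hwm
  have hw'n (x : ℝ) : ‖w' x‖ = ‖w x‖ := by simp [hw']
  have hw'i : Integrable w' := hwi.congr' hw'm.aestronglyMeasurable (by simp [hw'n])
  have hw'i' : Integrable fun u : ℝ => (u : ℂ) * w' u :=
    hwi'.congr' (Complex.measurable_ofReal.mul hw'm).aestronglyMeasurable (by simp [hw'n])
  have hB := hC y hy w' hw'm hw'i hw'i'
  set I := ∫⁻ x in Set.Icc (-R) R, ‖G x‖ₑ ^ p with hI
  have hIlt : I < ∞ := by
    calc I ≤ ∫⁻ _ in Set.Icc (-R) R, ENNReal.ofReal D ^ p := by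
          refine lintegral_mono fun x => ?_
          gcongr
          rw [← ofReal_norm]
          exact ENNReal.ofReal_le_ofReal (hGb x)
      _ < ∞ := by
          rw [setLIntegral_const]
          exact ENNReal.mul_lt_top (ENNReal.rpow_lt_top_of_nonneg hp0.le ENNReal.ofReal_ne_top)
            isCompact_Icc.measure_lt_top
  have hGw (x : ℝ) : G x * w x
      = (Set.Icc (-R) R).indicator (fun x => ((‖G x‖ ^ p : ℝ) : ℂ)) x := by
    simp only [hw, Set.indicator_apply]
    split_ifs
    · rw [← mul_assoc, Complex.mul_conj, Complex.normSq_eq_norm_sq, ← Complex.ofReal_mul]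
      congr 1
      rcases eq_or_ne ‖G x‖ 0 with h | h
      · rw [h, Real.zero_rpow hp0.ne']; simp
      · have h' : 0 < ‖G x‖ := lt_of_le_of_ne (norm_nonneg _) h.symm
        rw [← Real.rpow_natCast, ← Real.rpow_add h']
        congr 1
        push_cast
        ring
    · simp
  have hwnorm : ∫⁻ x, ‖w' x‖ₑ ^ q = I := by
    rw [hI, ← lintegral_indicator measurableSet_Icc]
    refine lintegral_congr fun x => ?_
    rw [← ofReal_norm, hw'n]
    simp only [hw, Set.indicator_apply]
    split_ifs
    · rw [norm_mul, RCLike.norm_conj, Complex.norm_real, Real.norm_eq_abs,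
        abs_of_nonneg (by positivity), ← ofReal_norm, ENNReal.ofReal_rpow_of_nonneg (by positivity)
        hpq.symm.nonneg, ENNReal.ofReal_rpow_of_nonneg (by positivity) hp0.le]
      congr 1
      rcases eq_or_ne ‖G x‖ 0 with h | h
      · rw [h, Real.zero_rpow hp0.ne', zero_mul, Real.zero_rpow hpq.symm.ne_zero]
      · have h' : 0 < ‖G x‖ := lt_of_le_of_ne (norm_nonneg _) h.symm
        nth_rewrite 1 [← Real.rpow_one ‖G x‖]
        rw [← Real.rpow_add h', ← Real.rpow_mul h'.le]
        congr 1
        rw [hqe]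
        have : p - 1 ≠ 0 := by linarith
        field_simp
        ring
    · simp [hpq.symm.pos]
  have hswap : ∫ x, G x * w x = ∫ u, g u * (starRingEnd ℂ) (cauchyInt w' (u + y * Complex.I)) := by
    have hker : Continuous fun z : ℝ × ℝ => Complex.I / (2 * π * ((z.1 + y * Complex.I) - z.2)) := by
      refine Continuous.div continuous_const (by fun_prop) fun z => ?_
      exact mul_ne_zero (by simp [Real.pi_ne_zero]) (sub_ofReal_ne_zero (by simp [hy]) _)
    have hInt : Integrable (Function.uncurry fun x u : ℝ =>
        Complex.I / (2 * π * ((x + y * Complex.I) - u)) * (w x * g u))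
        ((volume : Measure ℝ).prod volume) :=
      (hwi.mul_prod hgi).bdd_mul hker.aestronglyMeasurable
        (Filter.Eventually.of_forall fun z => norm_cauchyKernel_le hy _ (by simp) _)
    calc _ = ∫ x, ∫ u : ℝ, Complex.I / (2 * π * ((x + y * Complex.I) - u)) * (w x * g u) := by
          congr 1 with x
          rw [hG]
          simp only [cauchyInt]
          rw [← integral_mul_const]
          congr 1 with u
          ring
      _ = ∫ u : ℝ, ∫ x : ℝ, Complex.I / (2 * π * ((x + y * Complex.I) - u)) * (w x * g u) :=
          integral_integral_swap hInt
      _ = _ := by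
          congr 1 with u
          rw [cauchyInt, ← integral_conj, ← integral_const_mul]
          congr 1 with x
          rw [map_mul, conj_cauchyKernel, hw']
          simp only [Complex.conj_conj]
          ring
  have hIle : I ≤ (∫⁻ u, ‖g u‖ₑ ^ p) ^ (1 / p) * (C * I) ^ (1 / q) := by
    have hIeq : I = ‖∫ x, G x * w x‖ₑ := by
      have hcp : Continuous fun x => ‖G x‖ ^ p := hGc.norm.rpow_const fun _ => Or.inr hp0.le
      simp only [hGw]
      rw [integral_indicator measurableSet_Icc, integral_complex_ofReal, ← ofReal_norm,
        Complex.norm_real, Real.norm_eq_abs, abs_of_nonneg (by positivity),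
        ofReal_integral_eq_lintegral_ofReal hcp.continuousOn.integrableOn_Icc
          (Filter.Eventually.of_forall fun x => by positivity)]
      refine lintegral_congr fun x => ?_
      rw [← ofReal_norm, ENNReal.ofReal_rpow_of_nonneg (norm_nonneg _) hp0.le]
    have hF : Measurable fun u : ℝ => ‖cauchyInt w' (u + y * Complex.I)‖ₑ :=
      (continuous_cauchyInt_horizontal hw'i hy).enorm.measurable
    calc I = ‖∫ u, g u * (starRingEnd ℂ) (cauchyInt w' (u + y * Complex.I))‖ₑ := by
          rw [hIeq, hswap]
      _ ≤ ∫⁻ u : ℝ, ‖g u * (starRingEnd ℂ) (cauchyInt w' (u + y * Complex.I))‖ₑ :=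
          enorm_integral_le_lintegral_enorm _
      _ = ∫⁻ u : ℝ, ((fun u => ‖g u‖ₑ) * fun u : ℝ => ‖cauchyInt w' (u + y * Complex.I)‖ₑ) u := by
          refine lintegral_congr fun u => ?_
          rw [enorm_mul, RCLike.enorm_conj]
          rfl
      _ ≤ (∫⁻ u, ‖g u‖ₑ ^ p) ^ (1 / p)
          * (∫⁻ u : ℝ, ‖cauchyInt w' (u + y * Complex.I)‖ₑ ^ q) ^ (1 / q) :=
          ENNReal.lintegral_mul_le_Lp_mul_Lq _ hpq hgm.enorm.aemeasurable hF.aemeasurable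
      _ ≤ _ := by
          have hq0 := hpq.symm.pos
          gcongr
          rw [← hwnorm]
          exact hB
  rcases eq_or_ne I 0 with h0 | h0
  · rw [h0]; exact bot_le
  have hq0 := hpq.symm.pos
  have hsum : 1 / p + 1 / q = 1 := by
    simpa [one_div] using hpq.inv_add_inv_eq_one
  rw [ENNReal.mul_rpow_of_nonneg _ _ (by positivity), ← mul_assoc] at hIle
  have hII : I ^ (1 / p) * I ^ (1 / q) = I := by
    rw [← ENNReal.rpow_add _ _ h0 hIlt.ne, hsum, ENNReal.rpow_one]
  have hq1 : 0 ≤ 1 / q := by positivity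
  have hcancel : I ^ (1 / p) ≤ (∫⁻ u, ‖g u‖ₑ ^ p) ^ (1 / p) * (C : ℝ≥0∞) ^ (1 / q) := by
    refine (ENNReal.mul_le_mul_iff_left (c := I ^ (1 / q)) ?_ ?_).1 (hII.le.trans hIle)
    · exact (ENNReal.rpow_pos (pos_iff_ne_zero.2 h0) hIlt.ne).ne'
    · exact ENNReal.rpow_ne_top_of_nonneg hq1 hIlt.ne
  calc I = (I ^ (1 / p)) ^ p := by
        rw [← ENNReal.rpow_mul, one_div_mul_cancel hp0.ne', ENNReal.rpow_one]
    _ ≤ ((∫⁻ u, ‖g u‖ₑ ^ p) ^ (1 / p) * (C : ℝ≥0∞) ^ (1 / q)) ^ p := by gcongr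
    _ = _ := by
        rw [ENNReal.mul_rpow_of_nonneg _ _ hp0.le, ← ENNReal.rpow_mul, one_div_mul_cancel hp0.ne',
          ENNReal.rpow_one, ← ENNReal.rpow_mul, ENNReal.coe_rpow_of_nonneg _ (by linarith),
          mul_comm]
        congr 2
        rw [hqe]
        have : p - 1 ≠ 0 := by linarith
        field_simp

/-- The M. Riesz inequality, uniformly over horizontal lines. -/
lemma exists_lintegral_cauchyInt_le {p : ℝ} (hp : 1 < p) :
    ∃ C : ℝ≥0, ∀ y : ℝ, 0 < y → ∀ g : ℝ → ℂ, Measurable g →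
      Integrable g → Integrable (fun u : ℝ => (u : ℂ) * g u) →
      ∫⁻ x : ℝ, ‖cauchyInt g (x + y * Complex.I)‖ₑ ^ p ≤ C * ∫⁻ u, ‖g u‖ₑ ^ p := by
  rcases le_or_gt p 2 with h | h
  · exact exists_lintegral_cauchyInt_le_of_le_two hp h
  · exact exists_lintegral_cauchyInt_le_of_two_lt h

/-- The character `r ↦ e^{2πir}`. -/
def ex (r : ℝ) : ℂ := Complex.exp ((2 * π * r : ℝ) * Complex.I)

lemma norm_ex (r : ℝ) : ‖ex r‖ = 1 := Complex.norm_exp_ofReal_mul_I _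

lemma ex_add (r s : ℝ) : ex (r + s) = ex r * ex s := by
  rw [ex, ex, ex, ← Complex.exp_add]
  congr 1
  push_cast
  ring

lemma continuous_ex : Continuous ex := by
  unfold ex
  fun_prop

lemma measurable_ex : Measurable ex := continuous_ex.measurable

lemma integral_Ioi_cexp {w : ℂ} (hw : 0 < w.im) :
    ∫ σ in Set.Ioi (0 : ℝ), Complex.exp (2 * π * Complex.I * w * σ)
      = Complex.I / (2 * π * w) := by
  have hw0 : w ≠ 0 := fun h => by simp [h] at hw
  have hpi : (π : ℂ) ≠ 0 := by exact_mod_cast Real.pi_ne_zero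
  rw [integral_exp_mul_complex_Ioi (by simp; positivity)]
  simp only [Complex.ofReal_zero, mul_zero, Complex.exp_zero]
  field_simp
  simp

lemma integral_ex_mul_gaussian {ε : ℝ} (hε : 0 < ε) (l : ℝ) :
    ∫ u : ℝ, ex (u * l) * (Real.exp (-π * (ε * u) ^ 2) : ℂ)
      = ((1 / ε * Real.exp (-π * (l / ε) ^ 2) : ℝ) : ℂ) := by
  have hb : 0 < ((π * ε ^ 2 : ℝ) : ℂ).re := by simp only [Complex.ofReal_re]; positivity
  have := fourierIntegral_gaussian hb ((2 * π * l : ℝ) : ℂ)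
  have e1 : (∫ u : ℝ, ex (u * l) * (Real.exp (-π * (ε * u) ^ 2) : ℂ))
      = ∫ x : ℝ, Complex.exp (Complex.I * ((2 * π * l : ℝ) : ℂ) * x)
        * Complex.exp (-((π * ε ^ 2 : ℝ) : ℂ) * x ^ 2) := by
    congr 1 with u
    rw [ex, Complex.ofReal_exp]
    congr 2 <;> push_cast <;> ring
  rw [e1, this]
  have hpi := Real.pi_pos
  have e2 : (π : ℂ) / ((π * ε ^ 2 : ℝ) : ℂ) = (((1 / ε) ^ 2 : ℝ) : ℂ) := by
    rw [← Complex.ofReal_div]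
    congr 1
    field_simp
  rw [e2]
  have e3 : (((1 / ε) ^ 2 : ℝ) : ℂ) ^ (1 / 2 : ℂ) = ((1 / ε : ℝ) : ℂ) := by
    have : (1 / 2 : ℂ) = ((1 / 2 : ℝ) : ℂ) := by push_cast; rfl
    rw [this, ← Complex.ofReal_cpow (by positivity), ← Real.sqrt_eq_rpow,
      Real.sqrt_sq (by positivity)]
  rw [e3, Complex.ofReal_mul (1 / ε) (Real.exp _), Complex.ofReal_exp]
  congr 2
  have h1 : (π : ℂ) ≠ 0 := by exact_mod_cast hpi.ne'
  have h2 : (ε : ℂ) ≠ 0 := by exact_mod_cast hε.ne'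
  push_cast
  field_simp
  ring

/-- The boundary function `σ ↦ 1_{σ>0} e^{2πizσ}`. -/
def halfExp (z : ℂ) (σ : ℝ) : ℂ :=
  if 0 < σ then Complex.exp (2 * π * Complex.I * z * σ) else 0

lemma norm_halfExp_le {z : ℂ} (hz : 0 ≤ z.im) (σ : ℝ) : ‖halfExp z σ‖ ≤ 1 := by
  unfold halfExp
  split_ifs with h
  · rw [Complex.norm_exp]
    simp
    positivity
  · simp

lemma measurable_halfExp (z : ℂ) : Measurable (halfExp z) := by
  unfold halfExp
  refine Measurable.ite measurableSet_Ioi ?_ measurable_const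
  fun_prop

lemma continuousAt_halfExp (z : ℂ) {σ : ℝ} (h : σ ≠ 0) : ContinuousAt (halfExp z) σ := by
  rcases lt_or_gt_of_ne h with h | h
  · refine continuousAt_const.congr (f := fun _ => (0 : ℂ)) ?_
    filter_upwards [Iio_mem_nhds h] with x hx
    simp [halfExp, not_lt.2 (Set.mem_Iio.1 hx).le]
  · refine ContinuousAt.congr (f := fun σ : ℝ => Complex.exp (2 * π * Complex.I * z * σ)) ?_ ?_
    · fun_prop
    · filter_upwards [Ioi_mem_nhds h] with x hx
      simp [halfExp, Set.mem_Ioi.1 hx]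

lemma integrable_gaussian_pi : Integrable fun v : ℝ => Real.exp (-π * v ^ 2) :=
  integrable_exp_neg_mul_sq Real.pi_pos

lemma integral_gaussian_pi : ∫ v : ℝ, Real.exp (-π * v ^ 2) = 1 := by
  rw [integral_gaussian, div_self Real.pi_ne_zero, Real.sqrt_one]

lemma integral_cauchyKernel_gaussian {ε : ℝ} (hε : 0 < ε) {z : ℂ} (hz : 0 < z.im) (l : ℝ) :
    ∫ u : ℝ, Complex.I / (2 * π * (z - u)) * ((Real.exp (-π * (ε * u) ^ 2) : ℂ) * ex (u * l))
      = ∫ v : ℝ, halfExp z (l + ε * v) * (Real.exp (-π * v ^ 2) : ℂ) := by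
  have hgi : Integrable fun u : ℝ => (Real.exp (-π * (ε * u) ^ 2) : ℂ) :=
    (integrable_gaussian_pi.comp_mul_left' hε.ne').ofReal
  have hexp : IntegrableOn (fun σ : ℝ => Complex.exp (2 * π * Complex.I * z * σ)) (Set.Ioi 0) :=
    integrableOn_exp_mul_complex_Ioi (by simp; positivity) 0
  have hInt : Integrable (Function.uncurry fun (u σ : ℝ) =>
      Complex.exp (2 * π * Complex.I * z * σ) * (Real.exp (-π * (ε * u) ^ 2) : ℂ)
        * ex (u * (l - σ))) (volume.prod (volume.restrict (Set.Ioi 0))) := by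
    refine ((hgi.mul_prod hexp).mul_bdd (c := 1) (g := fun x : ℝ × ℝ => ex (x.1 * (l - x.2)))
      ?_ (Filter.Eventually.of_forall fun x => (norm_ex _).le)).congr
      (Filter.Eventually.of_forall fun x => ?_)
    · exact (continuous_ex.comp (by fun_prop)).aestronglyMeasurable
    · simp only [Function.uncurry]
      ring
  calc _ = ∫ u : ℝ, ∫ σ in Set.Ioi (0 : ℝ), Complex.exp (2 * π * Complex.I * z * σ)
        * (Real.exp (-π * (ε * u) ^ 2) : ℂ) * ex (u * (l - σ)) := by
        congr 1 with u
        rw [← integral_Ioi_cexp (w := z - u) (by simpa using hz), ← integral_mul_const]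
        congr 1 with σ
        have : ex (u * (l - σ)) = ex (u * l) * ex (u * (-σ)) := by rw [← ex_add]; ring_nf
        rw [this]
        have : Complex.exp (2 * π * Complex.I * (z - u) * σ)
            = Complex.exp (2 * π * Complex.I * z * σ) * ex (u * (-σ)) := by
          rw [ex, ← Complex.exp_add]
          congr 1
          push_cast
          ring
        rw [this]
        ring
    _ = ∫ σ in Set.Ioi (0 : ℝ), ∫ u : ℝ, Complex.exp (2 * π * Complex.I * z * σ)
        * (Real.exp (-π * (ε * u) ^ 2) : ℂ) * ex (u * (l - σ)) := integral_integral_swap hInt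
    _ = ∫ σ in Set.Ioi (0 : ℝ), Complex.exp (2 * π * Complex.I * z * σ)
          * ((1 / ε * Real.exp (-π * ((l - σ) / ε) ^ 2) : ℝ) : ℂ) := by
        congr 1 with σ
        rw [← integral_ex_mul_gaussian hε, ← integral_const_mul]
        congr 1 with u
        ring
    _ = ∫ σ : ℝ, halfExp z σ * ((1 / ε * Real.exp (-π * ((l - σ) / ε) ^ 2) : ℝ) : ℂ) := by
        rw [← integral_indicator measurableSet_Ioi]
        congr 1 with σ
        by_cases h : 0 < σ <;> simp [halfExp, h]
    _ = ∫ σ : ℝ, halfExp z (l + σ) * ((1 / ε * Real.exp (-π * (σ / ε) ^ 2) : ℝ) : ℂ) := by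
        rw [← integral_add_left_eq_self _ l]
        congr 1 with σ
        congr 4
        ring
    _ = _ := by
        have := Measure.integral_comp_mul_left (fun σ : ℝ => halfExp z (l + σ)
          * ((1 / ε * Real.exp (-π * (σ / ε) ^ 2) : ℝ) : ℂ)) ε
        rw [abs_of_pos (inv_pos.2 hε), ← inv_smul_eq_iff₀ (by positivity), inv_inv] at this
        rw [← this, ← integral_smul]
        congr 1 with v
        have h2 : (ε : ℂ) ≠ 0 := by exact_mod_cast hε.ne'
        rw [mul_div_cancel_left₀ _ hε.ne', Complex.real_smul]
        push_cast
        field_simp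

lemma tendsto_integral_halfExp_gaussian {z : ℂ} (hz : 0 ≤ z.im) {l : ℝ} (hl : l ≠ 0) :
    Filter.Tendsto (fun n : ℕ => ∫ v : ℝ, halfExp z (l + (1 / ((n : ℝ) + 1)) * v)
      * (Real.exp (-π * v ^ 2) : ℂ)) Filter.atTop (nhds (halfExp z l)) := by
  have e : halfExp z l = ∫ v : ℝ, halfExp z l * (Real.exp (-π * v ^ 2) : ℂ) := by
    rw [integral_const_mul, integral_complex_ofReal, integral_gaussian_pi]
    simp
  rw [e]
  refine tendsto_integral_of_dominated_convergence (fun v => Real.exp (-π * v ^ 2))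
    (fun n => ?_) integrable_gaussian_pi (fun n => Filter.Eventually.of_forall fun v => ?_)
    (Filter.Eventually.of_forall fun v => ?_)
  · refine (Measurable.mul ?_ ?_).aestronglyMeasurable
    · exact (measurable_halfExp z).comp (by fun_prop)
    · fun_prop
  · rw [norm_mul, Complex.norm_real, Real.norm_of_nonneg (Real.exp_pos _).le]
    exact mul_le_of_le_one_left (Real.exp_pos _).le (norm_halfExp_le hz _)
  · refine Filter.Tendsto.mul_const _ ?_
    refine (continuousAt_halfExp z hl).tendsto.comp ?_
    have := (tendsto_one_div_add_atTop_nhds_zero_nat (𝕜 := ℝ)).mul_const v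
    simpa using this.const_add l

lemma norm_integral_halfExp_gaussian_le {z : ℂ} (hz : 0 ≤ z.im) (l ε : ℝ) :
    ‖∫ v : ℝ, halfExp z (l + ε * v) * (Real.exp (-π * v ^ 2) : ℂ)‖ ≤ 1 := by
  rw [← integral_gaussian_pi]
  refine norm_integral_le_of_norm_le integrable_gaussian_pi
    (Filter.Eventually.of_forall fun v => ?_)
  rw [norm_mul, Complex.norm_real, Real.norm_of_nonneg (Real.exp_pos _).le]
  exact mul_le_of_le_one_left (Real.exp_pos _).le (norm_halfExp_le hz _)

/-- The symbol `1_{l>0} e^{-2πyl}`. -/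
def halfSym (y l : ℝ) : ℂ := halfExp (y * Complex.I) l

lemma norm_halfSym_le {y : ℝ} (hy : 0 ≤ y) (l : ℝ) : ‖halfSym y l‖ ≤ 1 :=
  norm_halfExp_le (by simpa using hy) l

lemma measurable_halfSym (y : ℝ) : Measurable (halfSym y) := measurable_halfExp _

lemma halfExp_add_mul_I (t y l : ℝ) :
    halfExp (t + y * Complex.I) l = halfSym y l * ex (t * l) := by
  unfold halfSym halfExp
  split_ifs
  · rw [ex, ← Complex.exp_add]
    congr 1
    push_cast
    ring
  · simp

lemma tendsto_halfSym (l : ℝ) : Filter.Tendsto (fun n : ℕ => halfSym (1 / ((n : ℝ) + 1)) l)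
    Filter.atTop (nhds (halfSym 0 l)) := by
  have h : Continuous fun y => halfSym y l := by
    unfold halfSym halfExp
    split_ifs <;> fun_prop
  exact (h.tendsto 0).comp tendsto_one_div_add_atTop_nhds_zero_nat

lemma lintegral_enorm_rpow_le_of_tendsto {X : Type*} [MeasurableSpace X] {ν : Measure X} {p : ℝ}
    {F : ℕ → X → ℂ} {G : X → ℂ} {M : ℝ≥0∞} (hF : ∀ n, Measurable (F n))
    (hlim : ∀ x, Filter.Tendsto (fun n => F n x) Filter.atTop (nhds (G x)))
    (hM : ∀ n, ∫⁻ x, ‖F n x‖ₑ ^ p ∂ν ≤ M) : ∫⁻ x, ‖G x‖ₑ ^ p ∂ν ≤ M := by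
  have hl (x : X) : Filter.liminf (fun n => ‖F n x‖ₑ ^ p) Filter.atTop = ‖G x‖ₑ ^ p :=
    (((ENNReal.continuous_rpow_const (y := p)).tendsto _).comp (hlim x).enorm).liminf_eq
  calc ∫⁻ x, ‖G x‖ₑ ^ p ∂ν = ∫⁻ x, Filter.liminf (fun n => ‖F n x‖ₑ ^ p) Filter.atTop ∂ν := by
        simp only [hl]
    _ ≤ Filter.liminf (fun n => ∫⁻ x, ‖F n x‖ₑ ^ p ∂ν) Filter.atTop :=
        lintegral_liminf_le fun n => (hF n).enorm.pow_const p
    _ ≤ M := Filter.liminf_le_of_le (by isBoundedDefault) fun b hb => by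
        obtain ⟨n, hn⟩ := hb.exists
        exact hn.trans (hM n)

section OneDim

variable {Ω : Type*} [MeasurableSpace Ω] {μ : Measure Ω}

lemma continuous_integral_mul_ex {h : Ω → ℂ} {l : Ω → ℝ} (hh : Integrable h μ)
    (hl : Measurable l) : Continuous fun t : ℝ => ∫ ω, h ω * ex (t * l ω) ∂μ := by
  refine continuous_of_dominated (bound := fun ω => ‖h ω‖) (fun t => ?_)
    (fun t => Filter.Eventually.of_forall fun ω => ?_) hh.norm
    (Filter.Eventually.of_forall fun ω => ?_)
  · exact hh.aestronglyMeasurable.mul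
      (measurable_ex.comp (hl.const_mul t)).aestronglyMeasurable
  · simp [norm_ex]
  · exact continuous_const.mul (continuous_ex.comp (by fun_prop))

lemma cauchyInt_gaussian_mul [SFinite μ] {h : Ω → ℂ} {l : Ω → ℝ} (hh : Integrable h μ)
    (hl : Measurable l) {ε : ℝ} (hε : 0 < ε) {z : ℂ} (hz : 0 < z.im) :
    cauchyInt (fun u : ℝ => (Real.exp (-π * (ε * u) ^ 2) : ℂ) * ∫ ω, h ω * ex (u * l ω) ∂μ) z
      = ∫ ω, h ω * (∫ v : ℝ, halfExp z (l ω + ε * v) * (Real.exp (-π * v ^ 2) : ℂ)) ∂μ := by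
  have hgi : Integrable fun u : ℝ => (Real.exp (-π * (ε * u) ^ 2) : ℂ) :=
    (integrable_gaussian_pi.comp_mul_left' hε.ne').ofReal
  have hInt : Integrable (Function.uncurry fun (u : ℝ) (ω : Ω) =>
      Complex.I / (2 * π * (z - u)) * ((Real.exp (-π * (ε * u) ^ 2) : ℂ)
        * (h ω * ex (u * l ω)))) (volume.prod μ) := by
    refine (((integrable_cauchyKernel_mul hgi hz).mul_prod hh).mul_bdd (c := 1)
      (g := fun x : ℝ × Ω => ex (x.1 * l x.2))
      ?_ (Filter.Eventually.of_forall fun x => (norm_ex _).le)).congr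
      (Filter.Eventually.of_forall fun x => ?_)
    · exact (measurable_ex.comp
        (measurable_fst.mul (hl.comp measurable_snd))).aestronglyMeasurable
    · simp only [Function.uncurry]
      ring
  calc _ = ∫ u : ℝ, ∫ ω, Complex.I / (2 * π * (z - u)) * ((Real.exp (-π * (ε * u) ^ 2) : ℂ)
        * (h ω * ex (u * l ω))) ∂μ := by
        unfold cauchyInt
        congr 1 with u
        simp only [← integral_const_mul]
    _ = ∫ ω, (∫ u : ℝ, Complex.I / (2 * π * (z - u)) * ((Real.exp (-π * (ε * u) ^ 2) : ℂ)
        * (h ω * ex (u * l ω)))) ∂μ := integral_integral_swap hInt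
    _ = _ := by
        congr 1 with ω
        rw [← integral_cauchyKernel_gaussian hε hz, ← integral_const_mul]
        congr 1 with u
        ring

lemma exists_lintegral_halfSym_le {p : ℝ} (hp : 1 < p) :
    ∃ C : ℝ≥0, ∀ (Ω : Type) [MeasurableSpace Ω] (μ : Measure Ω) [SFinite μ] (h : Ω → ℂ)
      (l : Ω → ℝ), Integrable h μ → Measurable l → (∀ᵐ ω ∂μ, l ω ≠ 0) → ∀ y : ℝ, 0 ≤ y →
      ∫⁻ t : ℝ, ‖∫ ω, (halfSym y (l ω) * h ω) * ex (t * l ω) ∂μ‖ₑ ^ p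
        ≤ C * ∫⁻ t : ℝ, ‖∫ ω, h ω * ex (t * l ω) ∂μ‖ₑ ^ p := by
  obtain ⟨C, hC⟩ := exists_lintegral_cauchyInt_le hp
  refine ⟨C, fun Ω _ μ _ h l hh hl hl0 => ?_⟩
  have hInt (y : ℝ) (hy : 0 ≤ y) : Integrable (fun ω => halfSym y (l ω) * h ω) μ :=
    hh.bdd_mul (c := 1) ((measurable_halfSym y).comp hl).aestronglyMeasurable
      (Filter.Eventually.of_forall fun ω => norm_halfSym_le hy _)
  have hfc := continuous_integral_mul_ex hh hl
  have hpos (y : ℝ) (hy : 0 < y) :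
      ∫⁻ t : ℝ, ‖∫ ω, (halfSym y (l ω) * h ω) * ex (t * l ω) ∂μ‖ₑ ^ p
        ≤ C * ∫⁻ t : ℝ, ‖∫ ω, h ω * ex (t * l ω) ∂μ‖ₑ ^ p := by
    set f : ℕ → ℝ → ℂ := fun n u =>
      (Real.exp (-π * (1 / ((n : ℝ) + 1) * u) ^ 2) : ℂ) * ∫ ω, h ω * ex (u * l ω) ∂μ with hf
    have hε (n : ℕ) : 0 < 1 / ((n : ℝ) + 1) := by positivity
    have hfb (u : ℝ) : ‖∫ ω, h ω * ex (u * l ω) ∂μ‖ ≤ ∫ ω, ‖h ω‖ ∂μ :=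
      (norm_integral_le_integral_norm _).trans (by simp [norm_ex])
    have hgi (n : ℕ) : Integrable fun u : ℝ => (Real.exp (-π * (1 / ((n : ℝ) + 1) * u) ^ 2) : ℂ) :=
      (integrable_gaussian_pi.comp_mul_left' (hε n).ne').ofReal
    have hgi' (n : ℕ) : Integrable fun u : ℝ =>
        (u : ℂ) * (Real.exp (-π * (1 / ((n : ℝ) + 1) * u) ^ 2) : ℂ) := by
      have h0 : Integrable fun u : ℝ =>
          u * Real.exp (-(π * (1 / ((n : ℝ) + 1)) ^ 2) * u ^ 2) :=
        integrable_mul_exp_neg_mul_sq (mul_pos Real.pi_pos (pow_pos (hε n) 2))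
      have h1 : Integrable fun u : ℝ =>
          ((u * Real.exp (-(π * (1 / ((n : ℝ) + 1)) ^ 2) * u ^ 2) : ℝ) : ℂ) := h0.ofReal
      refine h1.congr (Filter.Eventually.of_forall fun u => ?_)
      simp only
      rw [Complex.ofReal_mul u]
      congr 3
      ring
    have hfi (n : ℕ) : Integrable (f n) :=
      (hgi n).mul_bdd (c := ∫ ω, ‖h ω‖ ∂μ) hfc.aestronglyMeasurable
        (Filter.Eventually.of_forall hfb)
    have hfi' (n : ℕ) : Integrable fun u : ℝ => (u : ℂ) * f n u := by
      simp only [hf, ← mul_assoc]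
      exact (hgi' n).mul_bdd (c := ∫ ω, ‖h ω‖ ∂μ) hfc.aestronglyMeasurable
        (Filter.Eventually.of_forall hfb)
    have hfm (n : ℕ) : Measurable (f n) := by
      refine (Continuous.mul ?_ hfc).measurable
      fun_prop
    refine lintegral_enorm_rpow_le_of_tendsto
      (F := fun n (t : ℝ) => cauchyInt (f n) (t + y * Complex.I))
      (fun n => (continuous_cauchyInt_horizontal (hfi n) hy).measurable) (fun t => ?_)
      (fun n => (hC y hy (f n) (hfm n) (hfi n) (hfi' n)).trans ?_)
    · have hz : 0 < ((t : ℂ) + y * Complex.I).im := by simpa using hy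
      have e (ω : Ω) : (halfSym y (l ω) * h ω) * ex (t * l ω)
          = h ω * halfExp (t + y * Complex.I) (l ω) := by
        rw [halfExp_add_mul_I]; ring
      simp only [e, hf, cauchyInt_gaussian_mul hh hl (hε _) hz]
      refine tendsto_integral_of_dominated_convergence (fun ω => ‖h ω‖) (fun n => ?_) hh.norm
        (fun n => Filter.Eventually.of_forall fun ω => ?_) ?_
      · refine hh.aestronglyMeasurable.mul (AEStronglyMeasurable.comp_measurable (g := fun r : ℝ =>
          ∫ v : ℝ, halfExp (t + y * Complex.I) (r + 1 / ((n : ℝ) + 1) * v)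
            * (Real.exp (-π * v ^ 2) : ℂ)) ?_ hl)
        refine StronglyMeasurable.aestronglyMeasurable ?_
        refine StronglyMeasurable.integral_prod_right (Measurable.stronglyMeasurable ?_)
        refine Measurable.mul ((measurable_halfExp _).comp ?_) ?_ <;> fun_prop
      · rw [norm_mul]
        exact mul_le_of_le_one_right (norm_nonneg _)
          (norm_integral_halfExp_gaussian_le hz.le _ _)
      · filter_upwards [hl0] with ω hω
        exact (tendsto_integral_halfExp_gaussian hz.le hω).const_mul _
    · refine mul_le_mul_right (lintegral_mono fun u => ?_) _
      gcongr
      refine enorm_le_iff_norm_le.2 ?_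
      simp only [hf, norm_mul]
      refine mul_le_of_le_one_left (norm_nonneg _) ?_
      rw [Complex.norm_real, Real.norm_of_nonneg (Real.exp_pos _).le, Real.exp_le_one_iff]
      have := Real.pi_pos
      nlinarith [sq_nonneg (1 / ((n : ℝ) + 1) * u)]
  intro y hy
  rcases hy.eq_or_lt with rfl | hy
  · have hε (n : ℕ) : 0 < 1 / ((n : ℝ) + 1) := by positivity
    refine lintegral_enorm_rpow_le_of_tendsto
      (F := fun n t => ∫ ω, (halfSym (1 / ((n : ℝ) + 1)) (l ω) * h ω) * ex (t * l ω) ∂μ)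
      (fun n => (continuous_integral_mul_ex (hInt _ (hε n).le) hl).measurable) (fun t => ?_)
      (fun n => hpos _ (hε n))
    refine tendsto_integral_of_dominated_convergence (fun ω => ‖h ω‖) (fun n => ?_) hh.norm
      (fun n => Filter.Eventually.of_forall fun ω => ?_)
      (Filter.Eventually.of_forall fun ω => ?_)
    · exact (hInt _ (hε n).le).aestronglyMeasurable.mul
        (measurable_ex.comp (hl.const_mul t)).aestronglyMeasurable
    · rw [norm_mul, norm_mul, norm_ex, mul_one]
      exact mul_le_of_le_one_left (norm_nonneg _) (norm_halfSym_le (hε n).le _)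
    · exact ((tendsto_halfSym (l ω)).mul_const _).mul_const _
  · exact hpos y hy

end OneDim

/-- The symbol `1_{±l>0} e^{-2πy|l|}`; the sign is `+` for `true`. -/
def sgnSym (b : Bool) (y l : ℝ) : ℂ := halfSym y (if b then l else -l)

lemma norm_sgnSym_le (b : Bool) {y : ℝ} (hy : 0 ≤ y) (l : ℝ) : ‖sgnSym b y l‖ ≤ 1 :=
  norm_halfSym_le hy _

lemma measurable_sgnSym (b : Bool) (y : ℝ) : Measurable (sgnSym b y) := by
  cases b
  · exact (measurable_halfSym y).comp measurable_neg
  · exact measurable_halfSym y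

lemma exists_lintegral_sgnSym_le {p : ℝ} (hp : 1 < p) :
    ∃ C : ℝ≥0, ∀ (Ω : Type) [MeasurableSpace Ω] (μ : Measure Ω) [SFinite μ] (h : Ω → ℂ)
      (l : Ω → ℝ), Integrable h μ → Measurable l → (∀ᵐ ω ∂μ, l ω ≠ 0) →
      ∀ (b : Bool) (y : ℝ), 0 ≤ y →
      ∫⁻ t : ℝ, ‖∫ ω, (sgnSym b y (l ω) * h ω) * ex (t * l ω) ∂μ‖ₑ ^ p
        ≤ C * ∫⁻ t : ℝ, ‖∫ ω, h ω * ex (t * l ω) ∂μ‖ₑ ^ p := by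
  obtain ⟨C, hC⟩ := exists_lintegral_halfSym_le hp
  refine ⟨C, fun Ω _ μ _ h l hh hl hl0 b y hy => ?_⟩
  cases b
  · have := hC Ω μ h (fun ω => -l ω) hh hl.neg (by simpa using hl0) y hy
    rw [← lintegral_neg_eq_self (f := fun t : ℝ =>
      ‖∫ ω, (sgnSym false y (l ω) * h ω) * ex (t * l ω) ∂μ‖ₑ ^ p),
      ← lintegral_neg_eq_self (f := fun t : ℝ => ‖∫ ω, h ω * ex (t * l ω) ∂μ‖ₑ ^ p)]
    simpa [sgnSym] using this
  · exact hC Ω μ h l hh hl hl0 y hy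

section Osc

variable {Ω : Type} [MeasurableSpace Ω] {d : ℕ}

/-- Superposition `∫ h(ω) e^{2πi⟨ζ(ω), x⟩} dμ(ω)` of plane waves. -/
def osc (μ : Measure Ω) (ζ : Ω → Rd d) (h : Ω → ℂ) (x : Rd d) : ℂ :=
  ∫ ω, h ω * ex (inner ℝ (ζ ω) x) ∂μ

variable {μ : Measure Ω} {ζ : Ω → Rd d} {h : Ω → ℂ}

lemma Integrable.mul_ex {l : Ω → ℝ} (hh : Integrable h μ) (hl : Measurable l) :
    Integrable (fun ω => h ω * ex (l ω)) μ :=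
  hh.mul_bdd (c := 1) (measurable_ex.comp hl).aestronglyMeasurable
    (Filter.Eventually.of_forall fun _ => (norm_ex _).le)

lemma continuous_osc (hh : Integrable h μ) (hζ : Measurable ζ) : Continuous (osc μ ζ h) := by
  refine continuous_of_dominated (bound := fun ω => ‖h ω‖) (fun t => ?_)
    (fun t => Filter.Eventually.of_forall fun ω => ?_) hh.norm
    (Filter.Eventually.of_forall fun ω => ?_)
  · exact (Integrable.mul_ex hh (hζ.inner_const)).aestronglyMeasurable
  · simp [norm_ex]
  · exact continuous_const.mul (continuous_ex.comp (by fun_prop))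

lemma lintegral_toLp (f : Rd d → ℝ≥0∞) :
    ∫⁻ x : Fin d → ℝ, f (WithLp.toLp 2 x) = ∫⁻ x, f x :=
  (PiLp.volume_preserving_toLp (Fin d)).lintegral_comp_emb
    (MeasurableEquiv.toLp 2 (Fin d → ℝ)).measurableEmbedding f

lemma inner_toLp_update (v : Rd d) (x : Fin d → ℝ) (i : Fin d) (t : ℝ) :
    inner ℝ v (WithLp.toLp 2 (Function.update x i t) : Rd d)
      = inner ℝ v (WithLp.toLp 2 (Function.update x i 0) : Rd d) + t * v i := by
  simp only [PiLp.inner_apply]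
  rw [← Finset.add_sum_erase _ _ (Finset.mem_univ i),
    ← Finset.add_sum_erase Finset.univ (fun j => inner ℝ (v j) _) (Finset.mem_univ i)]
  simp only [Function.update_self]
  have : ∑ j ∈ Finset.univ.erase i, inner ℝ (v j) (Function.update x i t j)
      = ∑ j ∈ Finset.univ.erase i, inner ℝ (v j) (Function.update x i 0 j) := by
    refine Finset.sum_congr rfl fun j hj => ?_
    rw [Function.update_of_ne (Finset.ne_of_mem_erase hj),
      Function.update_of_ne (Finset.ne_of_mem_erase hj)]
  rw [this]
  simp
  ring

lemma measurable_coord (hζ : Measurable ζ) (i : Fin d) : Measurable fun ω => ζ ω i :=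
  (measurable_pi_apply i).comp ((MeasurableEquiv.toLp 2 (Fin d → ℝ)).symm.measurable.comp hζ)

lemma integrable_sgnSym_mul (hh : Integrable h μ) (hζ : Measurable ζ) (i : Fin d) (b : Bool)
    {y : ℝ} (hy : 0 ≤ y) : Integrable (fun ω => sgnSym b y (ζ ω i) * h ω) μ :=
  hh.bdd_mul (c := 1) ((measurable_sgnSym b y).comp (measurable_coord hζ i)).aestronglyMeasurable
    (Filter.Eventually.of_forall fun _ => norm_sgnSym_le b hy _)

end Osc

lemma exists_lintegral_osc_coord_le {p : ℝ} (hp : 1 < p) :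
    ∃ C : ℝ≥0, ∀ (d : ℕ) (Ω : Type) [MeasurableSpace Ω] (μ : Measure Ω) [SFinite μ] (h : Ω → ℂ)
      (ζ : Ω → Rd d), Integrable h μ → Measurable ζ → ∀ i : Fin d, (∀ᵐ ω ∂μ, ζ ω i ≠ 0) →
      ∀ (b : Bool) (y : ℝ), 0 ≤ y →
      ∫⁻ x, ‖osc μ ζ (fun ω => sgnSym b y (ζ ω i) * h ω) x‖ₑ ^ p
        ≤ C * ∫⁻ x, ‖osc μ ζ h x‖ₑ ^ p := by
  obtain ⟨C, hC⟩ := exists_lintegral_sgnSym_le hp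
  refine ⟨C, fun d Ω _ μ _ h ζ hh hζ i hi b y hy => ?_⟩
  have hm1 := (continuous_osc (integrable_sgnSym_mul hh hζ i b hy) hζ).enorm.measurable.pow_const p
  have hm2 := (continuous_osc hh hζ).enorm.measurable.pow_const p
  have hto : Measurable (WithLp.toLp 2 : (Fin d → ℝ) → Rd d) :=
    (MeasurableEquiv.toLp 2 (Fin d → ℝ)).measurable
  rw [← lintegral_const_mul _ hm2, ← lintegral_toLp, ← lintegral_toLp]
  refine lintegral_le_of_lmarginal_le {i} (hm1.comp hto)
    ((hm2.const_mul _).comp hto) ?_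
  rw [lmarginal_singleton, lmarginal_singleton]
  intro x
  have e (g : Ω → ℂ) (t : ℝ) : osc μ ζ g (WithLp.toLp 2 (Function.update x i t))
      = ∫ ω, g ω * ex (inner ℝ (ζ ω) (WithLp.toLp 2 (Function.update x i 0) : Rd d))
        * ex (t * ζ ω i) ∂μ := by
    unfold osc
    simp only [inner_toLp_update _ x i t, ex_add, mul_assoc]
  have := hC Ω μ (fun ω => h ω * ex (inner ℝ (ζ ω)
    (WithLp.toLp 2 (Function.update x i 0) : Rd d))) (fun ω => ζ ω i)
    (Integrable.mul_ex hh hζ.inner_const) (measurable_coord hζ i) hi b y hy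
  simp only [e]
  rw [lintegral_const_mul']
  · simpa only [mul_assoc] using this
  · simp

lemma exists_lintegral_osc_prod_le {p : ℝ} (hp : 1 < p) (d : ℕ) :
    ∃ C : ℝ≥0, ∀ (Ω : Type) [MeasurableSpace Ω] (μ : Measure Ω) [SFinite μ] (h : Ω → ℂ)
      (ζ : Ω → Rd d), Integrable h μ → Measurable ζ → (∀ i : Fin d, ∀ᵐ ω ∂μ, ζ ω i ≠ 0) →
      ∀ (b : Fin d → Bool) (y : Fin d → ℝ), (∀ i, 0 ≤ y i) →
      Integrable (fun ω => (∏ i, sgnSym (b i) (y i) (ζ ω i)) * h ω) μ ∧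
      ∫⁻ x, ‖osc μ ζ (fun ω => (∏ i, sgnSym (b i) (y i) (ζ ω i)) * h ω) x‖ₑ ^ p
        ≤ C * ∫⁻ x, ‖osc μ ζ h x‖ₑ ^ p := by
  obtain ⟨C, hC⟩ := exists_lintegral_osc_coord_le hp
  refine ⟨C ^ d, fun Ω _ μ _ h ζ hh hζ hζ0 b y hy => ?_⟩
  have key (S : Finset (Fin d)) :
      Integrable (fun ω => (∏ i ∈ S, sgnSym (b i) (y i) (ζ ω i)) * h ω) μ ∧
      ∫⁻ x, ‖osc μ ζ (fun ω => (∏ i ∈ S, sgnSym (b i) (y i) (ζ ω i)) * h ω) x‖ₑ ^ p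
        ≤ (C : ℝ≥0∞) ^ S.card * ∫⁻ x, ‖osc μ ζ h x‖ₑ ^ p := by
    induction S using Finset.induction_on with
    | empty => simpa using hh
    | insert i S hi ih =>
      simp only [Finset.prod_insert hi, mul_assoc, Finset.card_insert_of_notMem hi]
      refine ⟨integrable_sgnSym_mul ih.1 hζ i (b i) (hy i),
        (hC d Ω μ _ ζ ih.1 hζ i (hζ0 i) (b i) (y i) (hy i)).trans ?_⟩
      rw [pow_succ', mul_assoc]
      gcongr
      exact ih.2
  simpa using key Finset.univ

lemma lintegral_comp_inv_smul {d : ℕ} (f : Rd d → ℝ≥0∞) {R : ℝ} (hR : 0 < R) :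
    ∫⁻ x, f (R⁻¹ • x) = ENNReal.ofReal (R ^ d) * ∫⁻ x, f x := by
  let e : Rd d ≃ᵐ Rd d := (Homeomorph.smulOfNeZero R⁻¹ (inv_ne_zero hR.ne')).toMeasurableEquiv
  have h1 := lintegral_map_equiv (μ := volume) f e
  have h2 : Measure.map e volume = ENNReal.ofReal (R ^ d) • (volume : Measure (Rd d)) := by
    have := Measure.map_addHaar_smul (volume : Measure (Rd d)) (inv_ne_zero hR.ne')
    rw [finrank_euclideanSpace_fin, inv_pow, inv_inv, abs_of_pos (by positivity)] at this
    exact this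
  rw [h2, lintegral_smul_measure] at h1
  exact h1.symm

lemma eLpNorm_ofReal_eq {X : Type*} [MeasurableSpace X] {ν : Measure X} (f : X → ℂ) {p : ℝ}
    (hp : 0 < p) : eLpNorm f (ENNReal.ofReal p) ν = (∫⁻ x, ‖f x‖ₑ ^ p ∂ν) ^ (1 / p) := by
  rw [eLpNorm_eq_lintegral_rpow_enorm_toReal (by simpa using hp) ENNReal.ofReal_ne_top,
    ENNReal.toReal_ofReal hp.le]

lemma eLpNorm_le_of_lintegral_le {X : Type*} [MeasurableSpace X] {ν : Measure X} {f g : X → ℂ}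
    {p : ℝ} (hp : 0 < p) {C : ℝ≥0} (h : ∫⁻ x, ‖f x‖ₑ ^ p ∂ν ≤ C * ∫⁻ x, ‖g x‖ₑ ^ p ∂ν) :
    eLpNorm f (ENNReal.ofReal p) ν
      ≤ ((C ^ (1 / p) : ℝ≥0) : ℝ≥0∞) * eLpNorm g (ENNReal.ofReal p) ν := by
  have hp' : 0 ≤ 1 / p := by positivity
  rw [eLpNorm_ofReal_eq f hp, eLpNorm_ofReal_eq g hp, ENNReal.coe_rpow_of_nonneg _ hp',
    ← ENNReal.mul_rpow_of_nonneg _ _ hp']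
  gcongr

lemma eLpNorm_comp_inv_smul {d : ℕ} (f : Rd d → ℂ) {R p : ℝ} (hR : 0 < R) (hp : 0 < p) :
    eLpNorm (fun x => f (R⁻¹ • x)) (ENNReal.ofReal p) volume
      = ENNReal.ofReal (R ^ ((d : ℝ) / p)) * eLpNorm f (ENNReal.ofReal p) volume := by
  have hp' : 0 ≤ 1 / p := by positivity
  rw [eLpNorm_ofReal_eq _ hp, eLpNorm_ofReal_eq _ hp,
    lintegral_comp_inv_smul (fun x => ‖f x‖ₑ ^ p) hR, ENNReal.mul_rpow_of_nonneg _ _ hp',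
    ENNReal.ofReal_rpow_of_nonneg (by positivity) hp', ← Real.rpow_natCast, ← Real.rpow_mul hR.le]
  congr 3
  ring

lemma fourier_eq_integral_ex {d : ℕ} (f : Rd d → ℂ) (ξ : Rd d) :
    𝓕 f ξ = ∫ x, f x * ex (-inner ℝ x ξ) := by
  rw [Real.fourier_eq']
  congr 1 with x
  rw [smul_eq_mul, mul_comm, ex]
  congr 4
  ring

lemma fourierInv_eq_osc {d : ℕ} (f : Rd d → ℂ) : 𝓕⁻ f = osc volume id f := by
  ext x
  rw [Real.fourierInv_eq']
  unfold osc
  congr 1 with ξ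
  rw [smul_eq_mul, mul_comm, ex, id]

/-- A smooth compactly supported function is the Fourier transform of a Schwartz function. -/
lemma exists_schwartz_fourier_eq {d : ℕ} {χ : Rd d → ℝ} (hχ : ContDiff ℝ (⊤ : ℕ∞) χ)
    (hc : HasCompactSupport χ) :
    ∃ K : 𝓢(Rd d, ℂ), ∀ ξ, (χ ξ : ℂ) = ∫ v, K v * ex (-inner ℝ v ξ) := by
  have hc' : HasCompactSupport fun ξ => (χ ξ : ℂ) := hc.comp_left (g := fun r : ℝ => (r : ℂ)) rfl
  let S : 𝓢(Rd d, ℂ) := hc'.toSchwartzMap (Complex.ofRealCLM.contDiff.comp hχ)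
  refine ⟨𝓕⁻ S, fun ξ => ?_⟩
  rw [← fourier_eq_integral_ex, ← SchwartzMap.fourier_coe, FourierTransform.fourier_fourierInv_eq]
  rfl

section

variable {Ω : Type} [MeasurableSpace Ω] {d : ℕ} {μ : Measure Ω} {ζ : Ω → Rd d} {h : Ω → ℂ}

lemma osc_inv_smul (R : ℝ) (x : Rd d) :
    osc μ (fun ω => R • ζ ω) h x = osc μ ζ h (R • x) := by
  unfold osc
  simp only [real_inner_smul_left, real_inner_smul_right]

lemma osc_symbol_mul_eq [SFinite μ] {χ : Rd d → ℝ} {K : 𝓢(Rd d, ℂ)}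
    (hK : ∀ ξ, (χ ξ : ℂ) = ∫ v, K v * ex (-inner ℝ v ξ)) (hh : Integrable h μ)
    (hζ : Measurable ζ) (x : Rd d) :
    osc μ ζ (fun ω => (χ (ζ ω) : ℂ) * h ω) x = ∫ v, K v * osc μ ζ h (x - v) := by
  have hInt : Integrable (Function.uncurry fun (v : Rd d) (ω : Ω) =>
      K v * (h ω * ex (inner ℝ (ζ ω) (x - v)))) (volume.prod μ) := by
    refine ((K.integrable.mul_prod hh).mul_bdd (c := 1)
      (g := fun z : Rd d × Ω => ex (inner ℝ (ζ z.2) (x - z.1)))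
      ?_ (Filter.Eventually.of_forall fun x => (norm_ex _).le)).congr
      (Filter.Eventually.of_forall fun z => ?_)
    · exact (measurable_ex.comp (Measurable.inner (hζ.comp measurable_snd)
        (by fun_prop))).aestronglyMeasurable
    · simp only [Function.uncurry]
      ring
  calc _ = ∫ ω, (∫ v, K v * (h ω * ex (inner ℝ (ζ ω) (x - v)))) ∂μ := by
        unfold osc
        congr 1 with ω
        simp only [hK, ← integral_mul_const]
        congr 1 with v
        rw [inner_sub_right, sub_eq_add_neg, ex_add, real_inner_comm (ζ ω) v]
        ring
    _ = ∫ v, ∫ ω, K v * (h ω * ex (inner ℝ (ζ ω) (x - v))) ∂μ :=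
        (integral_integral_swap hInt).symm
    _ = _ := by
        congr 1 with v
        rw [integral_const_mul]
        rfl

lemma integrable_symbol_mul {χ : Rd d → ℝ} (hχ : Continuous χ) (hc : HasCompactSupport χ)
    (hh : Integrable h μ) (hζ : Measurable ζ) :
    Integrable (fun ω => (χ (ζ ω) : ℂ) * h ω) μ := by
  obtain ⟨C, hC⟩ := hχ.bounded_above_of_compact_support hc
  exact hh.bdd_mul (c := C)
    (Complex.measurable_ofReal.comp (hχ.measurable.comp hζ)).aestronglyMeasurable
    (Filter.Eventually.of_forall fun ω => by simpa using hC (ζ ω))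

end

/-- Smooth compactly supported symbols at any dyadic scale are uniformly bounded on `L^p`. -/
lemma exists_eLpNorm_osc_symbol_le {p : ℝ} (hp : 1 < p) {d : ℕ} {χ : Rd d → ℝ}
    (hχ : ContDiff ℝ (⊤ : ℕ∞) χ) (hc : HasCompactSupport χ) :
    ∃ C : ℝ≥0, ∀ (Ω : Type) [MeasurableSpace Ω] (μ : Measure Ω) [SFinite μ] (h : Ω → ℂ)
      (ζ : Ω → Rd d), Integrable h μ → Measurable ζ → ∀ R : ℝ, 0 < R →
      eLpNorm (osc μ ζ fun ω => (χ (R • ζ ω) : ℂ) * h ω) (ENNReal.ofReal p) volume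
        ≤ C * eLpNorm (osc μ ζ h) (ENNReal.ofReal p) volume := by
  have hp0 : 0 < p := by linarith
  obtain ⟨K, hK⟩ := exists_schwartz_fourier_eq hχ hc
  have hKfin : ∫⁻ v, ‖K v‖ₑ ≠ ∞ := (K.integrable (μ := volume)).2.ne
  have hunit (Ω : Type) [MeasurableSpace Ω] (μ : Measure Ω) [SFinite μ] (h : Ω → ℂ)
      (ζ : Ω → Rd d) (hh : Integrable h μ) (hζ : Measurable ζ) :
      eLpNorm (osc μ ζ fun ω => (χ (ζ ω) : ℂ) * h ω) (ENNReal.ofReal p) volume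
        ≤ (∫⁻ v, ‖K v‖ₑ) * eLpNorm (osc μ ζ h) (ENNReal.ofReal p) volume := by
    have hp' : 0 ≤ 1 / p := by positivity
    rw [eLpNorm_ofReal_eq _ hp0, eLpNorm_ofReal_eq _ hp0]
    calc _ ≤ ((∫⁻ v, ‖K v‖ₑ) ^ p * ∫⁻ x, ‖osc μ ζ h x‖ₑ ^ p) ^ (1 / p) := by
          gcongr
          refine le_trans (lintegral_mono fun x => ?_) (lintegral_conv_rpow_le volume hp
            K.continuous.enorm.measurable (continuous_osc hh hζ).enorm.measurable)
          gcongr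
          rw [osc_symbol_mul_eq hK hh hζ]
          refine (enorm_integral_le_lintegral_enorm _).trans (le_of_eq ?_)
          simp only [enorm_mul]
      _ = _ := by
          rw [ENNReal.mul_rpow_of_nonneg _ _ hp', ← ENNReal.rpow_mul, mul_one_div_cancel hp0.ne',
            ENNReal.rpow_one]
  refine ⟨(∫⁻ v, ‖K v‖ₑ).toNNReal, fun Ω _ μ _ h ζ hh hζ R hR => ?_⟩
  rw [ENNReal.coe_toNNReal hKfin]
  have := hunit Ω μ h (fun ω => R • ζ ω) hh (hζ.const_smul R)
  have e (g : Ω → ℂ) : osc μ (fun ω => R • ζ ω) g = fun x => osc μ ζ g ((R⁻¹)⁻¹ • x) := by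
    ext x
    rw [osc_inv_smul, inv_inv]
  have hR' : 0 < R⁻¹ := inv_pos.2 hR
  rw [e, e, eLpNorm_comp_inv_smul _ hR' hp0, eLpNorm_comp_inv_smul _ hR' hp0,
    mul_left_comm] at this
  refine (ENNReal.mul_le_mul_iff_right ?_ ENNReal.ofReal_ne_top).1 this
  simp only [ne_eq, ENNReal.ofReal_eq_zero, not_le]
  positivity

/-- Bernstein's inequality. -/
lemma exists_eLpNorm_osc_bernstein {p r : ℝ} (hp : 1 < p) (hr : p ≤ r) (d : ℕ) :
    ∃ C : ℝ≥0, ∀ (Ω : Type) [MeasurableSpace Ω] (μ : Measure Ω) [SFinite μ] (h : Ω → ℂ)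
      (ζ : Ω → Rd d), Integrable h μ → Measurable ζ → ∀ R : ℝ, 0 < R →
      (∀ ω, h ω ≠ 0 → ‖ζ ω‖ ≤ 3 * R) →
      eLpNorm (osc μ ζ h) (ENNReal.ofReal r) volume
        ≤ C * ENNReal.ofReal (R ^ ((d : ℝ) / p - (d : ℝ) / r))
          * eLpNorm (osc μ ζ h) (ENNReal.ofReal p) volume := by
  have hp0 : 0 < p := by linarith
  have hr0 : 0 < r := by linarith
  let B : ContDiffBump (0 : Rd d) := ⟨3, 4, by norm_num, by norm_num⟩
  obtain ⟨K, hK⟩ := exists_schwartz_fourier_eq (χ := B) B.contDiff B.hasCompactSupport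
  have hpq : p.HolderConjugate (p / (p - 1)) := Real.HolderConjugate.conjExponent hp
  set q := p / (p - 1) with hq
  set M : ℝ≥0∞ := (∫⁻ v, ‖K v‖ₑ ^ q) ^ (1 / q) with hM
  have hMfin : M ≠ ∞ := by
    have := (K.memLp (ENNReal.ofReal q) volume).2.ne
    rwa [eLpNorm_ofReal_eq _ hpq.symm.pos] at this
  have hunit (Ω : Type) [MeasurableSpace Ω] (μ : Measure Ω) [SFinite μ] (h : Ω → ℂ)
      (ζ : Ω → Rd d) (hh : Integrable h μ) (hζ : Measurable ζ)
      (hsupp : ∀ ω, h ω ≠ 0 → ‖ζ ω‖ ≤ 3) :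
      eLpNorm (osc μ ζ h) (ENNReal.ofReal r) volume
        ≤ M ^ (1 - p / r) * eLpNorm (osc μ ζ h) (ENNReal.ofReal p) volume := by
    have hosc := (continuous_osc hh hζ).enorm.measurable
    have heq : (fun ω => ((B (ζ ω) : ℝ) : ℂ) * h ω) = h := by
      ext ω
      by_cases h0 : h ω = 0
      · simp [h0]
      · rw [B.one_of_mem_closedBall (by simpa using hsupp ω h0)]
        simp
    set N := eLpNorm (osc μ ζ h) (ENNReal.ofReal p) volume with hN
    have hsup (x : Rd d) : ‖osc μ ζ h x‖ₑ ≤ M * N := by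
      calc ‖osc μ ζ h x‖ₑ = ‖∫ v, K v * osc μ ζ h (x - v)‖ₑ := by
            rw [← osc_symbol_mul_eq hK hh hζ, heq]
        _ ≤ ∫⁻ v, ((fun v => ‖K v‖ₑ) * fun v => ‖osc μ ζ h (x - v)‖ₑ) v := by
            refine (enorm_integral_le_lintegral_enorm _).trans (le_of_eq ?_)
            simp only [enorm_mul, Pi.mul_apply]
        _ ≤ (∫⁻ v, ‖K v‖ₑ ^ q) ^ (1 / q) * (∫⁻ v, ‖osc μ ζ h (x - v)‖ₑ ^ p) ^ (1 / p) :=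
            ENNReal.lintegral_mul_le_Lp_mul_Lq _ hpq.symm K.continuous.enorm.measurable.aemeasurable
              (hosc.comp (measurable_const.sub measurable_id)).aemeasurable
        _ = M * N := by
            rw [lintegral_sub_left_eq_self (fun v => ‖osc μ ζ h v‖ₑ ^ p) x, hN,
              eLpNorm_ofReal_eq _ hp0]
    have hpr : 0 ≤ r - p := by linarith
    have hr' : 0 ≤ 1 / r := by positivity
    calc eLpNorm (osc μ ζ h) (ENNReal.ofReal r) volume
        = (∫⁻ x, ‖osc μ ζ h x‖ₑ ^ (r - p) * ‖osc μ ζ h x‖ₑ ^ p) ^ (1 / r) := by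
          rw [eLpNorm_ofReal_eq _ hr0]
          congr 2 with x
          rw [← ENNReal.rpow_add_of_nonneg _ _ hpr hp0.le, sub_add_cancel]
      _ ≤ (∫⁻ x, (M * N) ^ (r - p) * ‖osc μ ζ h x‖ₑ ^ p) ^ (1 / r) := by
          gcongr with x
          exact hsup x
      _ = ((M * N) ^ (r - p) * N ^ p) ^ (1 / r) := by
          rw [lintegral_const_mul _ (hosc.pow_const p), hN, eLpNorm_ofReal_eq _ hp0,
            ← ENNReal.rpow_mul _ (1 / p) p, one_div_mul_cancel hp0.ne', ENNReal.rpow_one]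
      _ = _ := by
          rw [ENNReal.mul_rpow_of_nonneg _ _ hpr, mul_assoc,
            ← ENNReal.rpow_add_of_nonneg _ _ hpr hp0.le, sub_add_cancel,
            ENNReal.mul_rpow_of_nonneg _ _ hr', ← ENNReal.rpow_mul M,
            ← ENNReal.rpow_mul N, mul_one_div_cancel hr0.ne', ENNReal.rpow_one]
          congr 2
          field_simp
  have h1 : 0 ≤ 1 - p / r := by rw [sub_nonneg, div_le_one hr0]; exact hr
  refine ⟨(M ^ (1 - p / r)).toNNReal, fun Ω _ μ _ h ζ hh hζ R hR hs => ?_⟩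
  rw [ENNReal.coe_toNNReal (ENNReal.rpow_ne_top_of_nonneg h1 hMfin)]
  have := hunit Ω μ h (fun ω => R⁻¹ • ζ ω) hh (hζ.const_smul R⁻¹) (fun ω hω => by
    rw [norm_smul, norm_inv, Real.norm_of_nonneg hR.le, inv_mul_le_iff₀ hR, mul_comm]
    exact hs ω hω)
  have e : osc μ (fun ω => R⁻¹ • ζ ω) h = fun x => osc μ ζ h (R⁻¹ • x) := by
    ext x
    rw [osc_inv_smul]
  rw [e, eLpNorm_comp_inv_smul _ hR hp0, eLpNorm_comp_inv_smul _ hR hr0] at this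
  have hpos : ENNReal.ofReal (R ^ ((d : ℝ) / r)) ≠ 0 := by
    simp only [ne_eq, ENNReal.ofReal_eq_zero, not_le]
    positivity
  refine (ENNReal.mul_le_mul_iff_right hpos ENNReal.ofReal_ne_top).1 (this.trans (le_of_eq ?_))
  have e2 : R ^ ((d : ℝ) / p) = R ^ ((d : ℝ) / r) * R ^ ((d : ℝ) / p - (d : ℝ) / r) := by
    rw [← Real.rpow_add hR]
    congr 1
    ring
  rw [e2, ENNReal.ofReal_mul (by positivity)]
  ring

lemma sgnSym_eq (b : Bool) (y l : ℝ) :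
    sgnSym b y l = ((if 0 < (if b then l else -l) then Real.exp (-2 * π * y * |l|) else 0 : ℝ) : ℂ) := by
  have key (m : ℝ) (hm : 0 < m) : Complex.exp (2 * π * Complex.I * (y * Complex.I) * m)
      = ((Real.exp (-2 * π * y * m) : ℝ) : ℂ) := by
    rw [Complex.ofReal_exp]
    congr 1
    push_cast
    linear_combination (2 * π * y * m) * Complex.I_mul_I
  cases b
  · simp only [sgnSym, halfSym, halfExp, Bool.false_eq_true, if_false]
    split_ifs with h
    · rw [key _ h, abs_of_neg (by linarith)]
    · simp
  · simp only [sgnSym, halfSym, halfExp, if_true]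
    split_ifs with h
    · rw [key _ h, abs_of_pos h]
    · simp

/-- Decay parameter of the one-sided symbols occurring in the splitting of the Gevrey symbol. -/
def gevShift (τ : ℝ) (b b' : Bool) : ℝ := if b = b' then 0 else τ / π

lemma gevShift_nonneg {τ : ℝ} (hτ : 0 ≤ τ) (b b' : Bool) : 0 ≤ gevShift τ b b' := by
  unfold gevShift
  split_ifs <;> positivity

lemma exp_abs_eq_sum_sgnSym (τ : ℝ) {a b : ℝ} (ha : a ≠ 0) (hb : b ≠ 0) (hab : a + b ≠ 0) :
    ((Real.exp (τ * (|a + b| - |a| - |b|)) : ℝ) : ℂ)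
      = ∑ σ : Bool × Bool × Bool, sgnSym σ.2.2 0 (a + b)
        * (sgnSym σ.1 (gevShift τ σ.1 σ.2.2) a * sgnSym σ.2.1 (gevShift τ σ.2.1 σ.2.2) b) := by
  have hpi : -2 * π * (τ / π) = -2 * τ := by
    have := Real.pi_ne_zero
    field_simp
  simp only [sgnSym_eq, ← Complex.ofReal_mul, ← Complex.ofReal_sum, gevShift]
  congr 1
  simp only [Fintype.sum_prod_type, Fintype.sum_bool]
  simp only [if_true, Bool.false_eq_true, Bool.true_eq_false, if_false, hpi, mul_zero, zero_mul,
    Real.exp_zero]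
  rcases lt_or_gt_of_ne ha with ha | ha <;> rcases lt_or_gt_of_ne hb with hb | hb <;>
    rcases lt_or_gt_of_ne hab with hab | hab <;>
    first
    | exact absurd hab (by linarith)
    | skip
  all_goals
    simp only [abs_of_neg, abs_of_pos, ha, hb, hab, ha.not_gt, hb.not_gt, hab.not_gt,
      neg_pos, neg_pos.2, if_true, if_false, mul_zero, zero_mul, mul_one, one_mul, add_zero,
      zero_add]
  all_goals
    first
    | (rw [Real.exp_eq_one_iff]; ring)
    | (congr 1; ring)

/-- The symbol `e^{τ(|ξ+η|₁-|ξ|₁-|η|₁)}`. -/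
def gevSym {d : ℕ} (τ : ℝ) (ξ η : Rd d) : ℝ :=
  Real.exp (τ * (∑ i, |ξ i + η i| - ∑ i, |ξ i| - ∑ i, |η i|))

lemma gevSym_eq_sum {d : ℕ} (τ : ℝ) {ξ η : Rd d} (hξ : ∀ i, ξ i ≠ 0) (hη : ∀ i, η i ≠ 0)
    (hs : ∀ i, (ξ + η) i ≠ 0) :
    (gevSym τ ξ η : ℂ) = ∑ σ : Fin d → Bool × Bool × Bool,
      (∏ i, sgnSym (σ i).2.2 0 ((ξ + η) i))
        * ((∏ i, sgnSym (σ i).1 (gevShift τ (σ i).1 (σ i).2.2) (ξ i))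
          * ∏ i, sgnSym (σ i).2.1 (gevShift τ (σ i).2.1 (σ i).2.2) (η i)) := by
  have h1 : gevSym τ ξ η = ∏ i, Real.exp (τ * (|ξ i + η i| - |ξ i| - |η i|)) := by
    rw [gevSym, ← Real.exp_sum, ← Finset.mul_sum, Finset.sum_sub_distrib, Finset.sum_sub_distrib]
  rw [h1, Complex.ofReal_prod]
  simp only [exp_abs_eq_sum_sgnSym τ (hξ _) (hη _) (hs _)]
  rw [Finset.prod_univ_sum, Fintype.piFinset_univ]
  refine Finset.sum_congr rfl fun σ _ => ?_
  rw [Finset.prod_mul_distrib, Finset.prod_mul_distrib]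
  rfl

lemma ae_coord_ne_zero {d : ℕ} (i : Fin d) : ∀ᵐ ξ : Rd d, ξ i ≠ 0 := by
  have h1 : Measure.QuasiMeasurePreserving (fun ξ : Rd d => ξ i) :=
    (Measure.quasiMeasurePreserving_eval (fun _ : Fin d => (volume : Measure ℝ)) i).comp
      (PiLp.volume_preserving_ofLp (Fin d)).quasiMeasurePreserving
  exact h1.ae (Measure.ae_ne volume 0)

lemma quasiMeasurePreserving_prod_add {d : ℕ} : Measure.QuasiMeasurePreserving
    (fun z : Rd d × Rd d => z.1 + z.2) (volume.prod volume) volume :=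
  Measure.quasiMeasurePreserving_snd.comp
    (measurePreserving_prod_add (volume : Measure (Rd d)) volume).quasiMeasurePreserving

lemma osc_prod_mul {d : ℕ} (h₁ h₂ : Rd d → ℂ) (x : Rd d) :
    osc (volume.prod volume) (fun z : Rd d × Rd d => z.1 + z.2) (fun z => h₁ z.1 * h₂ z.2) x
      = osc volume id h₁ x * osc volume id h₂ x := by
  unfold osc
  rw [← integral_prod_mul]
  congr 1 with z
  rw [inner_add_left, ex_add]
  simp only [id]
  ring

lemma osc_sum {Ω : Type} [MeasurableSpace Ω] {d : ℕ} {μ : Measure Ω} {ζ : Ω → Rd d} {ι : Type*}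
    (s : Finset ι) {h : ι → Ω → ℂ} (hh : ∀ i ∈ s, Integrable (h i) μ) (hζ : Measurable ζ) :
    osc μ ζ (fun ω => ∑ i ∈ s, h i ω) = ∑ i ∈ s, osc μ ζ (h i) := by
  ext x
  rw [Finset.sum_apply]
  unfold osc
  rw [← integral_finsetSum s fun i hi => Integrable.mul_ex (hh i hi) hζ.inner_const]
  simp only [Finset.sum_mul]

lemma osc_congr_ae {Ω : Type} [MeasurableSpace Ω] {d : ℕ} {μ : Measure Ω} {ζ : Ω → Rd d}
    {g h : Ω → ℂ} (hgh : g =ᵐ[μ] h) : osc μ ζ g = osc μ ζ h := by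
  ext x
  refine integral_congr_ae ?_
  filter_upwards [hgh] with ω hω
  rw [hω]

lemma holderTriple_ofReal {r t q : ℝ} (hr : 0 < r) (ht : 0 < t) (hq : 0 < q)
    (h : 1 / r + 1 / t = 1 / q) :
    ENNReal.HolderTriple (ENNReal.ofReal r) (ENNReal.ofReal t) (ENNReal.ofReal q) := by
  constructor
  rw [← ENNReal.ofReal_inv_of_pos hr, ← ENNReal.ofReal_inv_of_pos ht,
    ← ENNReal.ofReal_inv_of_pos hq, ← ENNReal.ofReal_add (by positivity) (by positivity)]
  simp only [one_div] at h
  rw [h]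

lemma exists_eLpNorm_osc_prod_le {p : ℝ} (hp : 1 < p) (d : ℕ) :
    ∃ C : ℝ≥0, ∀ (Ω : Type) [MeasurableSpace Ω] (μ : Measure Ω) [SFinite μ] (h : Ω → ℂ)
      (ζ : Ω → Rd d), Integrable h μ → Measurable ζ → (∀ i : Fin d, ∀ᵐ ω ∂μ, ζ ω i ≠ 0) →
      ∀ (b : Fin d → Bool) (y : Fin d → ℝ), (∀ i, 0 ≤ y i) →
      Integrable (fun ω => (∏ i, sgnSym (b i) (y i) (ζ ω i)) * h ω) μ ∧
      eLpNorm (osc μ ζ fun ω => (∏ i, sgnSym (b i) (y i) (ζ ω i)) * h ω) (ENNReal.ofReal p) volume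
        ≤ C * eLpNorm (osc μ ζ h) (ENNReal.ofReal p) volume := by
  obtain ⟨C, hC⟩ := exists_lintegral_osc_prod_le hp d
  refine ⟨C ^ (1 / p), fun Ω _ μ _ h ζ hh hζ hζ0 b y hy => ?_⟩
  have := hC Ω μ h ζ hh hζ hζ0 b y hy
  exact ⟨this.1, eLpNorm_le_of_lintegral_le (by linarith) this.2⟩

/-- The Gevrey bilinear form satisfies Hölder's inequality, uniformly in `τ ≥ 0`. -/
lemma exists_eLpNorm_gevSym_le {r t q : ℝ} (hr : 1 < r) (ht : 1 < t) (hq : 1 < q)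
    (hrtq : 1 / r + 1 / t = 1 / q) (d : ℕ) :
    ∃ C : ℝ≥0, ∀ τ : ℝ, 0 ≤ τ → ∀ h₁ h₂ : Rd d → ℂ, Integrable h₁ → Integrable h₂ →
      eLpNorm (osc (volume.prod volume) (fun z : Rd d × Rd d => z.1 + z.2)
          fun z => (gevSym τ z.1 z.2 : ℂ) * (h₁ z.1 * h₂ z.2)) (ENNReal.ofReal q) volume
        ≤ C * eLpNorm (osc volume id h₁) (ENNReal.ofReal r) volume
          * eLpNorm (osc volume id h₂) (ENNReal.ofReal t) volume := by
  obtain ⟨Cr, hCr⟩ := exists_eLpNorm_osc_prod_le hr d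
  obtain ⟨Ct, hCt⟩ := exists_eLpNorm_osc_prod_le ht d
  obtain ⟨Cq, hCq⟩ := exists_eLpNorm_osc_prod_le hq d
  have hHT := holderTriple_ofReal (by linarith) (by linarith) (by linarith) hrtq
  refine ⟨Fintype.card (Fin d → Bool × Bool × Bool) * (Cq * (Cr * Ct)),
    fun τ hτ h₁ h₂ hh₁ hh₂ => ?_⟩
  have hadd : Measurable fun z : Rd d × Rd d => z.1 + z.2 := by fun_prop
  have hsum0 (i : Fin d) : ∀ᵐ z : Rd d × Rd d ∂(volume.prod volume), (z.1 + z.2) i ≠ 0 :=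
    quasiMeasurePreserving_prod_add.ae (ae_coord_ne_zero i)
  have hfst0 (i : Fin d) : ∀ᵐ z : Rd d × Rd d ∂(volume.prod volume), z.1 i ≠ 0 :=
    Measure.quasiMeasurePreserving_fst.ae (ae_coord_ne_zero i)
  have hsnd0 (i : Fin d) : ∀ᵐ z : Rd d × Rd d ∂(volume.prod volume), z.2 i ≠ 0 :=
    Measure.quasiMeasurePreserving_snd.ae (ae_coord_ne_zero i)
  set g₁ : (Fin d → Bool × Bool × Bool) → Rd d → ℂ := fun σ ξ =>
    (∏ i, sgnSym (σ i).1 (gevShift τ (σ i).1 (σ i).2.2) (ξ i)) * h₁ ξ with hg₁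
  set g₂ : (Fin d → Bool × Bool × Bool) → Rd d → ℂ := fun σ η =>
    (∏ i, sgnSym (σ i).2.1 (gevShift τ (σ i).2.1 (σ i).2.2) (η i)) * h₂ η with hg₂
  have B₁ (σ : Fin d → Bool × Bool × Bool) := hCr (Rd d) volume h₁ id hh₁ measurable_id
    ae_coord_ne_zero (fun i => (σ i).1) (fun i => gevShift τ (σ i).1 (σ i).2.2)
    fun i => gevShift_nonneg hτ _ _
  have B₂ (σ : Fin d → Bool × Bool × Bool) := hCt (Rd d) volume h₂ id hh₂ measurable_id
    ae_coord_ne_zero (fun i => (σ i).2.1) (fun i => gevShift τ (σ i).2.1 (σ i).2.2)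
    fun i => gevShift_nonneg hτ _ _
  have B₃ (σ : Fin d → Bool × Bool × Bool) := hCq (Rd d × Rd d) (volume.prod volume)
    (fun z => g₁ σ z.1 * g₂ σ z.2) (fun z => z.1 + z.2) ((B₁ σ).1.mul_prod (B₂ σ).1) hadd hsum0
    (fun i => (σ i).2.2) (fun _ => 0) fun _ => le_rfl
  have hae : (fun z : Rd d × Rd d => (gevSym τ z.1 z.2 : ℂ) * (h₁ z.1 * h₂ z.2))
      =ᵐ[volume.prod volume] fun z => ∑ σ, (∏ i, sgnSym (σ i).2.2 0 ((z.1 + z.2) i))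
        * (g₁ σ z.1 * g₂ σ z.2) := by
    filter_upwards [ae_all_iff.2 hsum0, ae_all_iff.2 hfst0, ae_all_iff.2 hsnd0] with z a1 a2 a3
    rw [gevSym_eq_sum τ a2 a3 a1, Finset.sum_mul]
    refine Finset.sum_congr rfl fun σ _ => ?_
    simp only [hg₁, hg₂]
    ring
  rw [osc_congr_ae hae, osc_sum _ (fun σ _ => (B₃ σ).1) hadd]
  refine (eLpNorm_sum_le (fun σ _ => (continuous_osc (B₃ σ).1 hadd).aestronglyMeasurable)
    (by simpa using hq.le)).trans ?_
  refine (Finset.sum_le_card_nsmul _ _ (((Cq : ℝ≥0∞) * (Cr * Ct))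
    * (eLpNorm (osc volume id h₁) (ENNReal.ofReal r) volume
      * eLpNorm (osc volume id h₂) (ENNReal.ofReal t) volume)) fun σ _ => ?_).trans (le_of_eq ?_)
  · refine (B₃ σ).2.trans ?_
    have e : osc (volume.prod volume) (fun z : Rd d × Rd d => z.1 + z.2)
        (fun z => g₁ σ z.1 * g₂ σ z.2) = osc volume id (g₁ σ) • osc volume id (g₂ σ) := by
      ext x
      rw [osc_prod_mul]
      rfl
    rw [e]
    calc _ ≤ (Cq : ℝ≥0∞) * (eLpNorm (osc volume id (g₁ σ)) (ENNReal.ofReal r) volume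
          * eLpNorm (osc volume id (g₂ σ)) (ENNReal.ofReal t) volume) := by
          gcongr
          exact eLpNorm_smul_le_mul_eLpNorm
            (continuous_osc (B₂ σ).1 measurable_id).aestronglyMeasurable
            (continuous_osc (B₁ σ).1 measurable_id).aestronglyMeasurable
      _ ≤ (Cq : ℝ≥0∞) * ((Cr * eLpNorm (osc volume id h₁) (ENNReal.ofReal r) volume)
          * (Ct * eLpNorm (osc volume id h₂) (ENNReal.ofReal t) volume)) := by
          gcongr
          · exact (B₁ σ).2
          · exact (B₂ σ).2
      _ = _ := by ring
  · rw [nsmul_eq_mul, Finset.card_univ]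
    push_cast
    ring

section Dyadic

variable {d : ℕ} {φ : Rd d → ℝ}

/-- The dyadic dilate `φ(2^{-k}·)`. -/
def dil (φ : Rd d → ℝ) (k : ℤ) (ξ : Rd d) : ℝ := φ (((2:ℝ) ^ (-k)) • ξ)

/-- The low-frequency symbol `∑_{k ≤ j-2} φ(2^{-k}·)`. -/
def lowSym (φ : Rd d → ℝ) (j : ℤ) (ξ : Rd d) : ℂ :=
  ∑' k : ℤ, if k ≤ j - 2 then (dil φ k ξ : ℂ) else 0

/-- The paraproduct symbol. -/
def paraSym (φ : Rd d → ℝ) (ξ η : Rd d) : ℂ := ∑' j : ℤ, lowSym φ j ξ * (dil φ j η : ℂ)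

lemma continuous_dil (hφ : Continuous φ) (k : ℤ) : Continuous (dil φ k) := by
  unfold dil
  fun_prop

lemma norm_bounds_of_dil_ne_zero (hφ3 : ∀ x : Rd d, φ x ≠ 0 → 3/4 ≤ ‖x‖ ∧ ‖x‖ ≤ 8/3) {k : ℤ}
    {ξ : Rd d} (h : dil φ k ξ ≠ 0) : 3/4 * (2:ℝ) ^ k ≤ ‖ξ‖ ∧ ‖ξ‖ ≤ 8/3 * (2:ℝ) ^ k := by
  have := hφ3 _ h
  have h2 : (0:ℝ) < 2 ^ k := by positivity
  rw [norm_smul, zpow_neg, norm_inv, Real.norm_of_nonneg h2.le, inv_mul_eq_div, le_div_iff₀ h2,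
    div_le_iff₀ h2] at this
  exact this

lemma le_add_of_two_zpow_le {a b : ℤ} {c : ℝ} {n : ℤ} (h : (2:ℝ) ^ a ≤ c * 2 ^ b)
    (hc : c < 2 ^ (n + 1)) : a ≤ b + n := by
  have h2 : (0:ℝ) < 2 ^ b := by positivity
  have : (2:ℝ) ^ a < 2 ^ (n + 1 + b) := by
    rw [zpow_add₀ two_ne_zero]
    exact h.trans_lt (mul_lt_mul_of_pos_right hc h2)
  have := (zpow_lt_zpow_iff_right₀ (one_lt_two : (1:ℝ) < 2)).1 this
  omega

lemma le_add_one_of_dil_ne_zero (hφ3 : ∀ x : Rd d, φ x ≠ 0 → 3/4 ≤ ‖x‖ ∧ ‖x‖ ≤ 8/3) {k k' : ℤ}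
    {ξ : Rd d} (h : dil φ k ξ ≠ 0) (h' : dil φ k' ξ ≠ 0) : k' ≤ k + 1 := by
  have h1 := norm_bounds_of_dil_ne_zero hφ3 h
  have h2 := norm_bounds_of_dil_ne_zero hφ3 h'
  refine le_add_of_two_zpow_le (c := 32 / 9) ?_ (by norm_num)
  linarith

lemma tsum_enorm_dil_le (hφ3 : ∀ x : Rd d, φ x ≠ 0 → 3/4 ≤ ‖x‖ ∧ ‖x‖ ≤ 8/3) {S : ℝ≥0}
    (hS : ∀ x, ‖φ x‖ₑ ≤ S) (ξ : Rd d) : ∑' k : ℤ, ‖(dil φ k ξ : ℂ)‖ₑ ≤ (3 * S : ℝ≥0) := by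
  by_cases h : ∃ k₀, dil φ k₀ ξ ≠ 0
  · obtain ⟨k₀, hk₀⟩ := h
    rw [tsum_eq_sum (s := Finset.Icc (k₀ - 1) (k₀ + 1)) fun k hk => ?_]
    · refine (Finset.sum_le_card_nsmul _ _ (S : ℝ≥0∞) fun k _ => ?_).trans (le_of_eq ?_)
      · rw [← ofReal_norm, Complex.norm_real, ofReal_norm]
        exact hS _
      · rw [Int.card_Icc, show (k₀ + 1 + 1 - (k₀ - 1)).toNat = 3 by omega]
        simp
    · by_contra hne
      have hne' : dil φ k ξ ≠ 0 := fun h0 => hne (by simp [h0])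
      have h1 := le_add_one_of_dil_ne_zero hφ3 hk₀ hne'
      have h2 := le_add_one_of_dil_ne_zero hφ3 hne' hk₀
      exact hk (Finset.mem_Icc.2 ⟨by omega, by omega⟩)
  · push Not at h
    simp [h]

lemma enorm_lowSym_le (hφ3 : ∀ x : Rd d, φ x ≠ 0 → 3/4 ≤ ‖x‖ ∧ ‖x‖ ≤ 8/3) {S : ℝ≥0}
    (hS : ∀ x, ‖φ x‖ₑ ≤ S) (j : ℤ) (ξ : Rd d) : ‖lowSym φ j ξ‖ₑ ≤ (3 * S : ℝ≥0) := by
  refine enorm_tsum_le_tsum_enorm.trans (le_trans ?_ (tsum_enorm_dil_le hφ3 hS ξ))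
  refine ENNReal.tsum_le_tsum fun k => ?_
  split_ifs <;> simp

lemma tsum_enorm_lowSym_mul_dil_le (hφ3 : ∀ x : Rd d, φ x ≠ 0 → 3/4 ≤ ‖x‖ ∧ ‖x‖ ≤ 8/3) {S : ℝ≥0}
    (hS : ∀ x, ‖φ x‖ₑ ≤ S) (ξ η : Rd d) :
    ∑' j : ℤ, ‖lowSym φ j ξ * (dil φ j η : ℂ)‖ₑ ≤ ((3 * S) * (3 * S) : ℝ≥0) := by
  calc _ ≤ ∑' j : ℤ, ((3 * S : ℝ≥0) : ℝ≥0∞) * ‖(dil φ j η : ℂ)‖ₑ := by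
        refine ENNReal.tsum_le_tsum fun j => ?_
        rw [enorm_mul]
        gcongr
        exact enorm_lowSym_le hφ3 hS j ξ
    _ ≤ _ := by
        rw [ENNReal.tsum_mul_left, ENNReal.coe_mul (3 * S)]
        exact mul_le_mul_right (tsum_enorm_dil_le hφ3 hS η) _

lemma enorm_paraSym_le (hφ3 : ∀ x : Rd d, φ x ≠ 0 → 3/4 ≤ ‖x‖ ∧ ‖x‖ ≤ 8/3) {S : ℝ≥0}
    (hS : ∀ x, ‖φ x‖ₑ ≤ S) (ξ η : Rd d) :
    ‖paraSym φ ξ η‖ₑ ≤ ((3 * S) * (3 * S) : ℝ≥0) :=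
  enorm_tsum_le_tsum_enorm.trans (tsum_enorm_lowSym_mul_dil_le hφ3 hS ξ η)

lemma measurable_lowSym (hφ : Continuous φ) (j : ℤ) : Measurable (lowSym φ j) := by
  refine Measurable.tsum (L := SummationFilter.unconditional ℤ) fun k => ?_
  split_ifs
  · exact Complex.measurable_ofReal.comp (continuous_dil hφ k).measurable
  · exact measurable_const

lemma measurable_paraSym (hφ : Continuous φ) :
    Measurable fun z : Rd d × Rd d => paraSym φ z.1 z.2 := by
  refine Measurable.tsum (L := SummationFilter.unconditional ℤ) fun j => ?_
  exact ((measurable_lowSym hφ j).comp measurable_fst).mul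
    (Complex.measurable_ofReal.comp ((continuous_dil hφ j).measurable.comp measurable_snd))

/-- Away from the origin only finitely many dyadic dilates matter locally. -/
lemma exists_finset_dil_eq_zero (hφ3 : ∀ x : Rd d, φ x ≠ 0 → 3/4 ≤ ‖x‖ ∧ ‖x‖ ≤ 8/3)
    {ξ₀ : Rd d} (h0 : ξ₀ ≠ 0) :
    ∃ F : Finset ℤ, ∀ᶠ ξ in nhds ξ₀, ∀ k ∉ F, dil φ k ξ = 0 := by
  have hpos : 0 < ‖ξ₀‖ := norm_pos_iff.2 h0
  obtain ⟨n, hn1, hn2⟩ := exists_mem_Ico_zpow hpos (one_lt_two : (1:ℝ) < 2)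
  refine ⟨Finset.Icc (n - 3) (n + 3), ?_⟩
  have hc : ContinuousAt (fun ξ : Rd d => ‖ξ‖) ξ₀ := continuous_norm.continuousAt
  filter_upwards [hc.eventually (Ioi_mem_nhds (show ‖ξ₀‖ / 2 < ‖ξ₀‖ by linarith)),
    hc.eventually (Iio_mem_nhds (show ‖ξ₀‖ < 2 * ‖ξ₀‖ by linarith))] with ξ h1 h2 k hk
  by_contra hne
  obtain ⟨b1, b2⟩ := norm_bounds_of_dil_ne_zero hφ3 hne
  rw [zpow_add_one₀ two_ne_zero] at hn2
  refine hk (Finset.mem_Icc.2 ⟨?_, ?_⟩)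
  · have : n ≤ k + 3 := le_add_of_two_zpow_le (c := 16 / 3) (by linarith) (by norm_num)
    omega
  · exact le_add_of_two_zpow_le (c := 16 / 3) (by linarith) (by norm_num)

lemma continuousAt_lowSym (hφ : Continuous φ)
    (hφ3 : ∀ x : Rd d, φ x ≠ 0 → 3/4 ≤ ‖x‖ ∧ ‖x‖ ≤ 8/3) (j : ℤ) {ξ₀ : Rd d} (h0 : ξ₀ ≠ 0) :
    ContinuousAt (lowSym φ j) ξ₀ := by
  obtain ⟨F, hF⟩ := exists_finset_dil_eq_zero hφ3 h0
  have h : Continuous fun ξ => ∑ k ∈ F, if k ≤ j - 2 then (dil φ k ξ : ℂ) else 0 := by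
    refine continuous_finsetSum _ fun k _ => ?_
    split_ifs
    · exact Complex.continuous_ofReal.comp (continuous_dil hφ k)
    · exact continuous_const
  refine h.continuousAt.congr ?_
  filter_upwards [hF] with ξ hξ
  exact (tsum_eq_sum fun k hk => by simp [hξ k hk]).symm

lemma continuousAt_paraSym (hφ : Continuous φ)
    (hφ3 : ∀ x : Rd d, φ x ≠ 0 → 3/4 ≤ ‖x‖ ∧ ‖x‖ ≤ 8/3) {ξ₀ η : Rd d} (h0 : ξ₀ ≠ 0)
    (hη : η ≠ 0) : ContinuousAt (fun ξ => paraSym φ ξ η) ξ₀ := by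
  obtain ⟨F, hF⟩ := exists_finset_dil_eq_zero hφ3 hη
  have e (ξ : Rd d) : paraSym φ ξ η = ∑ j ∈ F, lowSym φ j ξ * (dil φ j η : ℂ) :=
    tsum_eq_sum fun j hj => by simp [hF.self_of_nhds j hj]
  simp only [e]
  exact tendsto_finsetSum _ fun j _ => (continuousAt_lowSym hφ hφ3 j h0).mul_const _

/-- Frequency localization of the paraproduct. -/
lemma mem_Icc_of_symbol_ne_zero (hφ3 : ∀ x : Rd d, φ x ≠ 0 → 3/4 ≤ ‖x‖ ∧ ‖x‖ ≤ 8/3) {m j : ℤ}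
    {ξ η : Rd d} (hm : dil φ m (ξ + η) ≠ 0) (hl : lowSym φ j ξ ≠ 0) (hj : dil φ j η ≠ 0) :
    j ∈ Finset.Icc (m - 2) (m + 5) := by
  have hk : ∃ k ≤ j - 2, dil φ k ξ ≠ 0 := by
    by_contra! hcon
    refine hl ?_
    unfold lowSym
    convert tsum_zero with k
    split_ifs with hk
    · simp [hcon k hk]
    · rfl
  obtain ⟨k, hk, hne⟩ := hk
  have b1 := norm_bounds_of_dil_ne_zero hφ3 hm
  have b2 := norm_bounds_of_dil_ne_zero hφ3 hne
  have b3 := norm_bounds_of_dil_ne_zero hφ3 hj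
  have h2 : (2:ℝ) ^ k ≤ 2 ^ j / 4 := by
    have := zpow_le_zpow_right₀ (one_le_two : (1:ℝ) ≤ 2) hk
    rw [zpow_sub₀ two_ne_zero] at this
    norm_num at this
    exact this
  have t1 : ‖ξ + η‖ ≤ ‖ξ‖ + ‖η‖ := norm_add_le _ _
  have t2 : ‖η‖ ≤ ‖ξ + η‖ + ‖ξ‖ := by
    have := norm_sub_le (ξ + η) ξ
    rwa [add_sub_cancel_left] at this
  have hp : (0:ℝ) < 2 ^ j := by positivity
  have hp' : (0:ℝ) < 2 ^ m := by positivity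
  refine Finset.mem_Icc.2 ⟨?_, ?_⟩
  · have : m ≤ j + 2 := le_add_of_two_zpow_le (c := 40 / 9) (by linarith) (by norm_num)
    omega
  · exact le_add_of_two_zpow_le (c := 32) (by linarith) (by norm_num)

end Dyadic

/-- The Fourier transform of the inverse transform of a continuous integrable function is that
function, up to a factor which is `1`, or `0` when the inverse transform is not integrable. -/
lemma exists_fourier_fourierInv_eq_mul {d : ℕ} {f : Rd d → ℂ} (hf : Continuous f)
    (hi : Integrable f) : ∃ c : ℂ, ‖c‖ ≤ 1 ∧ ∀ ξ, 𝓕 (𝓕⁻ f) ξ = c * f ξ := by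
  by_cases h : Integrable (𝓕⁻ f)
  · refine ⟨1, by simp, fun ξ => ?_⟩
    have h' : Integrable (𝓕 f) := by
      refine h.comp_neg.congr (Filter.Eventually.of_forall fun x => ?_)
      simp [Real.fourierInv_eq_fourier_neg]
    rw [hf.fourier_fourierInv_eq hi h', one_mul]
  · refine ⟨0, by simp, fun ξ => ?_⟩
    rw [fourier_eq_integral_ex, zero_mul]
    refine integral_undef fun hI => h ?_
    refine (Integrable.mul_ex hI (l := fun x => inner ℝ x ξ) (by fun_prop)).congr
      (Filter.Eventually.of_forall fun x => ?_)
    simp only [mul_assoc, ← ex_add]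
    simp [ex]

section Osc

variable {Ω : Type} [MeasurableSpace Ω] {d : ℕ} {μ : Measure Ω} {ζ : Ω → Rd d}

lemma osc_tsum {h : ℤ → Ω → ℂ} (hm : ∀ k, AEStronglyMeasurable (h k) μ) (hζ : Measurable ζ)
    (hfin : ∑' k, ∫⁻ ω, ‖h k ω‖ₑ ∂μ ≠ ∞) (x : Rd d) :
    osc μ ζ (fun ω => ∑' k, h k ω) x = ∑' k, osc μ ζ (h k) x := by
  unfold osc
  rw [← integral_tsum]
  · congr 1 with ω
    rw [tsum_mul_right]
  · exact fun k => (hm k).mul (measurable_ex.comp hζ.inner_const).aestronglyMeasurable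
  · have (k : ℤ) (ω : Ω) : ‖h k ω * ex (inner ℝ (ζ ω) x)‖ₑ = ‖h k ω‖ₑ := by
      rw [enorm_mul, ← ofReal_norm (ex _), norm_ex, ENNReal.ofReal_one, mul_one]
    simpa only [this] using hfin

lemma osc_const_mul (c : ℂ) (h : Ω → ℂ) (x : Rd d) :
    osc μ ζ (fun ω => c * h ω) x = c * osc μ ζ h x := by
  unfold osc
  simp only [mul_assoc]
  exact integral_const_mul _ _

end Osc

section AddMarginal

variable {d : ℕ}

/-- The density at `ζ` of the image of `h` under addition. -/
def addMarginal (h : Rd d × Rd d → ℂ) (ζ : Rd d) : ℂ := ∫ η, h (ζ - η, η)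

lemma mul_addMarginal (g : Rd d → ℂ) (h : Rd d × Rd d → ℂ) (ζ : Rd d) :
    g ζ * addMarginal h ζ = addMarginal (fun z => g (z.1 + z.2) * h z) ζ := by
  unfold addMarginal
  rw [← integral_const_mul]
  simp

lemma integrable_comp_sub_prod {h : Rd d × Rd d → ℂ} (hh : Integrable h (volume.prod volume)) :
    Integrable (fun z : Rd d × Rd d => h (z.1 - z.2, z.2)) (volume.prod volume) :=
  (measurePreserving_sub_prod volume volume).integrable_comp_of_integrable hh

lemma integrable_addMarginal {h : Rd d × Rd d → ℂ} (hh : Integrable h (volume.prod volume)) :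
    Integrable (addMarginal h) :=
  (integrable_comp_sub_prod hh).integral_prod_left

lemma osc_add_eq {h : Rd d × Rd d → ℂ} (hh : Integrable h (volume.prod volume)) :
    osc (volume.prod volume) (fun z : Rd d × Rd d => z.1 + z.2) h = 𝓕⁻ (addMarginal h) := by
  rw [fourierInv_eq_osc]
  ext x
  have hadd : Measurable fun z : Rd d × Rd d => z.1 + z.2 := measurable_fst.add measurable_snd
  have hI := Integrable.mul_ex hh (hadd.inner_const (c := x))
  unfold osc
  have e := (measurePreserving_sub_prod (volume : Measure (Rd d)) volume).map_eq
  rw [← e, integral_map (measurePreserving_sub_prod _ _).aemeasurable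
    (by rw [e]; exact hI.aestronglyMeasurable)]
  refine (integral_prod _
    ((measurePreserving_sub_prod _ _).integrable_comp_of_integrable hI)).trans ?_
  congr 1 with ζ
  simp only [Function.comp_apply, sub_add_cancel, id]
  exact integral_mul_const _ _

end AddMarginal

section Unfold

variable {d : ℕ} {φ : Rd d → ℝ}

lemma LPblock_eq_osc (k : ℤ) (f : Rd d → ℂ) :
    LPblock d φ k f = osc volume id fun ξ => (dil φ k ξ : ℂ) * 𝓕 f ξ :=
  fourierInv_eq_osc _

lemma osc_lowSym_mul (hφ : Continuous φ)
    (hφ3 : ∀ x : Rd d, φ x ≠ 0 → 3/4 ≤ ‖x‖ ∧ ‖x‖ ≤ 8/3) {S : ℝ≥0} (hS : ∀ x, ‖φ x‖ₑ ≤ S)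
    {h : Rd d → ℂ} (hh : Integrable h) (j : ℤ) (x : Rd d) :
    osc volume id (fun ξ => lowSym φ j ξ * h ξ) x
      = ∑' k : ℤ, if k ≤ j - 2 then osc volume id (fun ξ => (dil φ k ξ : ℂ) * h ξ) x else 0 := by
  have hm (k : ℤ) : AEStronglyMeasurable
      (fun ξ => (if k ≤ j - 2 then (dil φ k ξ : ℂ) else 0) * h ξ) volume := by
    refine AEStronglyMeasurable.mul ?_ hh.aestronglyMeasurable
    split_ifs
    · exact (Complex.continuous_ofReal.comp (continuous_dil hφ k)).aestronglyMeasurable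
    · exact aestronglyMeasurable_const
  have hfin : ∑' k : ℤ, ∫⁻ ξ, ‖(if k ≤ j - 2 then (dil φ k ξ : ℂ) else 0) * h ξ‖ₑ ≠ ∞ := by
    rw [← lintegral_tsum fun k => (hm k).enorm]
    refine ((lintegral_mono fun ξ => ?_).trans_lt
      (hh.const_mul ((3 * S : ℝ≥0) : ℂ)).hasFiniteIntegral).ne
    simp only [enorm_mul]
    rw [ENNReal.tsum_mul_right]
    refine mul_le_mul_left ?_ _
    have e : ‖((3 * S : ℝ≥0) : ℂ)‖ₑ = ((3 * S : ℝ≥0) : ℝ≥0∞) := by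
      simp [← ofReal_norm]
    rw [e]
    refine le_trans (ENNReal.tsum_le_tsum fun k => ?_) (tsum_enorm_dil_le hφ3 hS ξ)
    split_ifs <;> simp
  calc osc volume id (fun ξ => lowSym φ j ξ * h ξ) x
      = osc volume id (fun ξ => ∑' k : ℤ,
          (if k ≤ j - 2 then (dil φ k ξ : ℂ) else 0) * h ξ) x := by
        congr 1 with ξ
        rw [tsum_mul_right, lowSym]
    _ = _ := by
        rw [osc_tsum hm measurable_id hfin]
        refine tsum_congr fun k => ?_
        split_ifs with hk
        · rfl
        · simp [osc]

lemma lowFreq_eq_osc (hφ : Continuous φ)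
    (hφ3 : ∀ x : Rd d, φ x ≠ 0 → 3/4 ≤ ‖x‖ ∧ ‖x‖ ≤ 8/3) {S : ℝ≥0} (hS : ∀ x, ‖φ x‖ₑ ≤ S)
    {f : Rd d → ℂ} (hf : Integrable (𝓕 f)) (j : ℤ) (x : Rd d) :
    lowFreq d φ j f x = osc volume id (fun ξ => lowSym φ j ξ * 𝓕 f ξ) x := by
  rw [osc_lowSym_mul hφ hφ3 hS hf, lowFreq]
  simp only [LPblock_eq_osc]

lemma para_eq_osc (hφ : Continuous φ)
    (hφ3 : ∀ x : Rd d, φ x ≠ 0 → 3/4 ≤ ‖x‖ ∧ ‖x‖ ≤ 8/3) {S : ℝ≥0} (hS : ∀ x, ‖φ x‖ₑ ≤ S)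
    {f g : Rd d → ℂ} (hf : Integrable (𝓕 f)) (hg : Integrable (𝓕 g)) :
    para d φ f g = osc (volume.prod volume) (fun z : Rd d × Rd d => z.1 + z.2)
      fun z => paraSym φ z.1 z.2 * (𝓕 f z.1 * 𝓕 g z.2) := by
  ext x
  have hfg : Integrable (fun z : Rd d × Rd d => 𝓕 f z.1 * 𝓕 g z.2) (volume.prod volume) :=
    hf.mul_prod hg
  have hm (j : ℤ) : AEStronglyMeasurable
      (fun z : Rd d × Rd d => lowSym φ j z.1 * (dil φ j z.2 : ℂ) * (𝓕 f z.1 * 𝓕 g z.2))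
      (volume.prod volume) :=
    (((measurable_lowSym hφ j).comp measurable_fst).mul (Complex.measurable_ofReal.comp
      ((continuous_dil hφ j).measurable.comp measurable_snd))).aestronglyMeasurable.mul
      hfg.aestronglyMeasurable
  have hfin : ∑' j : ℤ, ∫⁻ z : Rd d × Rd d,
      ‖lowSym φ j z.1 * (dil φ j z.2 : ℂ) * (𝓕 f z.1 * 𝓕 g z.2)‖ₑ ∂(volume.prod volume) ≠ ∞ := by
    rw [← lintegral_tsum fun k => (hm k).enorm]
    refine ((lintegral_mono fun z => ?_).trans_lt
      (hfg.const_mul (((3 * S) * (3 * S) : ℝ≥0) : ℂ)).hasFiniteIntegral).ne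
    simp only [enorm_mul _ (𝓕 f z.1 * 𝓕 g z.2)]
    rw [ENNReal.tsum_mul_right]
    refine mul_le_mul_left ?_ _
    have e : ‖(((3 * S) * (3 * S) : ℝ≥0) : ℂ)‖ₑ = (((3 * S) * (3 * S) : ℝ≥0) : ℝ≥0∞) := by
      rw [← ofReal_norm, Complex.norm_real]
      simp
    rw [e]
    exact tsum_enorm_lowSym_mul_dil_le hφ3 hS _ _
  calc para d φ f g x
      = ∑' j : ℤ, osc (volume.prod volume) (fun z : Rd d × Rd d => z.1 + z.2)
          (fun z => lowSym φ j z.1 * (dil φ j z.2 : ℂ) * (𝓕 f z.1 * 𝓕 g z.2)) x := by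
        refine tsum_congr fun j => ?_
        rw [lowFreq_eq_osc hφ hφ3 hS hf, LPblock_eq_osc, ← osc_prod_mul]
        congr 1 with z
        ring
    _ = _ := by
        rw [← osc_tsum (ζ := fun z : Rd d × Rd d => z.1 + z.2) hm (by fun_prop) hfin]
        congr 1 with z
        rw [tsum_mul_right, paraSym]

lemma norm_paraSym_le (hφ3 : ∀ x : Rd d, φ x ≠ 0 → 3/4 ≤ ‖x‖ ∧ ‖x‖ ≤ 8/3) {S : ℝ≥0}
    (hS : ∀ x, ‖φ x‖ₑ ≤ S) (ξ η : Rd d) :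
    ‖paraSym φ ξ η‖ ≤ (((3 * S) * (3 * S) : ℝ≥0) : ℝ) := by
  have := enorm_paraSym_le hφ3 hS ξ η
  rw [← coe_nnnorm]
  exact_mod_cast this

/-- The paraproduct is, on the Fourier side, a continuous function. -/
lemma continuous_addMarginal_para (hd : 1 ≤ d) (hφ : Continuous φ)
    (hφ3 : ∀ x : Rd d, φ x ≠ 0 → 3/4 ≤ ‖x‖ ∧ ‖x‖ ≤ 8/3) {S : ℝ≥0} (hS : ∀ x, ‖φ x‖ₑ ≤ S)
    {f g : Rd d → ℂ} (hf : Continuous f) {M : ℝ} (hM : ∀ ξ, ‖f ξ‖ ≤ M) (hg : Integrable g) :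
    Continuous (addMarginal fun z => paraSym φ z.1 z.2 * (f z.1 * g z.2)) := by
  have h0 : ∀ᵐ η : Rd d, η ≠ 0 := by
    filter_upwards [ae_coord_ne_zero (⟨0, hd⟩ : Fin d)] with η hη h
    simp [h] at hη
  refine continuous_iff_continuousAt.2 fun ζ₀ => ?_
  refine continuousAt_of_dominated
    (bound := fun η => (((3 * S) * (3 * S) : ℝ≥0) : ℝ) * (M * ‖g η‖))
    (Filter.Eventually.of_forall fun ζ => ?_) (Filter.Eventually.of_forall fun ζ =>
      Filter.Eventually.of_forall fun η => ?_) ((hg.norm.const_mul _).const_mul _) ?_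
  · refine AEStronglyMeasurable.mul ?_ (AEStronglyMeasurable.mul ?_ hg.aestronglyMeasurable)
    · exact ((measurable_paraSym hφ).comp
        (f := fun η : Rd d => (ζ - η, η)) (by fun_prop)).aestronglyMeasurable
    · exact (hf.comp (by fun_prop : Continuous fun η : Rd d => ζ - η)).aestronglyMeasurable
  · rw [norm_mul, norm_mul]
    have hM0 : 0 ≤ M := (norm_nonneg _).trans (hM 0)
    have h1 := norm_paraSym_le hφ3 hS (ζ - η) η
    have h2 := hM (ζ - η)
    gcongr
  · have hsub : ∀ᵐ η : Rd d, ζ₀ - η ≠ 0 :=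
      (Measure.measurePreserving_sub_left volume ζ₀).quasiMeasurePreserving.ae h0
    filter_upwards [h0, hsub] with η hη hsη
    have hs : ContinuousAt (fun ζ : Rd d => ζ - η) ζ₀ := by fun_prop
    refine ContinuousAt.mul ?_ ((hf.continuousAt.comp hs).mul continuousAt_const)
    exact ContinuousAt.comp (f := fun ζ : Rd d => ζ - η) (g := fun ξ => paraSym φ ξ η)
      (continuousAt_paraSym hφ hφ3 hsη hη) hs

lemma continuous_exp_mul_sum_abs (τ : ℝ) :
    Continuous fun ξ : Rd d => (Real.exp (τ * ∑ i, |ξ i|) : ℂ) := by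
  fun_prop

lemma norm_exp_neg_mul_sum_abs_le {τ : ℝ} (hτ : 0 ≤ τ) (ξ : Rd d) :
    ‖(Real.exp (-τ * ∑ i, |ξ i|) : ℂ)‖ ≤ 1 := by
  rw [Complex.norm_real, Real.norm_of_nonneg (Real.exp_pos _).le, Real.exp_le_one_iff]
  exact mul_nonpos_of_nonpos_of_nonneg (neg_nonpos.2 hτ) (Finset.sum_nonneg fun _ _ => abs_nonneg _)

lemma exists_fourier_expL1_neg_eq {τ : ℝ} (hτ : 0 ≤ τ) {f : Rd d → ℂ} (hf : Continuous (𝓕 f))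
    (hi : Integrable (𝓕 f)) : ∃ c : ℂ, ‖c‖ ≤ 1 ∧
      𝓕 (expL1 d (-τ) f) = fun ξ => c * ((Real.exp (-τ * ∑ i, |ξ i|) : ℂ) * 𝓕 f ξ) := by
  obtain ⟨c, hc, h⟩ := exists_fourier_fourierInv_eq_mul
    ((continuous_exp_mul_sum_abs (-τ)).mul hf)
    (hi.bdd_mul (c := 1) (continuous_exp_mul_sum_abs (-τ)).aestronglyMeasurable
      (Filter.Eventually.of_forall (norm_exp_neg_mul_sum_abs_le hτ)))
  exact ⟨c, hc, funext h⟩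

lemma gevSym_le_one {τ : ℝ} (hτ : 0 ≤ τ) (ξ η : Rd d) : gevSym τ ξ η ≤ 1 := by
  rw [gevSym, Real.exp_le_one_iff]
  refine mul_nonpos_of_nonneg_of_nonpos hτ ?_
  have : ∑ i, |ξ i + η i| ≤ ∑ i, |ξ i| + ∑ i, |η i| := by
    rw [← Finset.sum_add_distrib]
    exact Finset.sum_le_sum fun i _ => abs_add_le _ _
  linarith

lemma exp_mul_exp_neg_mul_exp_neg (τ : ℝ) (ξ η : Rd d) :
    (Real.exp (τ * ∑ i, |(ξ + η) i|) : ℂ) * ((Real.exp (-τ * ∑ i, |ξ i|) : ℂ)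
      * (Real.exp (-τ * ∑ i, |η i|) : ℂ)) = (gevSym τ ξ η : ℂ) := by
  rw [← Complex.ofReal_mul, ← Complex.ofReal_mul, ← Real.exp_add, ← Real.exp_add, gevSym]
  congr 2
  simp only [PiLp.add_apply]
  ring

lemma continuous_gevSym (τ : ℝ) :
    Continuous fun z : Rd d × Rd d => (gevSym τ z.1 z.2 : ℂ) := by
  unfold gevSym
  fun_prop

/-- A block of the Gevrey paraproduct as an oscillatory integral over pairs of frequencies. -/
lemma exists_LPblock_expL1_para_eq (hd : 1 ≤ d) (hφ : Continuous φ)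
    (hφ3 : ∀ x : Rd d, φ x ≠ 0 → 3/4 ≤ ‖x‖ ∧ ‖x‖ ≤ 8/3) {S : ℝ≥0} (hS : ∀ x, ‖φ x‖ₑ ≤ S)
    {τ : ℝ} (hτ : 0 ≤ τ) {f g : Rd d → ℂ} (hf : Continuous (𝓕 f)) (hfi : Integrable (𝓕 f))
    {M : ℝ} (hM : ∀ ξ, ‖𝓕 f ξ‖ ≤ M) (hg : Continuous (𝓕 g)) (hgi : Integrable (𝓕 g)) (m : ℤ) :
    ∃ c : ℂ, ‖c‖ ≤ 1 ∧
      LPblock d φ m (expL1 d τ (para d φ (expL1 d (-τ) f) (expL1 d (-τ) g)))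
        = fun x => c * osc (volume.prod volume) (fun z : Rd d × Rd d => z.1 + z.2)
          (fun z => (dil φ m (z.1 + z.2) : ℂ) * (paraSym φ z.1 z.2
            * ((gevSym τ z.1 z.2 : ℂ) * (𝓕 f z.1 * 𝓕 g z.2)))) x := by
  obtain ⟨ca, hca, ha⟩ := exists_fourier_expL1_neg_eq hτ hf hfi
  obtain ⟨cb, hcb, hb⟩ := exists_fourier_expL1_neg_eq hτ hg hgi
  have hE := continuous_exp_mul_sum_abs (d := d)
  have hInt {u : Rd d → ℂ} (hu : Integrable u) (c : ℂ) :
      Integrable fun ξ => c * ((Real.exp (-τ * ∑ i, |ξ i|) : ℂ) * u ξ) :=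
    (hu.bdd_mul (c := 1) (hE (-τ)).aestronglyMeasurable
      (Filter.Eventually.of_forall (norm_exp_neg_mul_sum_abs_le hτ))).const_mul c
  have hpara : AEStronglyMeasurable (fun z : Rd d × Rd d => paraSym φ z.1 z.2)
    (volume.prod volume) := (measurable_paraSym hφ).aestronglyMeasurable
  have hparab : ∀ᵐ z : Rd d × Rd d ∂(volume.prod volume), ‖paraSym φ z.1 z.2‖
      ≤ (((3 * S) * (3 * S) : ℝ≥0) : ℝ) :=
    Filter.Eventually.of_forall fun z => norm_paraSym_le hφ3 hS _ _
  set u : Rd d → ℂ := 𝓕 (expL1 d (-τ) f) with hu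
  set v : Rd d → ℂ := 𝓕 (expL1 d (-τ) g) with hv
  have hui : Integrable u := ha ▸ hInt hfi ca
  have hvi : Integrable v := hb ▸ hInt hgi cb
  have huc : Continuous u := by
    rw [ha]
    exact continuous_const.mul ((hE _).mul hf)
  have huM (ξ : Rd d) : ‖u ξ‖ ≤ M := by
    rw [ha, norm_mul, norm_mul, ← one_mul M, ← one_mul M]
    have := norm_exp_neg_mul_sum_abs_le hτ ξ
    have := hM ξ
    gcongr
  set P : Rd d × Rd d → ℂ := fun z => paraSym φ z.1 z.2 * (u z.1 * v z.2) with hP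
  set Q : Rd d × Rd d → ℂ := fun z => paraSym φ z.1 z.2
    * ((gevSym τ z.1 z.2 : ℂ) * (𝓕 f z.1 * 𝓕 g z.2)) with hQ
  have hPi : Integrable P (volume.prod volume) := (hui.mul_prod hvi).bdd_mul hpara hparab
  have hQi : Integrable Q (volume.prod volume) := by
    refine ((hfi.mul_prod hgi).bdd_mul (c := 1) (continuous_gevSym τ).aestronglyMeasurable
      (Filter.Eventually.of_forall fun z => ?_)).bdd_mul hpara hparab
    rw [Complex.norm_real, Real.norm_of_nonneg (show 0 ≤ gevSym τ z.1 z.2 from (Real.exp_pos _).le)]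
    exact gevSym_le_one hτ _ _
  have hEP (ζ : Rd d) : (Real.exp (τ * ∑ i, |ζ i|) : ℂ) * addMarginal P ζ
      = ca * cb * addMarginal Q ζ := by
    rw [mul_addMarginal (fun ζ => (Real.exp (τ * ∑ i, |ζ i|) : ℂ)),
      mul_addMarginal (fun _ => ca * cb)]
    congr 1 with z
    simp only [hP, hQ, ha, hb]
    rw [← exp_mul_exp_neg_mul_exp_neg]
    ring
  have hGP : Continuous (addMarginal P) := continuous_addMarginal_para hd hφ hφ3 hS huc huM hvi
  obtain ⟨c₁, hc₁, h₁⟩ := exists_fourier_fourierInv_eq_mul hGP (integrable_addMarginal hPi)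
  have hexp : expL1 d τ (para d φ (expL1 d (-τ) f) (expL1 d (-τ) g))
      = 𝓕⁻ fun ζ => c₁ * (ca * cb * addMarginal Q ζ) := by
    rw [para_eq_osc hφ hφ3 hS hui hvi, osc_add_eq hPi, expL1]
    congr 1 with ζ
    rw [h₁, ← hEP]
    ring
  have hcont : Continuous fun ζ => c₁ * (ca * cb * addMarginal Q ζ) := by
    simp only [← hEP]
    exact continuous_const.mul ((hE τ).mul hGP)
  obtain ⟨c₂, hc₂, h₂⟩ := exists_fourier_fourierInv_eq_mul hcont
    (((integrable_addMarginal hQi).const_mul _).const_mul _)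
  have hφc : HasCompactSupport φ := by
    refine HasCompactSupport.of_support_subset_isCompact (isCompact_closedBall (0 : Rd d) (8/3))
      fun x hx => ?_
    simpa using (hφ3 x hx).2
  have hdQ : Integrable (fun z : Rd d × Rd d => (dil φ m (z.1 + z.2) : ℂ) * Q z)
      (volume.prod volume) :=
    integrable_symbol_mul hφ hφc hQi (ζ := fun z : Rd d × Rd d => (2:ℝ) ^ (-m) • (z.1 + z.2))
      (by fun_prop)
  refine ⟨c₂ * (c₁ * (ca * cb)), ?_, ?_⟩
  · rw [norm_mul, norm_mul, norm_mul]
    exact mul_le_one₀ hc₂ (by positivity) (mul_le_one₀ hc₁ (by positivity)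
      (mul_le_one₀ hca (by positivity) hcb))
  · ext x
    rw [hexp, LPblock_eq_osc, osc_add_eq hdQ, fourierInv_eq_osc (addMarginal _), ← osc_const_mul]
    congr 1 with ζ
    rw [h₂, ← mul_addMarginal (fun ζ => (dil φ m ζ : ℂ))]
    ring

end Unfold

lemma eLpNorm_tsum_le {X : Type*} [MeasurableSpace X] {ν : Measure X} {u : ℤ → X → ℂ}
    (hu : ∀ k, Measurable (u k)) {p : ℝ} (hp : 1 < p) :
    eLpNorm (fun x => ∑' k, u k x) (ENNReal.ofReal p) ν
      ≤ ∑' k, eLpNorm (u k) (ENNReal.ofReal p) ν := by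
  have hp0 : 0 < p := by linarith
  have hform {ε : Type} [TopologicalSpace ε] [ESeminormedAddMonoid ε] (v : X → ε) :
      eLpNorm v (ENNReal.ofReal p) ν = (∫⁻ x, ‖v x‖ₑ ^ p ∂ν) ^ (1 / p) := by
    rw [eLpNorm_eq_lintegral_rpow_enorm_toReal (by simpa using hp0) ENNReal.ofReal_ne_top,
      ENNReal.toReal_ofReal hp0.le]
  set T : ℕ → X → ℝ≥0∞ := fun n x => ∑ k ∈ Finset.Icc (-(n:ℤ)) n, ‖u k x‖ₑ with hTdef
  have hT (n : ℕ) : ∫⁻ x, T n x ^ p ∂ν ≤ (∑' k, eLpNorm (u k) (ENNReal.ofReal p) ν) ^ p := by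
    have h1 : eLpNorm (T n) (ENNReal.ofReal p) ν ≤ ∑' k, eLpNorm (u k) (ENNReal.ofReal p) ν := by
      have e : T n = ∑ k ∈ Finset.Icc (-(n:ℤ)) n, fun x => ‖u k x‖ₑ := by
        ext x
        simp [hTdef]
      rw [e]
      refine (eLpNorm_sum_le (fun k _ => (hu k).enorm.aestronglyMeasurable) ?_).trans ?_
      · rw [← ENNReal.ofReal_one]
        exact ENNReal.ofReal_le_ofReal hp.le
      · simp only [eLpNorm_enorm]
        exact ENNReal.sum_le_tsum _
    rw [hform, one_div, ENNReal.rpow_inv_le_iff hp0] at h1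
    exact h1
  rw [hform, one_div, ENNReal.rpow_inv_le_iff hp0]
  calc ∫⁻ x, ‖∑' k, u k x‖ₑ ^ p ∂ν
      ≤ ∫⁻ x, Filter.liminf (fun n => T n x ^ p) Filter.atTop ∂ν := by
        refine lintegral_mono fun x => ?_
        have hlim : Filter.Tendsto (fun n => T n x ^ p) Filter.atTop
            (nhds ((∑' k, ‖u k x‖ₑ) ^ p)) :=
          (ENNReal.continuous_rpow_const.tendsto _).comp
            (ENNReal.summable.hasSum.comp Finset.tendsto_Icc_neg)
        rw [hlim.liminf_eq]
        exact ENNReal.rpow_le_rpow enorm_tsum_le_tsum_enorm hp0.le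
    _ ≤ Filter.liminf (fun n => ∫⁻ x, T n x ^ p ∂ν) Filter.atTop :=
        lintegral_liminf_le fun n =>
          (Finset.measurable_sum _ fun k _ => (hu k).enorm).pow_const p
    _ ≤ _ := Filter.liminf_le_of_le (by isBoundedDefault) fun b hb => by
        obtain ⟨n, hn⟩ := hb.exists
        exact hn.trans (hT n)

section Blocks

variable {d : ℕ} {φ : Rd d → ℝ}

lemma hasCompactSupport_of_annulus (hφ3 : ∀ x : Rd d, φ x ≠ 0 → 3/4 ≤ ‖x‖ ∧ ‖x‖ ≤ 8/3) :
    HasCompactSupport φ :=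
  HasCompactSupport.of_support_subset_isCompact (isCompact_closedBall (0 : Rd d) (8/3))
    fun x hx => by simpa using (hφ3 x hx).2

lemma integrable_dil_mul (hφ : Continuous φ)
    (hφ3 : ∀ x : Rd d, φ x ≠ 0 → 3/4 ≤ ‖x‖ ∧ ‖x‖ ≤ 8/3) {h : Rd d → ℂ} (hh : Integrable h)
    (k : ℤ) : Integrable fun ξ => (dil φ k ξ : ℂ) * h ξ :=
  integrable_symbol_mul hφ (hasCompactSupport_of_annulus hφ3) hh
    (ζ := fun ξ : Rd d => (2:ℝ) ^ (-k) • ξ) (by fun_prop)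

lemma integrable_lowSym_mul (hφ : Continuous φ)
    (hφ3 : ∀ x : Rd d, φ x ≠ 0 → 3/4 ≤ ‖x‖ ∧ ‖x‖ ≤ 8/3) {S : ℝ≥0} (hS : ∀ x, ‖φ x‖ₑ ≤ S)
    {h : Rd d → ℂ} (hh : Integrable h) (j : ℤ) : Integrable fun ξ => lowSym φ j ξ * h ξ := by
  refine hh.bdd_mul (c := ((3 * S : ℝ≥0) : ℝ)) (measurable_lowSym hφ j).aestronglyMeasurable
    (Filter.Eventually.of_forall fun ξ => ?_)
  have := enorm_lowSym_le hφ3 hS j ξ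
  rw [← coe_nnnorm]
  exact_mod_cast this

lemma eLpNorm_osc_lowSym_le (hφ : Continuous φ)
    (hφ3 : ∀ x : Rd d, φ x ≠ 0 → 3/4 ≤ ‖x‖ ∧ ‖x‖ ≤ 8/3) {S : ℝ≥0} (hS : ∀ x, ‖φ x‖ₑ ≤ S)
    {h : Rd d → ℂ} (hh : Integrable h) {r : ℝ} (hr : 1 < r) (j : ℤ) :
    eLpNorm (osc volume id fun ξ => lowSym φ j ξ * h ξ) (ENNReal.ofReal r) volume
      ≤ ∑' k : ℤ, if k ≤ j - 2 then
          eLpNorm (osc volume id fun ξ => (dil φ k ξ : ℂ) * h ξ) (ENNReal.ofReal r) volume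
        else 0 := by
  rw [funext (osc_lowSym_mul hφ hφ3 hS hh j)]
  refine (eLpNorm_tsum_le (fun k => ?_) hr).trans (ENNReal.tsum_le_tsum fun k => ?_)
  · split_ifs
    · exact (continuous_osc (integrable_dil_mul hφ hφ3 hh k) measurable_id).measurable
    · exact measurable_const
  · split_ifs <;> simp

lemma dil_mul_paraSym_eq_sum (hφ3 : ∀ x : Rd d, φ x ≠ 0 → 3/4 ≤ ‖x‖ ∧ ‖x‖ ≤ 8/3) (m : ℤ)
    (ξ η : Rd d) : (dil φ m (ξ + η) : ℂ) * paraSym φ ξ η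
      = ∑ j ∈ Finset.Icc (m - 2) (m + 5),
          (dil φ m (ξ + η) : ℂ) * (lowSym φ j ξ * (dil φ j η : ℂ)) := by
  rw [← Finset.mul_sum]
  by_cases h : dil φ m (ξ + η) = 0
  · simp [h]
  congr 1
  refine tsum_eq_sum fun j hj => ?_
  by_contra hne
  refine hj (mem_Icc_of_symbol_ne_zero hφ3 h (left_ne_zero_of_mul hne) ?_)
  exact_mod_cast right_ne_zero_of_mul hne

lemma exists_eLpNorm_block_para_le {r t q : ℝ} (hr : 1 < r) (ht : 1 < t) (hq : 1 < q)
    (hrtq : 1 / r + 1 / t = 1 / q) (hφ1 : ContDiff ℝ (⊤ : ℕ∞) φ)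
    (hφ3 : ∀ x : Rd d, φ x ≠ 0 → 3/4 ≤ ‖x‖ ∧ ‖x‖ ≤ 8/3) {S : ℝ≥0} (hS : ∀ x, ‖φ x‖ₑ ≤ S) :
    ∃ C : ℝ≥0, ∀ τ : ℝ, 0 ≤ τ → ∀ f g : Rd d → ℂ, Integrable f → Integrable g → ∀ m : ℤ,
      eLpNorm (osc (volume.prod volume) (fun z : Rd d × Rd d => z.1 + z.2)
          fun z => (dil φ m (z.1 + z.2) : ℂ) * (paraSym φ z.1 z.2
            * ((gevSym τ z.1 z.2 : ℂ) * (f z.1 * g z.2)))) (ENNReal.ofReal q) volume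
        ≤ ∑ j ∈ Finset.Icc (m - 2) (m + 5), C * (∑' k : ℤ, if k ≤ j - 2 then
            eLpNorm (osc volume id fun ξ => (dil φ k ξ : ℂ) * f ξ) (ENNReal.ofReal r) volume
          else 0) *
          eLpNorm (osc volume id fun ξ => (dil φ j ξ : ℂ) * g ξ) (ENNReal.ofReal t) volume := by
  obtain ⟨C₁, hC₁⟩ := exists_eLpNorm_osc_symbol_le hq hφ1 (hasCompactSupport_of_annulus hφ3)
  obtain ⟨C₂, hC₂⟩ := exists_eLpNorm_gevSym_le hr ht hq hrtq d
  refine ⟨C₁ * C₂, fun τ hτ f g hf hg m => ?_⟩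
  have hφ := hφ1.continuous
  have hadd : Measurable fun z : Rd d × Rd d => z.1 + z.2 := by fun_prop
  set H : ℤ → Rd d × Rd d → ℂ := fun j z => (gevSym τ z.1 z.2 : ℂ)
    * ((lowSym φ j z.1 * f z.1) * ((dil φ j z.2 : ℂ) * g z.2)) with hHdef
  have hH (j : ℤ) : Integrable (H j) (volume.prod volume) := by
    refine ((integrable_lowSym_mul hφ hφ3 hS hf j).mul_prod
      (integrable_dil_mul hφ hφ3 hg j)).bdd_mul (c := 1)
      (continuous_gevSym τ).aestronglyMeasurable (Filter.Eventually.of_forall fun z => ?_)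
    rw [Complex.norm_real, Real.norm_of_nonneg (show 0 ≤ gevSym τ z.1 z.2 from (Real.exp_pos _).le)]
    exact gevSym_le_one hτ _ _
  have hdH (j : ℤ) : Integrable (fun z => (dil φ m (z.1 + z.2) : ℂ) * H j z)
      (volume.prod volume) :=
    integrable_symbol_mul hφ (hasCompactSupport_of_annulus hφ3) (hH j)
      (ζ := fun z : Rd d × Rd d => (2:ℝ) ^ (-m) • (z.1 + z.2)) (by fun_prop)
  have hsum : (fun z : Rd d × Rd d => (dil φ m (z.1 + z.2) : ℂ) * (paraSym φ z.1 z.2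
      * ((gevSym τ z.1 z.2 : ℂ) * (f z.1 * g z.2))))
      = fun z => ∑ j ∈ Finset.Icc (m - 2) (m + 5), (dil φ m (z.1 + z.2) : ℂ) * H j z := by
    ext z
    rw [← mul_assoc, dil_mul_paraSym_eq_sum hφ3, Finset.sum_mul]
    refine Finset.sum_congr rfl fun j _ => ?_
    simp only [hHdef]
    ring
  rw [hsum, osc_sum _ (fun j _ => hdH j) hadd]
  refine (eLpNorm_sum_le (fun j _ => (continuous_osc (hdH j) hadd).aestronglyMeasurable) ?_).trans
    (Finset.sum_le_sum fun j _ => ?_)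
  · rw [← ENNReal.ofReal_one]
    exact ENNReal.ofReal_le_ofReal hq.le
  · calc eLpNorm (osc (volume.prod volume) (fun z : Rd d × Rd d => z.1 + z.2)
          fun z => (dil φ m (z.1 + z.2) : ℂ) * H j z) (ENNReal.ofReal q) volume
        ≤ C₁ * eLpNorm (osc (volume.prod volume) (fun z : Rd d × Rd d => z.1 + z.2) (H j))
            (ENNReal.ofReal q) volume :=
          hC₁ (Rd d × Rd d) (volume.prod volume) (H j) (fun z => z.1 + z.2) (hH j) hadd
            ((2:ℝ) ^ (-m)) (by positivity)
      _ ≤ C₁ * (C₂ * (∑' k : ℤ, if k ≤ j - 2 then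
            eLpNorm (osc volume id fun ξ => (dil φ k ξ : ℂ) * f ξ) (ENNReal.ofReal r) volume
          else 0) *
          eLpNorm (osc volume id fun ξ => (dil φ j ξ : ℂ) * g ξ) (ENNReal.ofReal t) volume) := by
          gcongr
          refine (hC₂ τ hτ _ _ (integrable_lowSym_mul hφ hφ3 hS hf j)
            (integrable_dil_mul hφ hφ3 hg j)).trans ?_
          gcongr
          exact eLpNorm_osc_lowSym_le hφ hφ3 hS hf hr j
      _ = _ := by
          rw [ENNReal.coe_mul]
          ring

end Blocks

section Powers

/-- `2 ^ x` as an extended nonnegative real. -/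
def twoPow (x : ℝ) : ℝ≥0∞ := ENNReal.ofReal ((2:ℝ) ^ x)

lemma twoPow_add (x y : ℝ) : twoPow (x + y) = twoPow x * twoPow y := by
  rw [twoPow, Real.rpow_add two_pos, ENNReal.ofReal_mul (by positivity), twoPow, twoPow]

lemma twoPow_mono {x y : ℝ} (h : x ≤ y) : twoPow x ≤ twoPow y :=
  ENNReal.ofReal_le_ofReal (Real.rpow_le_rpow_of_exponent_le one_le_two h)

lemma twoPow_zero : twoPow 0 = 1 := by simp [twoPow]

lemma twoPow_ne_top (x : ℝ) : twoPow x ≠ ∞ := ENNReal.ofReal_ne_top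

lemma ofReal_zpow_rpow (k : ℤ) (x : ℝ) :
    ENNReal.ofReal (((2:ℝ) ^ k) ^ x) = twoPow ((k : ℝ) * x) := by
  rw [twoPow, Real.rpow_mul zero_le_two, Real.rpow_intCast]

lemma le_twoPow_neg_mul {x : ℝ} {a b : ℝ≥0∞} (h : twoPow x * a ≤ b) : a ≤ twoPow (-x) * b := by
  calc a = twoPow (-x) * (twoPow x * a) := by
        rw [← mul_assoc, ← twoPow_add, neg_add_cancel, twoPow_zero, one_mul]
    _ ≤ _ := mul_le_mul_right h _

lemma twoPow_natCast_mul (n : ℕ) (x : ℝ) : twoPow ((n : ℝ) * x) = twoPow x ^ n := by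
  rw [twoPow, twoPow, ← ENNReal.ofReal_pow (by positivity), mul_comm, Real.rpow_mul zero_le_two,
    Real.rpow_natCast]

lemma exists_tsum_twoPow_le {θ : ℝ} (hθ : 0 < θ) :
    ∃ K : ℝ≥0, ∀ j : ℤ, (∑' k : ℤ, if k ≤ j - 2 then twoPow ((k : ℝ) * θ) else 0)
      ≤ K * twoPow ((j : ℝ) * θ) := by
  have hlt : twoPow (-θ) < 1 := by
    rw [← ENNReal.ofReal_one]
    refine (ENNReal.ofReal_lt_ofReal_iff one_pos).2 ?_
    exact Real.rpow_lt_one_of_one_lt_of_neg one_lt_two (neg_neg_iff_pos.2 hθ)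
  have hfin : (1 - twoPow (-θ))⁻¹ ≠ ∞ := ENNReal.inv_ne_top.2 (tsub_pos_of_lt hlt).ne'
  refine ⟨((1 - twoPow (-θ))⁻¹).toNNReal, fun j => ?_⟩
  rw [ENNReal.coe_toNNReal hfin]
  have hinj : Function.Injective fun n : ℕ => j - (n : ℤ) := fun a b h => by
    simpa using h
  rw [← hinj.tsum_eq]
  · calc _ ≤ ∑' n : ℕ, twoPow (-θ) ^ n * twoPow ((j : ℝ) * θ) := by
          refine ENNReal.tsum_le_tsum fun n => ?_
          rw [← twoPow_natCast_mul, ← twoPow_add]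
          split_ifs
          · refine (congrArg twoPow ?_).le
            push_cast
            ring
          · exact bot_le
      _ = _ := by rw [ENNReal.tsum_mul_right, ENNReal.tsum_geometric]
  · intro k hk
    have hkj : k ≤ j - 2 := by
      by_contra hcon
      simp [hcon] at hk
    exact ⟨(j - k).toNat, by simp only []; omega⟩

end Powers

lemma exists_holder_exponents {d p q k₁ : ℝ} (hd : 1 ≤ d) (hp : 1 < p) (hq : 1 < q)
    (hk₁ : d * max 0 (1/q - 1/p) < k₁) (hpq : p ≤ 2 * q) :
    ∃ r t : ℝ, p ≤ r ∧ p ≤ t ∧ 1 / r + 1 / t = 1 / q ∧ d / r < k₁ := by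
  have hp0 : 0 < p := by linarith
  have hq0 : 0 < q := by linarith
  suffices h : ∃ x : ℝ, 0 < x ∧ x ≤ 1 / p ∧ x < 1 / q ∧ 1 / q - x ≤ 1 / p ∧ d * x < k₁ by
    obtain ⟨x, hx0, hxp, hxq, hqx, hdx⟩ := h
    refine ⟨1 / x, 1 / (1 / q - x), (le_one_div hp0 hx0).2 hxp,
      (le_one_div hp0 (sub_pos.2 hxq)).2 hqx, ?_, ?_⟩
    · rw [one_div_one_div, one_div_one_div]
      ring
    · rwa [div_div_eq_mul_div, div_one]
  rcases le_or_gt (1 / q) (1 / p) with h | h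
  · rw [max_eq_left (by linarith), mul_zero] at hk₁
    have h1 : 0 < 1 / p := by positivity
    have h2 : 0 < 1 / q := by positivity
    have h3 : 0 < k₁ / (2 * d) := by positivity
    refine ⟨min (1 / q / 2) (k₁ / (2 * d)), lt_min (by linarith) h3, ?_, ?_, ?_, ?_⟩
    · exact (min_le_left _ _).trans (by linarith)
    · exact (min_le_left _ _).trans_lt (by linarith)
    · have := lt_min (half_pos h2) h3
      linarith
    · calc d * min (1 / q / 2) (k₁ / (2 * d)) ≤ d * (k₁ / (2 * d)) := by
            gcongr
            exact min_le_right _ _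
        _ = k₁ / 2 := by field_simp
        _ < k₁ := by linarith
  · rw [max_eq_right (by linarith)] at hk₁
    refine ⟨1 / q - 1 / p, by linarith, ?_, ?_, by linarith, hk₁⟩
    · have : 1 / q ≤ 2 / p := by
        rw [div_le_div_iff₀ hq0 hp0]
        linarith
      have e : 2 / p = 1 / p + 1 / p := by ring
      linarith
    · have : 0 < 1 / p := by positivity
      linarith

lemma besovNorm_top_eq {d : ℕ} (φ : Rd d → ℝ) (s : ℝ) (p : ℝ≥0∞) (f : Rd d → ℂ) :
    besovNorm d φ s p ∞ f = ⨆ j : ℤ, twoPow ((j : ℝ) * s) * eLpNorm (LPblock d φ j f) p volume := by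
  simp [besovNorm, seqNorm, twoPow]

lemma eLpNorm_LPblock_le {d : ℕ} (φ : Rd d → ℝ) (s : ℝ) (p : ℝ≥0∞) (f : Rd d → ℂ) (k : ℤ) :
    eLpNorm (LPblock d φ k f) p volume ≤ twoPow (-((k : ℝ) * s)) * besovNorm d φ s p ∞ f := by
  refine le_twoPow_neg_mul ?_
  rw [besovNorm_top_eq]
  exact le_iSup (fun j : ℤ => twoPow ((j : ℝ) * s) * eLpNorm (LPblock d φ j f) p volume) k

/-- Bernstein bound for a single dyadic block. -/
lemma exists_eLpNorm_LPblock_bernstein {d : ℕ} {φ : Rd d → ℝ} (hφ : Continuous φ)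
    (hφ3 : ∀ x : Rd d, φ x ≠ 0 → 3/4 ≤ ‖x‖ ∧ ‖x‖ ≤ 8/3) {p r : ℝ} (hp : 1 < p) (hr : p ≤ r) :
    ∃ C : ℝ≥0, ∀ f : Rd d → ℂ, Integrable (𝓕 f) → ∀ (s : ℝ) (k : ℤ),
      eLpNorm (osc volume id fun ξ => (dil φ k ξ : ℂ) * 𝓕 f ξ) (ENNReal.ofReal r) volume
        ≤ C * twoPow ((k : ℝ) * ((d : ℝ) / p - (d : ℝ) / r - s))
          * besovNorm d φ s (ENNReal.ofReal p) ∞ f := by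
  obtain ⟨C, hC⟩ := exists_eLpNorm_osc_bernstein hp hr d
  refine ⟨C, fun f hf s k => ?_⟩
  calc _ ≤ C * ENNReal.ofReal (((2:ℝ) ^ k) ^ ((d : ℝ) / p - (d : ℝ) / r))
          * eLpNorm (LPblock d φ k f) (ENNReal.ofReal p) volume := by
        rw [LPblock_eq_osc]
        refine hC (Rd d) volume _ id (integrable_dil_mul hφ hφ3 hf k) measurable_id _
          (by positivity) fun ξ hξ => ?_
        have hne : dil φ k ξ ≠ 0 := by exact_mod_cast left_ne_zero_of_mul hξ
        have h2 : (0:ℝ) < 2 ^ k := by positivity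
        have := (norm_bounds_of_dil_ne_zero hφ3 hne).2
        simp only [id]
        linarith
    _ ≤ C * ENNReal.ofReal (((2:ℝ) ^ k) ^ ((d : ℝ) / p - (d : ℝ) / r))
          * (twoPow (-((k : ℝ) * s)) * besovNorm d φ s (ENNReal.ofReal p) ∞ f) :=
        mul_le_mul_right (eLpNorm_LPblock_le _ _ _ _ _) _
    _ = _ := by
        rw [ofReal_zpow_rpow, mul_assoc, mul_assoc, ← mul_assoc (twoPow _), ← twoPow_add]
        congr 3
        ring

/-- Gevrey paraproduct estimate: for 1 < p,q < ∞ with k₁ > d·max(0, 1/q − 1/p) and p ≤ 2q,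
uniformly in τ ≥ 0, ‖e^{τΛ₁}T_a b‖_{Ḃ^{s−k+d/q−d/p}_{q,∞}} ≲
‖A‖_{Ḃ^{d/p−k₁}_{p,∞}}·‖B‖_{Ḃ^{s−k₂}_{p,∞}} where a = e^{−τΛ₁}A, b = e^{−τΛ₁}B. -/
theorem gevrey_paraproduct_estimate
    (d : ℕ) (hd : 1 ≤ d) (φ : Rd d → ℝ)
    (hφ1 : ContDiff ℝ (⊤ : ℕ∞) φ)
    (hφ2 : ∀ x y : Rd d, ‖x‖ = ‖y‖ → φ x = φ y)
    (hφ3 : ∀ x : Rd d, φ x ≠ 0 → 3/4 ≤ ‖x‖ ∧ ‖x‖ ≤ 8/3)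
    (hφ4 : ∀ ξ : Rd d, ξ ≠ 0 → ∑' j : ℤ, φ (((2:ℝ) ^ (-j)) • ξ) = 1)
    (p q : ℝ) (hp1 : 1 < p) (hq1 : 1 < q)
    (s k₁ k₂ : ℝ)
    (hk₁ : (d : ℝ) * max 0 (1/q - 1/p) < k₁)
    (hpq : p ≤ 2 * q) :
    ∃ C : ℝ, 0 < C ∧ ∀ τ : ℝ, 0 ≤ τ → ∀ A B : 𝓢(Rd d, ℂ),
      besovNorm d φ (s - (k₁ + k₂) + (d : ℝ)/q - (d : ℝ)/p) (ENNReal.ofReal q) ∞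
          (expL1 d τ (para d φ (expL1 d (-τ) A) (expL1 d (-τ) B)))
        ≤ ENNReal.ofReal C
            * besovNorm d φ ((d : ℝ)/p - k₁) (ENNReal.ofReal p) ∞ A
            * besovNorm d φ (s - k₂) (ENNReal.ofReal p) ∞ B := by
  have hφ := hφ1.continuous
  obtain ⟨S, hS⟩ : ∃ S : ℝ≥0, ∀ x, ‖φ x‖ₑ ≤ S := by
    obtain ⟨C, hC⟩ := hφ.bounded_above_of_compact_support (hasCompactSupport_of_annulus hφ3)
    refine ⟨C.toNNReal, fun x => ?_⟩
    rw [← ofReal_norm]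
    exact ENNReal.ofReal_le_ofReal (hC x)
  obtain ⟨r, t, hpr, hpt, hrtq, hdr⟩ :=
    exists_holder_exponents (d := d) (by exact_mod_cast hd) hp1 hq1 hk₁ hpq
  obtain ⟨C₁, hC₁⟩ := exists_eLpNorm_block_para_le (hp1.trans_le hpr) (hp1.trans_le hpt) hq1 hrtq
    hφ1 hφ3 hS
  obtain ⟨C₂, hC₂⟩ := exists_eLpNorm_LPblock_bernstein hφ hφ3 hp1 hpr
  obtain ⟨C₃, hC₃⟩ := exists_eLpNorm_LPblock_bernstein hφ hφ3 hp1 hpt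
  obtain ⟨K, hK⟩ := exists_tsum_twoPow_le (sub_pos.2 hdr)
  set α : ℝ := s - (k₁ + k₂) + (d : ℝ)/q - (d : ℝ)/p with hα
  set L : ℝ≥0∞ := 8 * (C₁ * C₂ * K * C₃ * twoPow (5 * |α|)) with hL
  have hLfin : L ≠ ∞ := by
    simp [hL, ENNReal.mul_eq_top, twoPow_ne_top]
  refine ⟨L.toReal + 1, by positivity, fun τ hτ A B => ?_⟩
  set NA := besovNorm d φ ((d : ℝ)/p - k₁) (ENNReal.ofReal p) ∞ A with hNA
  set NB := besovNorm d φ (s - k₂) (ENNReal.ofReal p) ∞ B with hNB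
  have hcont (F : 𝓢(Rd d, ℂ)) : Continuous (𝓕 (F : Rd d → ℂ)) := by
    rw [← SchwartzMap.fourier_coe]
    exact (𝓕 F).continuous
  have hInt (F : 𝓢(Rd d, ℂ)) : Integrable (𝓕 (F : Rd d → ℂ)) := by
    rw [← SchwartzMap.fourier_coe]
    exact (𝓕 F).integrable
  obtain ⟨M, hM⟩ : ∃ M : ℝ, ∀ ξ, ‖𝓕 (A : Rd d → ℂ) ξ‖ ≤ M := by
    rw [← SchwartzMap.fourier_coe]
    obtain ⟨M, -, hM⟩ := (𝓕 A).decay 0 0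
    exact ⟨M, fun ξ => by simpa using hM ξ⟩
  have hexp : (d : ℝ) / r + (d : ℝ) / t = (d : ℝ) / q := by
    rw [div_eq_mul_one_div, div_eq_mul_one_div _ t, ← mul_add, hrtq, mul_one_div]
  have hlow (j : ℤ) : (∑' k : ℤ, if k ≤ j - 2 then
      eLpNorm (osc volume id fun ξ => (dil φ k ξ : ℂ) * 𝓕 (A : Rd d → ℂ) ξ)
        (ENNReal.ofReal r) volume else 0) ≤ C₂ * NA * (K * twoPow ((j : ℝ) * (k₁ - d / r))) := by
    refine le_trans ?_ (mul_le_mul_right (hK j) _)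
    rw [← ENNReal.tsum_mul_left]
    refine ENNReal.tsum_le_tsum fun k => ?_
    split_ifs
    · refine (hC₂ A (hInt A) ((d : ℝ)/p - k₁) k).trans (le_of_eq ?_)
      rw [show (d : ℝ) / p - d / r - (d / p - k₁) = k₁ - d / r by ring]
      ring
    · exact bot_le
  have hterm (m : ℤ) (j : ℤ) (hj : j ∈ Finset.Icc (m - 2) (m + 5)) :
      twoPow ((m : ℝ) * α) * (C₁ * (∑' k : ℤ, if k ≤ j - 2 then
        eLpNorm (osc volume id fun ξ => (dil φ k ξ : ℂ) * 𝓕 (A : Rd d → ℂ) ξ)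
          (ENNReal.ofReal r) volume else 0) *
        eLpNorm (osc volume id fun ξ => (dil φ j ξ : ℂ) * 𝓕 (B : Rd d → ℂ) ξ)
          (ENNReal.ofReal t) volume)
        ≤ C₁ * C₂ * K * C₃ * twoPow (5 * |α|) * (NA * NB) := by
    calc _ ≤ twoPow ((m : ℝ) * α) * (C₁ * (C₂ * NA * (K * twoPow ((j : ℝ) * (k₁ - d / r))))
          * (C₃ * twoPow ((j : ℝ) * ((d : ℝ) / p - (d : ℝ) / t - (s - k₂))) * NB)) := by
          gcongr
          · exact hlow j
          · exact hC₃ B (hInt B) _ j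
      _ = C₁ * C₂ * K * C₃ * (twoPow ((m : ℝ) * α) * (twoPow ((j : ℝ) * (k₁ - d / r))
          * twoPow ((j : ℝ) * ((d : ℝ) / p - (d : ℝ) / t - (s - k₂))))) * (NA * NB) := by
          ring
      _ ≤ _ := by
          rw [← twoPow_add, ← twoPow_add]
          gcongr
          refine twoPow_mono ?_
          have e : (m : ℝ) * α + ((j : ℝ) * (k₁ - d / r)
              + (j : ℝ) * ((d : ℝ) / p - (d : ℝ) / t - (s - k₂))) = ((m : ℝ) - j) * α := by
            rw [hα, ← hexp]
            ring
          rw [e]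
          obtain ⟨h1, h2⟩ := Finset.mem_Icc.1 hj
          have h1' : (m : ℝ) - 2 ≤ j := by exact_mod_cast h1
          have h2' : (j : ℝ) ≤ m + 5 := by exact_mod_cast h2
          refine (le_abs_self _).trans ?_
          rw [abs_mul]
          gcongr
          exact abs_le.2 ⟨by linarith, by linarith⟩
  rw [besovNorm_top_eq]
  refine iSup_le fun m => ?_
  obtain ⟨c, hc, hblock⟩ := exists_LPblock_expL1_para_eq hd hφ hφ3 hS hτ (hcont A) (hInt A) hM
    (hcont B) (hInt B) m
  rw [hblock]
  calc _ ≤ twoPow ((m : ℝ) * α) * ∑ j ∈ Finset.Icc (m - 2) (m + 5), C₁ * (∑' k : ℤ,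
        if k ≤ j - 2 then eLpNorm (osc volume id fun ξ => (dil φ k ξ : ℂ) * 𝓕 (A : Rd d → ℂ) ξ)
          (ENNReal.ofReal r) volume else 0) *
        eLpNorm (osc volume id fun ξ => (dil φ j ξ : ℂ) * 𝓕 (B : Rd d → ℂ) ξ)
          (ENNReal.ofReal t) volume := by
        refine mul_le_mul_right (le_trans ?_ (hC₁ τ hτ _ _ (hInt A) (hInt B) m)) _
        refine eLpNorm_mono fun x => ?_
        rw [norm_mul]
        exact mul_le_of_le_one_left (norm_nonneg _) hc
    _ ≤ L * (NA * NB) := by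
        rw [Finset.mul_sum]
        refine (Finset.sum_le_card_nsmul _ _ _ (hterm m)).trans (le_of_eq ?_)
        rw [Int.card_Icc, show (m + 5 + 1 - (m - 2)).toNat = 8 by omega, hL, nsmul_eq_mul]
        push_cast
        ring
    _ ≤ _ := by
        rw [← mul_assoc]
        gcongr
        rw [ENNReal.ofReal_add ENNReal.toReal_nonneg zero_le_one, ENNReal.ofReal_toReal hLfin]
        exact le_self_add
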